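/- Let α,β>−1 and let N≥1 be an integer. Define, for θ,φ∈(0,π) with θ≠φ, the kernel R̃_N^{α,β}(θ,φ)=(1/Γ(N))∫₀^∞ δ_N^odd H̃_t^{α,β}(θ,φ) t^{N−1} dt, where δ_N^odd acts in the variable θ and the integral converges absolutely. Then there exists a constant C such that for all θ,φ∈(0,π) with θ≠φ: |R̃_N^{α,β}(θ,φ)| ≤ C/μ⁺_{α,β}(B(θ,|θ−φ|)) and |∂_θ R̃_N^{α,β}(θ,φ)|+|∂_φ R̃_N^{α,β}(θ,φ)| ≤ C/(|θ−φ|·μ⁺_{α,β}(B(θ,|θ−φ|))). -/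

import Mathlib

open MeasureTheory Real Set
open scoped ENNReal

noncomputable section

/-- The classical Jacobi polynomial `P_n^{α,β}`. -/
def jacobiP (α β : ℝ) (n : ℕ) (x : ℝ) : ℝ :=
  ∑ m ∈ Finset.range (n + 1),
    (Real.Gamma (α + n + 1) * Real.Gamma (α + β + n + m + 1)) /
      ((m.factorial : ℝ) * ((n - m).factorial : ℝ) * Real.Gamma (α + β + n + 1) *
        Real.Gamma (α + m + 1)) * ((x - 1) / 2) ^ m

/-- `Ψ^{α,β}(θ) = |sin(θ/2)|^{α+1/2} (cos(θ/2))^{β+1/2}`. -/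
def jPsi (α β θ : ℝ) : ℝ := |Real.sin (θ / 2)| ^ (α + 1 / 2) * Real.cos (θ / 2) ^ (β + 1 / 2)

/-- The measure `μ_{α,β}` on `(−π, π)`, with density `(Ψ^{α,β})²` w.r.t. Lebesgue measure. -/
def jacobiMeasure (α β : ℝ) : Measure ℝ :=
  (volume.restrict (Ioo (-π) π)).withDensity fun θ => ENNReal.ofReal (jPsi α β θ ^ 2)

/-- The restriction `μ⁺_{α,β}` of `μ_{α,β}` to `(0, π)`. -/
def jacobiMeasurePlus (α β : ℝ) : Measure ℝ := (jacobiMeasure α β).restrict (Ioo 0 π)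

/-- The normalizing constant `c_n^{α,β}` making `𝒫_n^{α,β}` have unit `L²(μ⁺)` norm. -/
def cJ (α β : ℝ) (n : ℕ) : ℝ :=
  (∫ θ, jacobiP α β n (Real.cos θ) ^ 2 ∂(jacobiMeasurePlus α β)) ^ (-(1 / 2) : ℝ)

/-- The normalized trigonometric Jacobi polynomial `𝒫_n^{α,β}(θ)`. -/
def trigP (α β : ℝ) (n : ℕ) (θ : ℝ) : ℝ := cJ α β n * jacobiP α β n (Real.cos θ)

/-- The eigenvalue `λ_n^{α,β} = (n + (α+β+1)/2)²`. -/
def jLam (α β : ℝ) (n : ℕ) : ℝ := ((n : ℝ) + (α + β + 1) / 2) ^ 2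

/-- The symmetrized system `Φ_n^{α,β}`. -/
def symPhi (α β : ℝ) (n : ℕ) (θ : ℝ) : ℝ :=
  if Even n then (Real.sqrt 2)⁻¹ * trigP α β (n / 2) θ
  else (Real.sqrt 2)⁻¹ * (Real.sin θ / 2) * trigP (α + 1) (β + 1) ((n - 1) / 2) θ

/-- The Jacobi functions `φ_n^{α,β} = Ψ^{α,β} 𝒫_n^{α,β}`. -/
def phiFun (α β : ℝ) (n : ℕ) (θ : ℝ) : ℝ := jPsi α β θ * trigP α β n θ

/-- The symmetrized Jacobi function system `Θ_n^{α,β}`. -/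
def jTheta (α β : ℝ) (n : ℕ) (θ : ℝ) : ℝ :=
  if Even n then (Real.sqrt 2)⁻¹ * phiFun α β (n / 2) θ
  else (Real.sqrt 2)⁻¹ * Real.sign θ * phiFun (α + 1) (β + 1) ((n - 1) / 2) θ

/-- The symmetrized Jacobi–Poisson semigroup `ℍ_t^{α,β}f(θ)` (polynomial setting). -/
def symH (α β : ℝ) (f : ℝ → ℝ) (t θ : ℝ) : ℝ :=
  ∑' n : ℕ, Real.exp (-t * Real.sqrt (jLam α β ((n + 1) / 2))) *
    (∫ φ, f φ * symPhi α β n φ ∂(jacobiMeasure α β)) * symPhi α β n θ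

/-- The symmetrized Jacobi–Poisson semigroup `H̄_t^{α,β}f(θ)` (function setting). -/
def symHbar (α β : ℝ) (f : ℝ → ℝ) (t θ : ℝ) : ℝ :=
  ∑' n : ℕ, Real.exp (-t * Real.sqrt (jLam α β ((n + 1) / 2))) *
    (∫ φ in Ioo (-π) π, f φ * jTheta α β n φ) * jTheta α β n θ

/-- The non-symmetrized Jacobi–Poisson semigroup `ℋ_t^{α,β}f(θ)` (polynomial setting). -/
def jacH (α β : ℝ) (f : ℝ → ℝ) (t θ : ℝ) : ℝ :=
  ∑' n : ℕ, Real.exp (-t * Real.sqrt (jLam α β n)) *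
    (∫ φ, f φ * trigP α β n φ ∂(jacobiMeasurePlus α β)) * trigP α β n θ

/-- The non-symmetrized Jacobi–Poisson semigroup `𝓗̄_t^{α,β}f(θ)` (function setting). -/
def jacHbar (α β : ℝ) (f : ℝ → ℝ) (t θ : ℝ) : ℝ :=
  ∑' n : ℕ, Real.exp (-t * Real.sqrt (jLam α β n)) *
    (∫ φ in Ioo 0 π, f φ * phiFun α β n φ) * phiFun α β n θ

/-- The symmetrized derivative `𝔻_{α,β}`. -/
def symD (α β : ℝ) (f : ℝ → ℝ) : ℝ → ℝ := fun θ =>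
  deriv f θ + (α - β + (α + β + 1) * Real.cos θ) / Real.sin θ * ((f θ - f (-θ)) / 2)

/-- The symmetrized derivative `D̄_{α,β}` (function setting). -/
def symDbar (α β : ℝ) (f : ℝ → ℝ) : ℝ → ℝ := fun θ =>
  deriv f θ -
    ((2 * α + 1) / 4 * (Real.cos (θ / 2) / Real.sin (θ / 2)) -
      (2 * β + 1) / 4 * Real.tan (θ / 2)) * f (-θ)

/-- The derivative `D_{α,β}` (non-symmetrized function setting). -/
def jacD (α β : ℝ) (f : ℝ → ℝ) : ℝ → ℝ := fun θ =>
  deriv f θ - (2 * α + 1) / 4 * (Real.cos (θ / 2) / Real.sin (θ / 2)) * f θ +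
    (2 * β + 1) / 4 * Real.tan (θ / 2) * f θ

/-- `δ*_{α,β} = −d/dθ − (α+1/2)cot(θ/2) + (β+1/2)tan(θ/2)`. -/
def delStar (α β : ℝ) (f : ℝ → ℝ) : ℝ → ℝ := fun θ =>
  -deriv f θ - (α + 1 / 2) * (Real.cos (θ / 2) / Real.sin (θ / 2)) * f θ +
    (β + 1 / 2) * Real.tan (θ / 2) * f θ

/-- `δ_N^even`: `N` alternating factors, rightmost (first applied) one being `δ = d/dθ`. -/
def deltaEven (α β : ℝ) : ℕ → (ℝ → ℝ) → ℝ → ℝ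
  | 0 => fun f => f
  | N + 1 => fun f => (if N % 2 = 0 then deriv else delStar α β) (deltaEven α β N f)

/-- `δ_N^odd`: `N` alternating factors, rightmost (first applied) one being `δ*_{α,β}`. -/
def deltaOdd (α β : ℝ) : ℕ → (ℝ → ℝ) → ℝ → ℝ
  | 0 => fun f => f
  | N + 1 => fun f => (if N % 2 = 0 then delStar α β else deriv) (deltaOdd α β N f)

/-- The Jacobi–Poisson kernel `H_t^{α,β}(θ,φ)` (even part of the symmetrized kernel). -/
def jHker (α β t θ φ : ℝ) : ℝ :=
  (1 / 2) * ∑' n : ℕ, Real.exp (-t * Real.sqrt (jLam α β n)) * trigP α β n θ * trigP α β n φ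

/-- The kernel `H̃_t^{α,β}(θ,φ)` (odd part of the symmetrized kernel). -/
def jHtil (α β t θ φ : ℝ) : ℝ :=
  (1 / 8) * Real.sin θ * Real.sin φ *
    ∑' n : ℕ, Real.exp (-t * Real.sqrt (jLam α β (n + 1))) *
      trigP (α + 1) (β + 1) n θ * trigP (α + 1) (β + 1) n φ

/-- `μ⁺_{α,β}(B(θ,r))` where `B(θ,r) = (θ−r, θ+r) ∩ (0,π)`. -/
def ballMeasure (α β θ r : ℝ) : ℝ≥0∞ := jacobiMeasurePlus α β (Ioo (θ - r) (θ + r))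

/-- The Muckenhoupt class `A_p^{α,β}` (`1 < p < ∞`) on `(−π,π)` w.r.t. `μ_{α,β}`. -/
def IsApWeight (α β p : ℝ) (w : ℝ → ℝ) : Prop :=
  (∀ θ, 0 ≤ w θ) ∧
    ∃ C : ℝ, ∀ a b : ℝ, -π ≤ a → a ≤ b → b ≤ π →
      (∫⁻ θ in Ioo a b, ENNReal.ofReal (w θ) ∂(jacobiMeasure α β)) *
          (∫⁻ θ in Ioo a b, ENNReal.ofReal (w θ ^ (-1 / (p - 1))) ∂(jacobiMeasure α β)) ^
            (p - 1) ≤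
        ENNReal.ofReal C * jacobiMeasure α β (Ioo a b) ^ p

/-- The Muckenhoupt class `A_1^{α,β}` on `(−π,π)` w.r.t. `μ_{α,β}`. -/
def IsA1Weight (α β : ℝ) (w : ℝ → ℝ) : Prop :=
  (∀ θ, 0 ≤ w θ) ∧
    ∃ C : ℝ, ∀ a b : ℝ, -π ≤ a → a ≤ b → b ≤ π →
      ∫⁻ θ in Ioo a b, ENNReal.ofReal (w θ) ∂(jacobiMeasure α β) ≤
        ENNReal.ofReal C *
          essInf (fun θ => ENNReal.ofReal (w θ)) ((jacobiMeasure α β).restrict (Ioo a b)) *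
          jacobiMeasure α β (Ioo a b)

/-- The Muckenhoupt class `(A_p^{α,β})⁺` (`1 < p < ∞`) on `(0,π)` w.r.t. `μ⁺_{α,β}`. -/
def IsApWeightPlus (α β p : ℝ) (w : ℝ → ℝ) : Prop :=
  (∀ θ, 0 ≤ w θ) ∧
    ∃ C : ℝ, ∀ a b : ℝ, 0 ≤ a → a ≤ b → b ≤ π →
      (∫⁻ θ in Ioo a b, ENNReal.ofReal (w θ) ∂(jacobiMeasurePlus α β)) *
          (∫⁻ θ in Ioo a b, ENNReal.ofReal (w θ ^ (-1 / (p - 1))) ∂(jacobiMeasurePlus α β)) ^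
            (p - 1) ≤
        ENNReal.ofReal C * jacobiMeasurePlus α β (Ioo a b) ^ p

/-- The Muckenhoupt class `(A_1^{α,β})⁺` on `(0,π)` w.r.t. `μ⁺_{α,β}`. -/
def IsA1WeightPlus (α β : ℝ) (w : ℝ → ℝ) : Prop :=
  (∀ θ, 0 ≤ w θ) ∧
    ∃ C : ℝ, ∀ a b : ℝ, 0 ≤ a → a ≤ b → b ≤ π →
      ∫⁻ θ in Ioo a b, ENNReal.ofReal (w θ) ∂(jacobiMeasurePlus α β) ≤
        ENNReal.ofReal C *
          essInf (fun θ => ENNReal.ofReal (w θ)) ((jacobiMeasurePlus α β).restrict (Ioo a b)) *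
          jacobiMeasurePlus α β (Ioo a b)

/-- The double power weight `w_{r,s}(θ) = |sin(θ/2)|^r (cos(θ/2))^s`. -/
def wrs (r s θ : ℝ) : ℝ := |Real.sin (θ / 2)| ^ r * Real.cos (θ / 2) ^ s


/-- The Riesz kernel `R̃_N^{α,β}(θ,φ)`. -/
def rieszKer (α β : ℝ) (N : ℕ) (θ φ : ℝ) : ℝ :=
  (1 / Real.Gamma N) *
    ∫ t in Ioi (0 : ℝ), deltaOdd α β N (fun θ' => jHtil α β t θ' φ) θ * t ^ (N - 1)

namespace JR
open scoped Topology

/-- The variable `z = cos ω sin(θ/2) sin(φ/2) + cos η cos(θ/2) cos(φ/2)`. -/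
def zz (p : ℝ × ℝ) (θ φ : ℝ) : ℝ :=
  cos p.1 * (sin (θ / 2) * sin (φ / 2)) + cos p.2 * (cos (θ / 2) * cos (φ / 2))

/-- `∂_θ z`. -/
def zt (p : ℝ × ℝ) (θ φ : ℝ) : ℝ :=
  (cos p.1 * (cos (θ / 2) * sin (φ / 2)) - cos p.2 * (sin (θ / 2) * cos (φ / 2))) / 2

/-- `∂_θ ∂_φ z`. -/
def zx (p : ℝ × ℝ) (θ φ : ℝ) : ℝ :=
  (cos p.1 * (cos (θ / 2) * cos (φ / 2)) + cos p.2 * (sin (θ / 2) * sin (φ / 2))) / 4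

lemma hasDerivAt_sin_half (θ : ℝ) : HasDerivAt (fun θ => sin (θ / 2)) (cos (θ / 2) / 2) θ := by
  exact (((hasDerivAt_id' θ).div_const 2).sin).congr_deriv (by ring)

lemma hasDerivAt_cos_half (θ : ℝ) : HasDerivAt (fun θ => cos (θ / 2)) (-sin (θ / 2) / 2) θ := by
  exact (((hasDerivAt_id' θ).div_const 2).cos).congr_deriv (by ring)

lemma zz_symm (p : ℝ × ℝ) (θ φ : ℝ) : zz p θ φ = zz p φ θ := by unfold zz; ring

lemma hasDerivAt_zz (p : ℝ × ℝ) (θ φ : ℝ) : HasDerivAt (fun θ => zz p θ φ) (zt p θ φ) θ := by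
  unfold zz zt
  have h := (((hasDerivAt_sin_half θ).mul_const (sin (φ / 2))).const_mul (cos p.1)).add
    (((hasDerivAt_cos_half θ).mul_const (cos (φ / 2))).const_mul (cos p.2))
  exact h.congr_deriv (by ring)

lemma hasDerivAt_zz' (p : ℝ × ℝ) (θ φ : ℝ) : HasDerivAt (fun φ => zz p θ φ) (zt p φ θ) φ := by
  simpa only [zz_symm p θ] using hasDerivAt_zz p φ θ

lemma hasDerivAt_zt (p : ℝ × ℝ) (θ φ : ℝ) :
    HasDerivAt (fun θ => zt p θ φ) (-zz p θ φ / 4) θ := by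
  unfold zz zt
  have h := ((((hasDerivAt_cos_half θ).mul_const (sin (φ / 2))).const_mul (cos p.1)).sub
    (((hasDerivAt_sin_half θ).mul_const (cos (φ / 2))).const_mul (cos p.2))).div_const 2
  exact h.congr_deriv (by ring)

lemma hasDerivAt_zt' (p : ℝ × ℝ) (θ φ : ℝ) :
    HasDerivAt (fun φ => zt p θ φ) (zx p θ φ) φ := by
  unfold zx zt
  have h := ((((hasDerivAt_sin_half φ).const_mul (cos (θ / 2))).const_mul (cos p.1)).sub
    (((hasDerivAt_cos_half φ).const_mul (sin (θ / 2))).const_mul (cos p.2))).div_const 2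
  exact h.congr_deriv (by ring)

lemma continuous_zz (θ φ : ℝ) : Continuous fun p => zz p θ φ := by unfold zz; fun_prop
lemma continuous_zt (θ φ : ℝ) : Continuous fun p => zt p θ φ := by unfold zt; fun_prop
lemma continuous_zx (θ φ : ℝ) : Continuous fun p => zx p θ φ := by unfold zx; fun_prop

lemma hpos {θ : ℝ} (h : θ ∈ Ioo 0 π) : 0 < sin (θ / 2) ∧ 0 < cos (θ / 2) := by
  constructor
  · exact sin_pos_of_pos_of_lt_pi (by linarith [h.1]) (by linarith [h.1, h.2])
  · exact cos_pos_of_mem_Ioo ⟨by linarith [h.1, pi_pos], by linarith [h.2]⟩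

lemma abs_zz_le (p : ℝ × ℝ) {θ φ : ℝ} (hθ : θ ∈ Ioo 0 π) (hφ : φ ∈ Ioo 0 π) :
    |zz p θ φ| ≤ cos ((θ - φ) / 2) := by
  have e : cos ((θ - φ) / 2) = sin (θ / 2) * sin (φ / 2) + cos (θ / 2) * cos (φ / 2) := by
    rw [sub_div, cos_sub]; ring
  rw [e]
  have h1 := mul_pos (hpos hθ).1 (hpos hφ).1
  have h2 := mul_pos (hpos hθ).2 (hpos hφ).2
  unfold zz
  have c1 := neg_one_le_cos p.1
  have c2 := cos_le_one p.1
  have c3 := neg_one_le_cos p.2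
  have c4 := cos_le_one p.2
  rw [abs_le]; constructor <;> nlinarith

lemma zt_sq (p : ℝ × ℝ) (θ φ : ℝ) :
    1 - zz p θ φ ^ 2 - 4 * zt p θ φ ^ 2 =
      sin (φ / 2) ^ 2 * sin p.1 ^ 2 + cos (φ / 2) ^ 2 * sin p.2 ^ 2 := by
  unfold zz zt
  have h1 := sin_sq_add_cos_sq (θ / 2)
  have h2 := sin_sq_add_cos_sq (φ / 2)
  have h3 := sin_sq_add_cos_sq p.1
  have h4 := sin_sq_add_cos_sq p.2
  have e3 : sin p.1 ^ 2 = 1 - cos p.1 ^ 2 := by linarith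
  have e4 : sin p.2 ^ 2 = 1 - cos p.2 ^ 2 := by linarith
  have e1 : sin (θ / 2) ^ 2 = 1 - cos (θ / 2) ^ 2 := by linarith
  rw [e3, e4]
  linear_combination (-cos p.1 ^ 2 * sin (φ / 2) ^ 2 - cos p.2 ^ 2 * cos (φ / 2) ^ 2) * h1 - h2

lemma zt_sq_le (p : ℝ × ℝ) (θ φ : ℝ) : 4 * zt p θ φ ^ 2 ≤ 1 - zz p θ φ ^ 2 := by
  have := zt_sq p θ φ
  have h : 0 ≤ sin (φ / 2) ^ 2 * sin p.1 ^ 2 + cos (φ / 2) ^ 2 * sin p.2 ^ 2 := by positivity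
  linarith

lemma abs_zt_le_one (p : ℝ × ℝ) (θ φ : ℝ) : |zt p θ φ| ≤ 1 := by
  have := zt_sq_le p θ φ
  rw [abs_le_one_iff_mul_self_le_one]
  nlinarith [sq_nonneg (zz p θ φ), sq_nonneg (zt p θ φ)]

lemma abs_zz_le_one (p : ℝ × ℝ) (θ φ : ℝ) : |zz p θ φ| ≤ 1 := by
  have := zt_sq_le p θ φ
  rw [abs_le_one_iff_mul_self_le_one]
  nlinarith [sq_nonneg (zz p θ φ), sq_nonneg (zt p θ φ)]

lemma abs_zx_le_one (p : ℝ × ℝ) (θ φ : ℝ) : |zx p θ φ| ≤ 1 := by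
  have key : ∀ a b c : ℝ, |a| ≤ 1 → |b| ≤ 1 → |c| ≤ 1 → |a * (b * c)| ≤ 1 := by
    intro a b c ha hb hc
    rw [abs_mul, abs_mul]
    exact mul_le_one₀ ha (by positivity) (mul_le_one₀ hb (by positivity) hc)
  have h1 := abs_le.1 (key _ _ _ (abs_cos_le_one p.1) (abs_cos_le_one (θ / 2))
    (abs_cos_le_one (φ / 2)))
  have h2 := abs_le.1 (key _ _ _ (abs_cos_le_one p.2) (abs_sin_le_one (θ / 2))
    (abs_sin_le_one (φ / 2)))
  unfold zx
  rw [abs_le]; constructor <;> linarith [h1.1, h1.2, h2.1, h2.2]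

lemma cos_half_lt {θ φ : ℝ} (hθ : θ ∈ Ioo 0 π) (hφ : φ ∈ Ioo 0 π) (h : θ ≠ φ) :
    cos ((θ - φ) / 2) < 1 := by
  refine lt_of_le_of_ne (cos_le_one _) fun h1 => h ?_
  have := (cos_eq_one_iff_of_lt_of_lt (x := (θ - φ) / 2) (by linarith [hθ.1, hθ.2, hφ.1, hφ.2])
    (by linarith [hθ.1, hθ.2, hφ.1, hφ.2])).1 h1
  linarith

/-- A good neighbourhood. -/
lemma good_nhds {θ φ : ℝ} (hθ : θ ∈ Ioo 0 π) (hφ : φ ∈ Ioo 0 π) (h : θ ≠ φ) :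
    ∃ ζ < 1, {x | x ∈ Ioo 0 π ∧ x ≠ φ ∧ cos ((x - φ) / 2) < ζ} ∈ 𝓝 θ := by
  obtain ⟨ζ, h1, h2⟩ := exists_between (cos_half_lt hθ hφ h)
  refine ⟨ζ, h2, ?_⟩
  have e1 : ∀ᶠ x in 𝓝 θ, x ∈ Ioo 0 π := isOpen_Ioo.mem_nhds hθ
  have e2 : ∀ᶠ x in 𝓝 θ, x ≠ φ := isOpen_ne.mem_nhds h
  have e3 : ∀ᶠ x in 𝓝 θ, cos ((x - φ) / 2) < ζ :=
    (Continuous.continuousAt (by fun_prop)).eventually_lt continuousAt_const h1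
  filter_upwards [e1, e2, e3] with x a b c using ⟨a, b, c⟩

lemma exists_bound {g : ℝ → ℝ} (hg : ContinuousOn g (Iio 1)) {ζ : ℝ} (hζ : ζ < 1) :
    ∃ M, 0 ≤ M ∧ ∀ z ∈ Icc (-1) ζ, |g z| ≤ M := by
  obtain ⟨M, hM⟩ := (isCompact_Icc (a := (-1 : ℝ)) (b := ζ)).exists_bound_of_continuousOn
    (hg.mono fun x hx => lt_of_le_of_lt hx.2 hζ)
  exact ⟨max M 0, le_max_right _ _, fun z hz => (hM z hz).trans (le_max_left _ _)⟩

lemma zz_mem (p : ℝ × ℝ) {θ φ ζ : ℝ} (hθ : θ ∈ Ioo 0 π) (hφ : φ ∈ Ioo 0 π)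
    (h : cos ((θ - φ) / 2) ≤ ζ) : zz p θ φ ∈ Icc (-1) ζ := by
  have h1 := abs_le.1 (abs_zz_le_one p θ φ)
  have h2 := abs_le.1 (abs_zz_le p hθ hφ)
  exact ⟨h1.1, h2.2.trans h⟩

lemma zz_lt_one (p : ℝ × ℝ) {θ φ : ℝ} (hθ : θ ∈ Ioo 0 π) (hφ : φ ∈ Ioo 0 π) (h : θ ≠ φ) :
    zz p θ φ < 1 :=
  lt_of_le_of_lt (zz_mem p hθ hφ le_rfl).2 (cos_half_lt hθ hφ h)

lemma cont_comp_zz {g : ℝ → ℝ} (hg : ContinuousOn g (Iio 1)) {θ φ : ℝ} (hθ : θ ∈ Ioo 0 π)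
    (hφ : φ ∈ Ioo 0 π) (h : θ ≠ φ) : Continuous fun p => g (zz p θ φ) :=
  hg.comp_continuous (continuous_zz θ φ) fun p => zz_lt_one p hθ hφ h

lemma cont_of_deriv {g g1 : ℝ → ℝ} (h : ∀ z < 1, HasDerivAt g (g1 z) z) :
    ContinuousOn g (Iio 1) := fun z hz => (h z hz).continuousAt.continuousWithinAt

lemma hasDeriv_param {ν : Measure (ℝ × ℝ)} [IsFiniteMeasure ν] {x₀ : ℝ} {s : Set ℝ}
    (hs : s ∈ 𝓝 x₀) {Φ Φ' : ℝ × ℝ → ℝ → ℝ} (hc : ∀ x ∈ s, Continuous fun p => Φ p x)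
    (hc' : Continuous fun p => Φ' p x₀) (hd : ∀ x ∈ s, ∀ p, HasDerivAt (Φ p) (Φ' p x) x)
    {M M0 : ℝ} (hM0 : ∀ p, |Φ p x₀| ≤ M0) (hM : ∀ x ∈ s, ∀ p, |Φ' p x| ≤ M) :
    HasDerivAt (fun x => ∫ p, Φ p x ∂ν) (∫ p, Φ' p x₀ ∂ν) x₀ := by
  refine (hasDerivAt_integral_of_dominated_loc_of_deriv_le (F := fun x p => Φ p x)
    (F' := fun x p => Φ' p x) (bound := fun _ => M) hs ?_ ?_ ?_ ?_ ?_ ?_).2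
  · filter_upwards [hs] with x hx using (hc x hx).aestronglyMeasurable
  · exact Integrable.of_bound (hc x₀ (mem_of_mem_nhds hs)).aestronglyMeasurable M0
      (Filter.Eventually.of_forall hM0)
  · exact hc'.aestronglyMeasurable
  · exact Filter.Eventually.of_forall fun p x hx => hM x hx p
  · exact integrable_const M
  · exact Filter.Eventually.of_forall fun p x hx => hd x hx p

def FF (ν : Measure (ℝ × ℝ)) (g : ℝ → ℝ) (θ φ : ℝ) : ℝ := ∫ p, g (zz p θ φ) ∂ν
def FFt (ν : Measure (ℝ × ℝ)) (g1 : ℝ → ℝ) (θ φ : ℝ) : ℝ := ∫ p, g1 (zz p θ φ) * zt p θ φ ∂ν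
def FFtt (ν : Measure (ℝ × ℝ)) (g1 g2 : ℝ → ℝ) (θ φ : ℝ) : ℝ :=
  ∫ p, g2 (zz p θ φ) * zt p θ φ * zt p θ φ + g1 (zz p θ φ) * (-zz p θ φ / 4) ∂ν
def FFtx (ν : Measure (ℝ × ℝ)) (g1 g2 : ℝ → ℝ) (θ φ : ℝ) : ℝ :=
  ∫ p, g2 (zz p θ φ) * zt p φ θ * zt p θ φ + g1 (zz p θ φ) * zx p θ φ ∂ν

lemma FF_symm (ν : Measure (ℝ × ℝ)) (g : ℝ → ℝ) (θ φ : ℝ) : FF ν g θ φ = FF ν g φ θ := by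
  unfold FF; simp only [zz_symm _ θ φ]

section
variable {ν : Measure (ℝ × ℝ)} [IsFiniteMeasure ν] {g g1 g2 : ℝ → ℝ} {θ φ : ℝ}

lemma integrable_zz {f : ℝ → ℝ} (hf : ContinuousOn f (Iio 1)) (hθ : θ ∈ Ioo 0 π)
    (hφ : φ ∈ Ioo 0 π) (h : θ ≠ φ) {k : ℝ × ℝ → ℝ} (hk : Continuous k) (hk1 : ∀ p, |k p| ≤ 1) :
    Integrable (fun p => f (zz p θ φ) * k p) ν := by
  obtain ⟨M, hM0, hM⟩ := exists_bound hf (cos_half_lt hθ hφ h)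
  refine Integrable.of_bound ((cont_comp_zz hf hθ hφ h).mul hk).aestronglyMeasurable M
      (Filter.Eventually.of_forall fun p => ?_)
  rw [Real.norm_eq_abs, abs_mul]
  exact (mul_le_of_le_one_right (abs_nonneg _) (hk1 p)).trans (hM _ (zz_mem p hθ hφ le_rfl))

lemma hasDerivAt_FF (hg : ∀ z < 1, HasDerivAt g (g1 z) z) (hg1 : ContinuousOn g1 (Iio 1))
    (hθ : θ ∈ Ioo 0 π) (hφ : φ ∈ Ioo 0 π) (h : θ ≠ φ) :
    HasDerivAt (fun θ => FF ν g θ φ) (FFt ν g1 θ φ) θ := by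
  obtain ⟨ζ, hζ, hs⟩ := good_nhds hθ hφ h
  obtain ⟨M, hM0, hM⟩ := exists_bound (cont_of_deriv hg) (cos_half_lt hθ hφ h)
  obtain ⟨M1, hM10, hM1⟩ := exists_bound hg1 hζ
  refine hasDeriv_param hs (Φ := fun p x => g (zz p x φ))
    (Φ' := fun p x => g1 (zz p x φ) * zt p x φ) (M0 := M) (M := M1)
    ?_ ?_ ?_ ?_ ?_
  · rintro x ⟨hx, hxφ, -⟩
    exact cont_comp_zz (cont_of_deriv hg) hx hφ hxφ
  · exact (cont_comp_zz hg1 hθ hφ h).mul (continuous_zt _ _)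
  · rintro x ⟨hx, hxφ, -⟩ p
    exact (hg _ (zz_lt_one p hx hφ hxφ)).comp x (hasDerivAt_zz p x φ)
  · intro p
    exact hM _ (zz_mem p hθ hφ le_rfl)
  · rintro x ⟨hx, hxφ, hxζ⟩ p
    rw [abs_mul]
    exact (mul_le_of_le_one_right (abs_nonneg _) (abs_zt_le_one _ _ _)).trans
      (hM1 _ (zz_mem p hx hφ hxζ.le))

lemma hasDerivAt_FF' (hg : ∀ z < 1, HasDerivAt g (g1 z) z) (hg1 : ContinuousOn g1 (Iio 1))
    (hθ : θ ∈ Ioo 0 π) (hφ : φ ∈ Ioo 0 π) (h : θ ≠ φ) :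
    HasDerivAt (fun φ => FF ν g θ φ) (FFt ν g1 φ θ) φ := by
  simpa only [FF_symm ν g θ] using hasDerivAt_FF (ν := ν) hg hg1 hφ hθ h.symm

lemma bound2 {A B x y w M1 M2 : ℝ} (hA : |A| ≤ M2) (hB : |B| ≤ M1) (hx : |x| ≤ 1) (hy : |y| ≤ 1)
    (hw : |w| ≤ 1) : |A * x * y + B * w| ≤ M2 + M1 := by
  have h1 : |A * x * y| ≤ M2 := by
    rw [abs_mul, abs_mul]
    exact (mul_le_of_le_one_right (by positivity) hy).trans
      ((mul_le_of_le_one_right (by positivity) hx).trans hA)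
  have h2 : |B * w| ≤ M1 := by
    rw [abs_mul]
    exact (mul_le_of_le_one_right (by positivity) hw).trans hB
  exact (abs_add_le _ _).trans (add_le_add h1 h2)

lemma abs_zz4 (p : ℝ × ℝ) (θ φ : ℝ) : |-zz p θ φ / 4| ≤ 1 := by
  have := abs_le.1 (abs_zz_le_one p θ φ)
  rw [abs_le]; constructor <;> linarith [this.1, this.2]

lemma hasDerivAt_FFt (hg1 : ∀ z < 1, HasDerivAt g1 (g2 z) z) (hg2 : ContinuousOn g2 (Iio 1))
    (hθ : θ ∈ Ioo 0 π) (hφ : φ ∈ Ioo 0 π) (h : θ ≠ φ) :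
    HasDerivAt (fun θ => FFt ν g1 θ φ) (FFtt ν g1 g2 θ φ) θ := by
  obtain ⟨ζ, hζ, hs⟩ := good_nhds hθ hφ h
  have hc1 := cont_of_deriv hg1
  obtain ⟨M, hM0, hM⟩ := exists_bound hc1 hζ
  obtain ⟨M1, hM10, hM1⟩ := exists_bound hg2 hζ
  have hh := mem_of_mem_nhds hs
  refine hasDeriv_param hs (Φ := fun p x => g1 (zz p x φ) * zt p x φ)
    (Φ' := fun p x => g2 (zz p x φ) * zt p x φ * zt p x φ + g1 (zz p x φ) * (-zz p x φ / 4))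
    (M0 := M) (M := M1 + M)
    ?_ ?_ ?_ ?_ ?_
  · rintro x ⟨hx, hxφ, -⟩
    exact (cont_comp_zz hc1 hx hφ hxφ).mul (continuous_zt _ _)
  · exact (((cont_comp_zz hg2 hθ hφ h).mul (continuous_zt _ _)).mul (continuous_zt _ _)).add
      ((cont_comp_zz hc1 hθ hφ h).mul ((continuous_zz _ _).neg.div_const 4))
  · rintro x ⟨hx, hxφ, -⟩ p
    exact ((hg1 _ (zz_lt_one p hx hφ hxφ)).comp x (hasDerivAt_zz p x φ)).mul
      (hasDerivAt_zt p x φ)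
  · intro p
    rw [abs_mul]
    exact (mul_le_of_le_one_right (abs_nonneg _) (abs_zt_le_one _ _ _)).trans
      (hM _ (zz_mem p hθ hφ hh.2.2.le))
  · rintro x ⟨hx, hxφ, hxζ⟩ p
    exact bound2 (hM1 _ (zz_mem p hx hφ hxζ.le)) (hM _ (zz_mem p hx hφ hxζ.le))
      (abs_zt_le_one _ _ _) (abs_zt_le_one _ _ _) (abs_zz4 _ _ _)

lemma hasDerivAt_FFt' (hg1 : ∀ z < 1, HasDerivAt g1 (g2 z) z) (hg2 : ContinuousOn g2 (Iio 1))
    (hθ : θ ∈ Ioo 0 π) (hφ : φ ∈ Ioo 0 π) (h : θ ≠ φ) :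
    HasDerivAt (fun φ => FFt ν g1 θ φ) (FFtx ν g1 g2 θ φ) φ := by
  obtain ⟨ζ, hζ, hs⟩ := good_nhds hφ hθ h.symm
  have hc1 := cont_of_deriv hg1
  obtain ⟨M, hM0, hM⟩ := exists_bound hc1 hζ
  obtain ⟨M1, hM10, hM1⟩ := exists_bound hg2 hζ
  have hh := mem_of_mem_nhds hs
  have sy : ∀ x, cos ((x - θ) / 2) < ζ → cos ((θ - x) / 2) ≤ ζ := by
    intro x hx
    have : (θ - x) / 2 = -((x - θ) / 2) := by ring
    rw [this, cos_neg]; exact hx.le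
  refine hasDeriv_param hs (Φ := fun p x => g1 (zz p θ x) * zt p θ x)
    (Φ' := fun p x => g2 (zz p θ x) * zt p x θ * zt p θ x + g1 (zz p θ x) * zx p θ x)
    (M0 := M) (M := M1 + M)
    ?_ ?_ ?_ ?_ ?_
  · rintro x ⟨hx, hxφ, -⟩
    exact (cont_comp_zz hc1 hθ hx hxφ.symm).mul (continuous_zt _ _)
  · exact (((cont_comp_zz hg2 hθ hφ h).mul (continuous_zt _ _)).mul (continuous_zt _ _)).add
      ((cont_comp_zz hc1 hθ hφ h).mul (continuous_zx _ _))
  · rintro x ⟨hx, hxφ, -⟩ p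
    exact ((hg1 _ (zz_lt_one p hθ hx hxφ.symm)).comp x (hasDerivAt_zz' p θ x)).mul
      (hasDerivAt_zt' p θ x)
  · intro p
    rw [abs_mul]
    exact (mul_le_of_le_one_right (abs_nonneg _) (abs_zt_le_one _ _ _)).trans
      (hM _ (zz_mem p hθ hφ (sy _ hh.2.2)))
  · rintro x ⟨hx, hxφ, hxζ⟩ p
    exact bound2 (hM1 _ (zz_mem p hθ hx (sy _ hxζ))) (hM _ (zz_mem p hθ hx (sy _ hxζ)))
      (abs_zt_le_one _ _ _) (abs_zt_le_one _ _ _) (abs_zx_le_one _ _ _)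

end
end JR

namespace JR
open scoped Topology

/-- The measure `sin^{2a} ω dω` on `(0,π]`. -/
def Pm (a : ℝ) : Measure ℝ :=
  (volume.restrict (Ioc 0 π)).withDensity fun ω => ENNReal.ofReal (sin ω ^ (2 * a))

/-- The product measure. -/
def nu (a b : ℝ) : Measure (ℝ × ℝ) := (Pm a).prod (Pm b)

lemma cont_sinpow {a : ℝ} (ha : 0 ≤ a) : Continuous fun ω => sin ω ^ a :=
  continuous_sin.rpow_const fun _ => Or.inr ha

lemma isFinite_Pm {a : ℝ} (ha : 0 < a) : IsFiniteMeasure (Pm a) := by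
  unfold Pm
  refine isFiniteMeasure_withDensity_ofReal ?_
  have h : IntegrableOn (fun ω => sin ω ^ (2 * a)) (Ioc 0 π) :=
    ((cont_sinpow (by linarith : 0 ≤ 2 * a)).integrableOn_Icc).mono_set Ioc_subset_Icc_self
  exact h.2

lemma integral_Pm {a : ℝ} (ha : 0 < a) (f : ℝ → ℝ) :
    ∫ ω, f ω ∂(Pm a) = ∫ ω in (0 : ℝ)..π, sin ω ^ (2 * a) * f ω := by
  unfold Pm
  rw [intervalIntegral.integral_of_le pi_pos.le]
  rw [integral_withDensity_eq_integral_toReal_smul₀]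
  · refine setIntegral_congr_fun measurableSet_Ioc fun ω hω => ?_
    have : 0 ≤ sin ω ^ (2 * a) := rpow_nonneg (sin_nonneg_of_nonneg_of_le_pi hω.1.le hω.2) _
    simp [ENNReal.toReal_ofReal this]
  · exact ((cont_sinpow (by linarith : 0 ≤ 2 * a)).measurable.ennreal_ofReal).aemeasurable
  · exact Filter.Eventually.of_forall fun _ => ENNReal.ofReal_lt_top

lemma ibp_Pm {a : ℝ} (ha : 0 < a) {f f' : ℝ → ℝ} (hf : ∀ ω, HasDerivAt f (f' ω) ω)
    (hf' : Continuous f') :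
    ∫ ω, f' ω * sin ω ∂(Pm a) = -((2 * a + 1) * ∫ ω, f ω * cos ω ∂(Pm a)) := by
  have hfc : Continuous f := continuous_iff_continuousAt.2 fun ω => (hf ω).continuousAt
  rw [integral_Pm ha, integral_Pm ha]
  have hd : ∀ ω, HasDerivAt (fun ω => sin ω ^ (2 * a + 1)) ((2 * a + 1) * sin ω ^ (2 * a) * cos ω) ω := by
    intro ω
    refine ((hasDerivAt_sin ω).rpow_const (p := 2 * a + 1) (Or.inr (by linarith))).congr_deriv ?_
    rw [add_sub_cancel_right]; ring
  have hp : ∀ ω ∈ Icc 0 π, sin ω ^ (2 * a + 1) = sin ω ^ (2 * a) * sin ω := by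
    intro ω hω
    exact rpow_add_one' (sin_nonneg_of_nonneg_of_le_pi hω.1 hω.2) (by linarith)
  have c1 := cont_sinpow (by linarith : 0 ≤ 2 * a + 1)
  have c2 := cont_sinpow (by linarith : 0 ≤ 2 * a)
  have key := intervalIntegral.integral_mul_deriv_eq_deriv_mul (a := 0) (b := π)
    (u := fun ω => sin ω ^ (2 * a + 1)) (v := f)
    (u' := fun ω => (2 * a + 1) * sin ω ^ (2 * a) * cos ω) (v' := f')
    (fun x _ => hd x) (fun x _ => hf x)
    (Continuous.intervalIntegrable (by fun_prop) _ _) (hf'.intervalIntegrable _ _)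
  simp only [sin_pi, sin_zero] at key
  rw [zero_rpow (by linarith)] at key
  simp only [zero_mul, sub_zero, zero_sub] at key
  rw [← intervalIntegral.integral_const_mul]
  calc _ = ∫ x in (0:ℝ)..π, sin x ^ (2 * a + 1) * f' x := by
        refine intervalIntegral.integral_congr fun ω hω => ?_
        rw [uIcc_of_le pi_pos.le] at hω
        simp only [hp ω hω]; ring
    _ = _ := by
        rw [key]; congr 1
        refine intervalIntegral.integral_congr fun ω hω => ?_
        ring

section
variable {a b : ℝ} {g g1 g2 : ℝ → ℝ} {θ φ : ℝ}

lemma isFinite_nu (ha : 0 < a) (hb : 0 < b) : IsFiniteMeasure (nu a b) := by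
  have := isFinite_Pm ha
  have := isFinite_Pm hb
  unfold nu; infer_instance

lemma ibp1 (ha : 0 < a) (hb : 0 < b) (hg1 : ∀ z < 1, HasDerivAt g1 (g2 z) z)
    (hg2 : ContinuousOn g2 (Iio 1)) (hθ : θ ∈ Ioo 0 π) (hφ : φ ∈ Ioo 0 π) (h : θ ≠ φ) :
    (sin (θ / 2) * sin (φ / 2)) * ∫ p, g2 (zz p θ φ) * sin p.1 ^ 2 ∂(nu a b) =
      (2 * a + 1) * ∫ p, g1 (zz p θ φ) * cos p.1 ∂(nu a b) := by
  have := isFinite_Pm ha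
  have := isFinite_Pm hb
  have i0 := isFinite_nu ha hb
  have i1 : Integrable (fun p : ℝ × ℝ => g2 (zz p θ φ) * sin p.1 ^ 2) (nu a b) :=
    integrable_zz hg2 hθ hφ h (by fun_prop) fun p => by
      rw [abs_of_nonneg (sq_nonneg _)]; exact sin_sq_le_one _
  have i2 : Integrable (fun p : ℝ × ℝ => g1 (zz p θ φ) * cos p.1) (nu a b) :=
    integrable_zz (cont_of_deriv hg1) hθ hφ h (by fun_prop) fun p => abs_cos_le_one _
  unfold nu at *
  rw [integral_prod_symm _ i1, integral_prod_symm _ i2, ← integral_const_mul,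
    ← integral_const_mul]
  refine integral_congr_ae (Filter.Eventually.of_forall fun η => ?_)
  simp only
  have key := ibp_Pm ha (f := fun ω => g1 (zz (ω, η) θ φ))
    (f' := fun ω => g2 (zz (ω, η) θ φ) * (-sin ω * (sin (θ / 2) * sin (φ / 2)))) ?_ ?_
  · rw [← integral_const_mul]
    rw [← neg_eq_iff_eq_neg, ← integral_neg] at key
    rw [← key]
    congr 1; ext ω; ring
  · intro ω
    refine (hg1 _ (zz_lt_one (ω, η) hθ hφ h)).comp ω ?_
    unfold zz
    exact ((hasDerivAt_cos ω).mul_const (sin (θ / 2) * sin (φ / 2))).add_const (cos η * (cos (θ / 2) * cos (φ / 2)))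
  · exact ((cont_comp_zz hg2 hθ hφ h).comp (by fun_prop : Continuous fun ω : ℝ => (ω, η))).mul
      (by fun_prop)

lemma ibp2 (ha : 0 < a) (hb : 0 < b) (hg1 : ∀ z < 1, HasDerivAt g1 (g2 z) z)
    (hg2 : ContinuousOn g2 (Iio 1)) (hθ : θ ∈ Ioo 0 π) (hφ : φ ∈ Ioo 0 π) (h : θ ≠ φ) :
    (cos (θ / 2) * cos (φ / 2)) * ∫ p, g2 (zz p θ φ) * sin p.2 ^ 2 ∂(nu a b) =
      (2 * b + 1) * ∫ p, g1 (zz p θ φ) * cos p.2 ∂(nu a b) := by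
  have := isFinite_Pm ha
  have := isFinite_Pm hb
  have i0 := isFinite_nu ha hb
  have i1 : Integrable (fun p : ℝ × ℝ => g2 (zz p θ φ) * sin p.2 ^ 2) (nu a b) :=
    integrable_zz hg2 hθ hφ h (by fun_prop) fun p => by
      rw [abs_of_nonneg (sq_nonneg _)]; exact sin_sq_le_one _
  have i2 : Integrable (fun p : ℝ × ℝ => g1 (zz p θ φ) * cos p.2) (nu a b) :=
    integrable_zz (cont_of_deriv hg1) hθ hφ h (by fun_prop) fun p => abs_cos_le_one _
  unfold nu at *
  rw [integral_prod _ i1, integral_prod _ i2, ← integral_const_mul,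
    ← integral_const_mul]
  refine integral_congr_ae (Filter.Eventually.of_forall fun ω => ?_)
  simp only
  have key := ibp_Pm hb (f := fun η => g1 (zz (ω, η) θ φ))
    (f' := fun η => g2 (zz (ω, η) θ φ) * (-sin η * (cos (θ / 2) * cos (φ / 2)))) ?_ ?_
  · rw [← integral_const_mul]
    rw [← neg_eq_iff_eq_neg, ← integral_neg] at key
    rw [← key]
    congr 1; ext η; ring
  · intro η
    refine (hg1 _ (zz_lt_one (ω, η) hθ hφ h)).comp η ?_
    unfold zz
    exact ((hasDerivAt_cos η).mul_const (cos (θ / 2) * cos (φ / 2))).const_add (cos ω * (sin (θ / 2) * sin (φ / 2)))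
  · exact ((cont_comp_zz hg2 hθ hφ h).comp (by fun_prop : Continuous fun η : ℝ => (ω, η))).mul
      (by fun_prop)

/-- The Gegenbauer operator in `z`. -/
def Aop (lam : ℝ) (g1 g2 : ℝ → ℝ) (z : ℝ) : ℝ :=
  -(1 / 4) * ((1 - z ^ 2) * g2 z - (2 * lam + 1) * z * g1 z)

lemma intertwine (ha : 0 < a) (hb : 0 < b) (hg1 : ∀ z < 1, HasDerivAt g1 (g2 z) z)
    (hg2 : ContinuousOn g2 (Iio 1)) (hθ : θ ∈ Ioo 0 π) (hφ : φ ∈ Ioo 0 π) (h : θ ≠ φ) :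
    FF (nu a b) (Aop (a + b + 1) g1 g2) θ φ =
      -FFtt (nu a b) g1 g2 θ φ - (a + 1 / 2) * (cos (θ / 2) / sin (θ / 2)) * FFt (nu a b) g1 θ φ
        + (b + 1 / 2) * (sin (θ / 2) / cos (θ / 2)) * FFt (nu a b) g1 θ φ := by
  have i0 := isFinite_nu ha hb
  have e1 := ibp1 ha hb hg1 hg2 hθ hφ h
  have e2 := ibp2 ha hb hg1 hg2 hθ hφ h
  have hc1 := cont_of_deriv hg1
  have j1 : Integrable (fun p : ℝ × ℝ => g2 (zz p θ φ) * sin p.1 ^ 2) (nu a b) :=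
    integrable_zz hg2 hθ hφ h (by fun_prop) fun p => by
      rw [abs_of_nonneg (sq_nonneg _)]; exact sin_sq_le_one _
  have j2 : Integrable (fun p : ℝ × ℝ => g2 (zz p θ φ) * sin p.2 ^ 2) (nu a b) :=
    integrable_zz hg2 hθ hφ h (by fun_prop) fun p => by
      rw [abs_of_nonneg (sq_nonneg _)]; exact sin_sq_le_one _
  have j3 : Integrable (fun p : ℝ × ℝ => g1 (zz p θ φ) * cos p.1) (nu a b) :=
    integrable_zz hc1 hθ hφ h (by fun_prop) fun p => abs_cos_le_one _
  have j4 : Integrable (fun p : ℝ × ℝ => g1 (zz p θ φ) * cos p.2) (nu a b) :=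
    integrable_zz hc1 hθ hφ h (by fun_prop) fun p => abs_cos_le_one _
  have j5 : Integrable (fun p : ℝ × ℝ => g2 (zz p θ φ) * zt p θ φ ^ 2) (nu a b) :=
    integrable_zz hg2 hθ hφ h ((continuous_zt _ _).pow 2) fun p => by
      rw [abs_pow]; exact pow_le_one₀ (abs_nonneg _) (abs_zt_le_one _ _ _)
  set X1 := ∫ p, g1 (zz p θ φ) * cos p.1 ∂(nu a b)
  set X2 := ∫ p, g1 (zz p θ φ) * cos p.2 ∂(nu a b)
  set W1 := ∫ p, g2 (zz p θ φ) * sin p.1 ^ 2 ∂(nu a b) with hW1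
  set W2 := ∫ p, g2 (zz p θ φ) * sin p.2 ^ 2 ∂(nu a b) with hW2
  set Y := ∫ p, g2 (zz p θ φ) * zt p θ φ ^ 2 ∂(nu a b) with hY
  set s := sin (θ / 2) with hs
  set c := cos (θ / 2) with hc
  set s' := sin (φ / 2) with hs'
  set c' := cos (φ / 2) with hc'
  have f1 : FFt (nu a b) g1 θ φ = c * s' / 2 * X1 - s * c' / 2 * X2 := by
    unfold FFt
    rw [← integral_const_mul, ← integral_const_mul, ← integral_sub (j3.const_mul _) (j4.const_mul _)]
    congr 1; ext p; unfold zt; ring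
  have f2 : FFtt (nu a b) g1 g2 θ φ = Y - (s * s' / 4 * X1 + c * c' / 4 * X2) := by
    unfold FFtt
    have : ∀ p, g2 (zz p θ φ) * zt p θ φ * zt p θ φ + g1 (zz p θ φ) * (-zz p θ φ / 4) =
        g2 (zz p θ φ) * zt p θ φ ^ 2 + (-(s * s' / 4)) * (g1 (zz p θ φ) * cos p.1)
          + (-(c * c' / 4)) * (g1 (zz p θ φ) * cos p.2) := by
      intro p
      have hz2 : zz p θ φ = cos p.1 * (s * s') + cos p.2 * (c * c') := rfl
      linear_combination (-(1 / 4) * g1 (zz p θ φ)) * hz2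
    simp only [this]
    rw [integral_add, integral_add]
    · simp only [integral_const_mul, ← hY]; ring
    · exact j5
    · exact j3.const_mul _
    · exact j5.add (j3.const_mul _)
    · exact j4.const_mul _
  have f3 : FF (nu a b) (Aop (a + b + 1) g1 g2) θ φ =
      -(1 / 4) * (4 * Y + s' ^ 2 * W1 + c' ^ 2 * W2) +
        (2 * (a + b + 1) + 1) / 4 * (s * s' * X1 + c * c' * X2) := by
    unfold FF
    have : ∀ p, Aop (a + b + 1) g1 g2 (zz p θ φ) =
        (-1) * (g2 (zz p θ φ) * zt p θ φ ^ 2) + (-(1/4) * s' ^ 2) * (g2 (zz p θ φ) * sin p.1 ^ 2)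
        + (-(1/4) * c' ^ 2) * (g2 (zz p θ φ) * sin p.2 ^ 2)
        + ((2 * (a + b + 1) + 1) / 4 * (s * s')) * (g1 (zz p θ φ) * cos p.1)
        + ((2 * (a + b + 1) + 1) / 4 * (c * c')) * (g1 (zz p θ φ) * cos p.2) := by
      intro p
      have hz := zt_sq p θ φ
      have hz2 : zz p θ φ = cos p.1 * (s * s') + cos p.2 * (c * c') := rfl
      unfold Aop
      linear_combination (-(1/4) * g2 (zz p θ φ)) * hz +
        ((2 * (a + b + 1) + 1) / 4 * g1 (zz p θ φ)) * hz2
    simp only [this]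
    rw [integral_add, integral_add, integral_add, integral_add]
    · simp only [integral_const_mul, ← hY, ← hW1, ← hW2]; ring
    all_goals first | exact j5.const_mul _ | exact j1.const_mul _ | exact j2.const_mul _ | exact j3.const_mul _ | exact j4.const_mul _ | skip
    · exact (j5.const_mul _).add (j1.const_mul _)
    · exact ((j5.const_mul _).add (j1.const_mul _)).add (j2.const_mul _)
    · exact (((j5.const_mul _).add (j1.const_mul _)).add (j2.const_mul _)).add (j3.const_mul _)
  have hspos : s ≠ 0 := (hpos hθ).1.ne'
  have hcpos : c ≠ 0 := (hpos hθ).2.ne'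
  have h1 : s ^ 2 + c ^ 2 = 1 := sin_sq_add_cos_sq _
  have g1' : s' ^ 2 * W1 = (2 * a + 1) * X1 * s' / s := by
    field_simp; linear_combination s' * e1
  have g2' : c' ^ 2 * W2 = (2 * b + 1) * X2 * c' / c := by
    field_simp; linear_combination c' * e2
  have h1' : s ^ 2 = 1 - c ^ 2 := by linarith
  rw [f1, f2, f3, g1', g2']
  field_simp
  linear_combination 4 * (X1 * s' * c * (2 * a + 1) + X2 * c' * s * (2 * b + 1)) * h1

end
end JR

namespace JR
open scoped Topology

open Polynomial in
/-- Gegenbauer polynomials. -/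
def CP (lam : ℝ) : ℕ → Polynomial ℝ
  | 0 => 1
  | 1 => C (2 * lam) * X
  | (n + 2) => C (1 / ((n : ℝ) + 2)) *
      (C (2 * ((n : ℝ) + 1 + lam)) * X * CP lam (n + 1) - C ((n : ℝ) + 2 * lam) * CP lam n)

def cc (lam : ℝ) (n : ℕ) (z : ℝ) : ℝ := (CP lam n).eval z
def cd (lam : ℝ) (n : ℕ) (z : ℝ) : ℝ := (Polynomial.derivative (CP lam n)).eval z
def ce (lam : ℝ) (n : ℕ) (z : ℝ) : ℝ :=
  (Polynomial.derivative (Polynomial.derivative (CP lam n))).eval z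

lemma cc_zero (lam z : ℝ) : cc lam 0 z = 1 := by simp [cc, CP]
lemma cc_one (lam z : ℝ) : cc lam 1 z = 2 * lam * z := by simp [cc, CP]
lemma cd_zero (lam z : ℝ) : cd lam 0 z = 0 := by simp [cd, CP]
lemma cd_one (lam z : ℝ) : cd lam 1 z = 2 * lam := by simp [cd, CP]

lemma cc_rec (lam : ℝ) (n : ℕ) (z : ℝ) : ((n : ℝ) + 2) * cc lam (n + 2) z =
    2 * ((n : ℝ) + 1 + lam) * z * cc lam (n + 1) z - ((n : ℝ) + 2 * lam) * cc lam n z := by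
  have : (n : ℝ) + 2 ≠ 0 := by positivity
  simp only [cc, CP, Polynomial.eval_mul, Polynomial.eval_C, Polynomial.eval_sub,
    Polynomial.eval_X]
  field_simp

lemma cd_rec (lam : ℝ) (n : ℕ) (z : ℝ) : ((n : ℝ) + 2) * cd lam (n + 2) z =
    2 * ((n : ℝ) + 1 + lam) * (cc lam (n + 1) z + z * cd lam (n + 1) z)
      - ((n : ℝ) + 2 * lam) * cd lam n z := by
  have : (n : ℝ) + 2 ≠ 0 := by positivity
  simp only [cd, cc, CP, Polynomial.derivative_mul, Polynomial.derivative_C,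
    Polynomial.derivative_X, Polynomial.derivative_sub, Polynomial.eval_mul, Polynomial.eval_C,
    Polynomial.eval_sub, Polynomial.eval_add, Polynomial.eval_zero, Polynomial.eval_one,
    Polynomial.eval_X]
  field_simp
  ring

lemma cc_ab (lam : ℝ) (n : ℕ) (z : ℝ) :
    ((n : ℝ) + 1) * cc lam (n + 1) z = z * cd lam (n + 1) z - cd lam n z ∧
    ((n : ℝ) + 2 * lam) * cc lam n z = cd lam (n + 1) z - z * cd lam n z := by
  induction n with
  | zero => simp [cc_zero, cc_one, cd_zero, cd_one]; ring
  | succ n ih =>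
    obtain ⟨ha, hb⟩ := ih
    have h1 := cc_rec lam n z
    have h2 := cd_rec lam n z
    have hn : (n : ℝ) + 2 ≠ 0 := by positivity
    push_cast
    have hb' : ((n : ℝ) + 1 + 2 * lam) * cc lam (n + 1) z
        = cd lam (n + 2) z - z * cd lam (n + 1) z := by
      apply mul_left_cancel₀ hn
      linear_combination -h2 + ((n : ℝ) + 2 * lam) * ha
    refine ⟨?_, hb'⟩
    linear_combination h1 + z * hb' + z * ha - hb

lemma hasDerivAt_cc (lam : ℝ) (n : ℕ) (z : ℝ) : HasDerivAt (cc lam n) (cd lam n z) z :=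
  (CP lam n).hasDerivAt z
lemma hasDerivAt_cd (lam : ℝ) (n : ℕ) (z : ℝ) : HasDerivAt (cd lam n) (ce lam n z) z :=
  (Polynomial.derivative (CP lam n)).hasDerivAt z

lemma cc_ode (lam : ℝ) (n : ℕ) (z : ℝ) :
    (1 - z ^ 2) * ce lam n z - (2 * lam + 1) * z * cd lam n z
      + n * (n + 2 * lam) * cc lam n z = 0 := by
  have ha := (cc_ab lam n z).1
  have hb := (cc_ab lam n z).2
  have ha' : ((n : ℝ) + 1) * cd lam (n + 1) z
      = cd lam (n + 1) z + z * ce lam (n + 1) z - ce lam n z := by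
    have e1 := (hasDerivAt_cc lam (n + 1) z).const_mul ((n : ℝ) + 1)
    have e2 := ((hasDerivAt_id' z).mul (hasDerivAt_cd lam (n + 1) z)).sub (hasDerivAt_cd lam n z)
    have : (fun y => ((n : ℝ) + 1) * cc lam (n + 1) y)
        = ((fun y => y) * cd lam (n + 1) - cd lam n) := by
      ext y; simpa using (cc_ab lam n y).1
    rw [this] at e1
    have := e1.unique e2
    linarith
  have hb' : ((n : ℝ) + 2 * lam) * cd lam n z
      = ce lam (n + 1) z - cd lam n z - z * ce lam n z := by
    have e1 := (hasDerivAt_cc lam n z).const_mul ((n : ℝ) + 2 * lam)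
    have e2 := (hasDerivAt_cd lam (n + 1) z).sub ((hasDerivAt_id' z).mul (hasDerivAt_cd lam n z))
    have : (fun y => ((n : ℝ) + 2 * lam) * cc lam n y)
        = (cd lam (n + 1) - (fun y => y) * cd lam n) := by
      ext y; simpa using (cc_ab lam n y).2
    rw [this] at e1
    have := e1.unique e2
    linarith
  linear_combination n * hb + ha' - z * hb'

lemma cc_neg (lam : ℝ) (n : ℕ) (z : ℝ) : cc lam n (-z) = (-1) ^ n * cc lam n z := by
  have : ∀ n, cc lam n (-z) = (-1) ^ n * cc lam n z ∧
      cc lam (n + 1) (-z) = (-1) ^ (n + 1) * cc lam (n + 1) z := by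
    intro n
    induction n with
    | zero => simp [cc_zero, cc_one]
    | succ n ih =>
      refine ⟨ih.2, ?_⟩
      have h1 := cc_rec lam n z
      have h2 := cc_rec lam n (-z)
      have hn : (n : ℝ) + 2 ≠ 0 := by positivity
      apply mul_left_cancel₀ hn
      rw [ih.1, ih.2] at h2
      have e : ((n:ℝ) + 2) * cc lam (n + 1 + 1) (-z) = (n + 2) * cc lam (n + 2) (-z) := rfl
      rw [e, h2]
      have e : ((-1:ℝ)) ^ (n + 1 + 1) * cc lam (n + 1 + 1) z = (-1) ^ n * cc lam (n + 2) z := by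
        rw [show n + 1 + 1 = n + 2 from rfl, pow_add]; norm_num
      rw [e]
      linear_combination (-1) ^ n * (-h1) 
  exact (this n).1

lemma CP_natDegree (lam : ℝ) (n : ℕ) : (CP lam n).natDegree ≤ n := by
  have : ∀ n, (CP lam n).natDegree ≤ n ∧ (CP lam (n + 1)).natDegree ≤ n + 1 := by
    intro n
    induction n with
    | zero =>
      refine ⟨by simp [CP], ?_⟩
      simp only [CP]
      exact (Polynomial.natDegree_C_mul_le _ _).trans Polynomial.natDegree_X_le
    | succ n ih =>
      refine ⟨ih.2, ?_⟩
      show (CP lam (n + 2)).natDegree ≤ _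
      simp only [CP]
      refine (Polynomial.natDegree_C_mul_le _ _).trans ?_
      refine (Polynomial.natDegree_sub_le _ _).trans (max_le ?_ ?_)
      · refine Polynomial.natDegree_mul_le.trans ?_
        have := (Polynomial.natDegree_C_mul_le (2 * ((n : ℝ) + 1 + lam)) Polynomial.X).trans
          Polynomial.natDegree_X_le
        have := ih.2
        omega
      · refine (Polynomial.natDegree_C_mul_le _ _).trans ?_
        have := ih.1
        omega
  exact (this n).1

lemma CP_lead (lam : ℝ) (n : ℕ) :
    ((n : ℝ) + 1) * (CP lam (n + 1)).coeff (n + 1) = 2 * (n + lam) * (CP lam n).coeff n := by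
  cases n with
  | zero => simp [CP]
  | succ n =>
    have h0 : (CP lam n).coeff (n + 2) = 0 :=
      Polynomial.coeff_eq_zero_of_natDegree_lt (by have := CP_natDegree lam n; omega)
    have hn : (n : ℝ) + 2 ≠ 0 := by positivity
    simp only [CP]
    rw [Polynomial.coeff_C_mul, Polynomial.coeff_sub, Polynomial.coeff_C_mul, h0, mul_assoc,
      Polynomial.coeff_C_mul, Polynomial.coeff_X_mul]
    push_cast
    field_simp
    ring

lemma CP_lead_pos {lam : ℝ} (h : 0 < lam) (n : ℕ) : 0 < (CP lam n).coeff n := by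
  induction n with
  | zero => simp [CP]
  | succ n ih =>
    have := CP_lead lam n
    have h2 : 0 < ((n : ℝ) + 1) * (CP lam (n + 1)).coeff (n + 1) := by rw [this]; positivity
    exact pos_of_mul_pos_right h2 (by positivity)

/-- energy bound -/
lemma cc_bound (lam : ℝ) {ζ : ℝ} (hζ0 : 0 ≤ ζ) (hζ : ζ < 1) :
    ∃ (M : ℝ) (K : ℕ), 0 ≤ M ∧ ∀ n : ℕ, ∀ z : ℝ, |z| ≤ ζ →
      |cc lam n z| ≤ M * ((n : ℝ) + 2) ^ K := by
  set L := 2 * |lam - 1| with hL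
  have hL0 : 0 ≤ L := by positivity
  obtain ⟨K, hK⟩ := exists_nat_ge ((4 * L + 2 * L ^ 2) / (1 - ζ))
  have h1ζ : 0 < 1 - ζ := by linarith
  set E : ℕ → ℝ → ℝ := fun n z => cc lam n z ^ 2 - 2 * z * cc lam n z * cc lam (n + 1) z
    + cc lam (n + 1) z ^ 2 with hE
  have hEl : ∀ n z, |z| ≤ ζ → (1 - ζ) * (cc lam n z ^ 2 + cc lam (n + 1) z ^ 2) ≤ E n z := by
    intro n z hz
    obtain ⟨h1, h2⟩ := abs_le.1 hz
    simp only [hE]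
    nlinarith [mul_nonneg (by linarith : 0 ≤ ζ + z) (sq_nonneg (cc lam n z - cc lam (n+1) z)),
      mul_nonneg (by linarith : 0 ≤ ζ - z) (sq_nonneg (cc lam n z + cc lam (n+1) z))]
  have hEs : ∀ n z, |z| ≤ ζ → E (n + 1) z ≤ (1 + K / ((n : ℝ) + 2)) * E n z := by
    intro n z hz
    have hlow := hEl n z hz
    set x := cc lam n z
    set y := cc lam (n + 1) z
    set δ := (2 * (lam - 1) * z * y - 2 * (lam - 1) * x) / ((n : ℝ) + 2) with hδ
    have hn : (0:ℝ) < (n : ℝ) + 2 := by positivity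
    have hrec : cc lam (n + 2) z = 2 * z * y - x + δ := by
      apply mul_left_cancel₀ hn.ne'
      rw [cc_rec, hδ]
      field_simp
      ring
    have hE1 : E (n + 1) z = E n z + 2 * δ * (z * y - x) + δ ^ 2 := by
      simp only [hE]
      rw [show n + 1 + 1 = n + 2 from rfl, hrec]
      ring
    have hz1 : |z| ≤ 1 := by linarith
    have hw : |z * y - x| ≤ |x| + |y| := by
      calc |z * y - x| ≤ |z * y| + |x| := abs_sub _ _
        _ ≤ |y| + |x| := by rw [abs_mul]; nlinarith [abs_nonneg y]
        _ = _ := by ring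
    have hδb : |δ| ≤ L * (|x| + |y|) / ((n : ℝ) + 2) := by
      rw [hδ, abs_div, abs_of_pos hn]
      gcongr
      have : 2 * (lam - 1) * z * y - 2 * (lam - 1) * x = 2 * (lam - 1) * (z * y - x) := by ring
      rw [this, abs_mul, abs_mul, abs_two]
      gcongr
    have hxy : (|x| + |y|) ^ 2 ≤ 2 * (x ^ 2 + y ^ 2) := by
      nlinarith [sq_nonneg (|x| - |y|), sq_abs x, sq_abs y]
    have t1 : 2 * δ * (z * y - x) ≤ 4 * L * (x ^ 2 + y ^ 2) / ((n : ℝ) + 2) := by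
      calc 2 * δ * (z * y - x) ≤ |2 * δ * (z * y - x)| := le_abs_self _
        _ = 2 * |δ| * |z * y - x| := by rw [abs_mul, abs_mul, abs_two]
        _ ≤ 2 * (L * (|x| + |y|) / ((n : ℝ) + 2)) * (|x| + |y|) := by gcongr
        _ = 2 * L * (|x| + |y|) ^ 2 / ((n : ℝ) + 2) := by ring
        _ ≤ 2 * L * (2 * (x ^ 2 + y ^ 2)) / ((n : ℝ) + 2) := by gcongr
        _ = _ := by ring
    have t2 : δ ^ 2 ≤ 2 * L ^ 2 * (x ^ 2 + y ^ 2) / ((n : ℝ) + 2) := by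
      calc δ ^ 2 = |δ| ^ 2 := (sq_abs _).symm
        _ ≤ (L * (|x| + |y|) / ((n : ℝ) + 2)) ^ 2 := by gcongr
        _ = L ^ 2 * (|x| + |y|) ^ 2 / ((n : ℝ) + 2) / ((n : ℝ) + 2) := by field_simp
        _ ≤ L ^ 2 * (|x| + |y|) ^ 2 / ((n : ℝ) + 2) / 1 := by
          gcongr; have : (0:ℝ) ≤ n := by positivity
          linarith
        _ ≤ L ^ 2 * (2 * (x ^ 2 + y ^ 2)) / ((n : ℝ) + 2) := by rw [div_one]; gcongr
        _ = _ := by ring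
    have hKK : (4 * L + 2 * L ^ 2) * (x ^ 2 + y ^ 2) ≤ K * E n z := by
      rw [div_le_iff₀ h1ζ] at hK
      calc (4 * L + 2 * L ^ 2) * (x ^ 2 + y ^ 2) ≤ (K * (1 - ζ)) * (x ^ 2 + y ^ 2) := by gcongr
        _ = K * ((1 - ζ) * (x ^ 2 + y ^ 2)) := by ring
        _ ≤ _ := by gcongr
    have t3 : (4 * L + 2 * L ^ 2) * (x ^ 2 + y ^ 2) / ((n : ℝ) + 2) ≤ K * E n z / ((n : ℝ) + 2) := by
      gcongr
    rw [hE1]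
    calc _ ≤ E n z + 4 * L * (x ^ 2 + y ^ 2) / ((n : ℝ) + 2)
        + 2 * L ^ 2 * (x ^ 2 + y ^ 2) / ((n : ℝ) + 2) := by linarith
      _ = E n z + (4 * L + 2 * L ^ 2) * (x ^ 2 + y ^ 2) / ((n : ℝ) + 2) := by ring
      _ ≤ E n z + K * E n z / ((n : ℝ) + 2) := by linarith
      _ = _ := by ring
  have hE0 : ∀ z, |z| ≤ ζ → E 0 z ≤ 1 + 4 * |lam| + 4 * lam ^ 2 := by
    intro z hz
    have hz1 : z ^ 2 ≤ 1 := by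
      rw [← sq_abs]; nlinarith [abs_nonneg z]
    simp only [hE, cc_zero, zero_add, cc_one]
    have := neg_abs_le lam
    nlinarith [mul_nonneg (sq_nonneg lam) (by linarith : 0 ≤ 1 - z ^ 2), abs_nonneg lam,
      mul_nonneg (sq_nonneg z) (by linarith : 0 ≤ |lam| + lam)]
  have hEn : ∀ n z, |z| ≤ ζ → E n z ≤ (1 + 4 * |lam| + 4 * lam ^ 2) * ((n : ℝ) + 2) ^ K := by
    intro n z hz
    induction n with
    | zero =>
      refine (hE0 z hz).trans ?_
      have : (1:ℝ) ≤ (((0:ℕ):ℝ) + 2) ^ K := one_le_pow₀ (by norm_num)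
      have h2 : 0 ≤ (1 + 4 * |lam| + 4 * lam ^ 2) := by positivity
      nlinarith
    | succ n ih =>
      have hn : (0:ℝ) < (n : ℝ) + 2 := by positivity
      refine (hEs n z hz).trans ?_
      have hB : 1 + K / ((n : ℝ) + 2) ≤ (1 + 1 / ((n : ℝ) + 2)) ^ K := by
        have := one_add_mul_le_pow (a := 1 / ((n : ℝ) + 2)) (by
          have : 0 < 1 / ((n : ℝ) + 2) := by positivity
          linarith) K
        rwa [mul_one_div] at this
      have hE0' : 0 ≤ E n z := le_trans (by positivity) (hEl n z hz)
      calc _ ≤ (1 + 1 / ((n : ℝ) + 2)) ^ K * ((1 + 4 * |lam| + 4 * lam ^ 2) * ((n : ℝ) + 2) ^ K) := by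
            gcongr
        _ = (1 + 4 * |lam| + 4 * lam ^ 2) * ((1 + 1 / ((n : ℝ) + 2)) * ((n : ℝ) + 2)) ^ K := by
            rw [mul_pow]; ring
        _ = _ := by
            congr 2; push_cast; field_simp; ring
  refine ⟨(1 + 4 * |lam| + 4 * lam ^ 2) / (1 - ζ) + 1, K, by positivity, fun n z hz => ?_⟩
  have h1 := hEl n z hz
  have h2 := hEn n z hz
  have hp : (1:ℝ) ≤ ((n : ℝ) + 2) ^ K := one_le_pow₀ (by
    have : (0:ℝ) ≤ n := by positivity
    linarith)
  have h3 : cc lam n z ^ 2 ≤ (1 + 4 * |lam| + 4 * lam ^ 2) / (1 - ζ) * ((n : ℝ) + 2) ^ K := by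
    rw [div_mul_eq_mul_div, le_div_iff₀ h1ζ]
    nlinarith [sq_nonneg (cc lam (n + 1) z)]
  have h4 : |cc lam n z| ≤ cc lam n z ^ 2 + 1 := by
    rw [← sq_abs]; nlinarith [sq_nonneg (|cc lam n z| - 1), abs_nonneg (cc lam n z)]
  nlinarith

end JR

namespace JR
open scoped Topology

lemma summable_pow_geom (K : ℕ) {r : ℝ} (h0 : 0 ≤ r) (h1 : r < 1) :
    Summable (fun n : ℕ => ((n : ℝ) + 2) ^ K * r ^ n) := by
  have a1 := summable_pow_mul_geometric_of_norm_lt_one (R := ℝ) K (r := r)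
    (by rw [Real.norm_of_nonneg h0]; exact h1)
  have a2 := summable_geometric_of_lt_one h0 h1
  refine Summable.of_nonneg_of_le (fun n => by positivity) (fun n => ?_)
    ((a1.add a2).mul_left (3 ^ K))
  rw [← add_one_mul, ← mul_assoc]
  gcongr
  rcases Nat.eq_zero_or_pos n with h | h
  · subst h
    have h2 : (2:ℝ) ^ K ≤ 3 ^ K := by gcongr; norm_num
    have h3 : (0:ℝ) ≤ 3 ^ K * (0:ℝ) ^ K := by positivity
    simp only [Nat.cast_zero, zero_add]
    linarith
  · have : (1:ℝ) ≤ n := by exact_mod_cast h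
    calc ((n:ℝ) + 2) ^ K ≤ (3 * n) ^ K := by gcongr; linarith
      _ = 3 ^ K * n ^ K := by rw [mul_pow]
      _ ≤ _ := by gcongr; linarith

lemma w_pos {z r : ℝ} (hz : |z| < 1) : 0 < 1 - 2 * r * z + r ^ 2 := by
  have : z ^ 2 < 1 := by rw [← sq_abs]; nlinarith [abs_nonneg z]
  nlinarith [sq_nonneg (r - z)]

lemma summable_cc (lam : ℝ) {z : ℝ} (hz : |z| < 1) (j : ℕ) {r : ℝ} (hr : |r| < 1) :
    Summable (fun n : ℕ => ((n : ℝ) + 2) ^ j * (cc lam n z * r ^ n)) := by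
  obtain ⟨M, K, hM, hb⟩ := cc_bound lam (abs_nonneg z) hz
  refine Summable.of_norm_bounded ((summable_pow_geom (K + j) (abs_nonneg r) hr).mul_left M) ?_
  intro n
  rw [Real.norm_eq_abs, abs_mul, abs_mul, abs_pow, abs_pow, abs_of_nonneg (by positivity : (0:ℝ) ≤ n + 2)]
  calc _ ≤ ((n : ℝ) + 2) ^ j * (M * ((n : ℝ) + 2) ^ K * |r| ^ n) := by
        gcongr; exact hb n z le_rfl
    _ = _ := by rw [pow_add]; ring

lemma hasDerivAt_gen (lam : ℝ) {z : ℝ} (hz : |z| < 1) {r : ℝ} (hr : |r| < 1) :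
    Summable (fun n : ℕ => cc lam n z * (n * r ^ (n - 1))) ∧
    HasDerivAt (fun r => ∑' n, cc lam n z * r ^ n) (∑' n : ℕ, cc lam n z * (n * r ^ (n - 1))) r := by
  obtain ⟨M, K, hM, hb⟩ := cc_bound lam (abs_nonneg z) hz
  obtain ⟨ρ, h1, h2⟩ := exists_between hr
  have hρ : 0 < ρ := (abs_nonneg r).trans_lt h1
  have hu : Summable (fun n : ℕ => M / ρ * (((n : ℝ) + 2) ^ (K + 1) * ρ ^ n)) :=
    (summable_pow_geom (K + 1) hρ.le h2).mul_left _
  have hbd : ∀ (n : ℕ) (y : ℝ), y ∈ Ioo (-ρ) ρ →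
      ‖cc lam n z * (n * y ^ (n - 1))‖ ≤ M / ρ * (((n : ℝ) + 2) ^ (K + 1) * ρ ^ n) := by
    intro n y hy
    have hy' : |y| ≤ ρ := abs_le.2 ⟨hy.1.le, hy.2.le⟩
    rcases n with _ | n
    · simp; positivity
    · rw [Real.norm_eq_abs, abs_mul, abs_mul, abs_pow, Nat.add_sub_cancel, Nat.abs_cast]
      calc _ ≤ (M * (((n + 1 : ℕ) : ℝ) + 2) ^ K) * ((((n + 1 : ℕ) : ℝ) + 2) * ρ ^ n) := by
            gcongr
            · exact hb _ z le_rfl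
            · linarith
        _ = _ := by field_simp; ring
  have hm : r ∈ Ioo (-ρ) ρ := ⟨by linarith [neg_abs_le r], by linarith [le_abs_self r]⟩
  refine ⟨Summable.of_norm_bounded hu (fun n => hbd n r hm), ?_⟩
  refine hasDerivAt_tsum_of_isPreconnected hu isOpen_Ioo isPreconnected_Ioo
    (g := fun n y => cc lam n z * y ^ n) (g' := fun n y => cc lam n z * (n * y ^ (n - 1)))
    (fun n y _ => (hasDerivAt_pow n y).const_mul _) hbd hm ?_ hm
  simpa using summable_cc lam hz 0 hr

lemma gen_ode (lam : ℝ) {z : ℝ} (hz : |z| < 1) {r : ℝ} (hr : |r| < 1) :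
    (1 - 2 * r * z + r ^ 2) * (∑' n : ℕ, cc lam n z * (n * r ^ (n - 1))) =
      2 * lam * (z - r) * ∑' n, cc lam n z * r ^ n := by
  have hA : HasSum (fun n => cc lam n z * r ^ n) (∑' n, cc lam n z * r ^ n) := by
    apply Summable.hasSum
    simpa using summable_cc lam hz 0 hr
  have hB := (hasDerivAt_gen lam hz hr).1.hasSum
  set S := ∑' n, cc lam n z * r ^ n
  set S1 := ∑' n : ℕ, cc lam n z * (n * r ^ (n - 1))
  have hA1 := (hasSum_nat_add_iff' (f := fun n => cc lam n z * r ^ n) 1).2 hA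
  have hB1 := (hasSum_nat_add_iff' (f := fun n : ℕ => cc lam n z * (n * r ^ (n - 1))) 1).2 hB
  have hB2 := (hasSum_nat_add_iff' (f := fun n : ℕ => cc lam n z * (n * r ^ (n - 1))) 2).2 hB
  simp only [Finset.sum_range_succ, Finset.sum_range_zero, cc_zero, cc_one] at hA1 hB1 hB2
  have h := (((hB1.mul_left (2 * z * r)).add (hA1.mul_left (2 * lam * z))).sub
    (hB.mul_left (r ^ 2))).sub (hA.mul_left (2 * lam * r))
  have heq := hB2.unique (h.congr_fun ?_)
  · norm_num at heq
    linear_combination heq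
  intro n
  have hrec := cc_rec lam n z
  have e1 : (n : ℝ) * r ^ (n - 1) * r ^ 2 = n * r ^ (n + 1) := by
    rcases n with _ | n
    · simp
    · rw [Nat.add_sub_cancel]; ring
  simp only [Nat.add_sub_cancel, show n + 2 - 1 = n + 1 from rfl]
  push_cast
  linear_combination (r ^ (n+1)) * hrec + (cc lam n z) * e1

lemma gen_eq (lam : ℝ) {z : ℝ} (hz : |z| < 1) {r : ℝ} (hr : |r| < 1) :
    ∑' n, cc lam n z * r ^ n = (1 - 2 * r * z + r ^ 2) ^ (-lam) := by
  have hd : ∀ y ∈ Ioo (-1 : ℝ) 1, HasDerivAt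
      (fun r => (∑' n, cc lam n z * r ^ n) * (1 - 2 * r * z + r ^ 2) ^ lam) 0 y := by
    intro y hy
    have hy' : |y| < 1 := abs_lt.2 hy
    have h1 := (hasDerivAt_gen lam hz hy').2
    have hw := w_pos (r := y) hz
    have h2 : HasDerivAt (fun r : ℝ => 1 - 2 * r * z + r ^ 2) (-2 * z + 2 * y) y := by
      have := ((((hasDerivAt_id' y).const_mul 2).mul_const z).const_sub 1).add (hasDerivAt_pow 2 y)
      exact this.congr_deriv (by norm_num)
    have h3 := h1.mul (h2.rpow_const (p := lam) (Or.inl hw.ne'))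
    refine h3.congr_deriv ?_
    have ho := gen_ode lam hz hy'
    have e : (1 - 2 * y * z + y ^ 2) ^ lam
        = (1 - 2 * y * z + y ^ 2) * (1 - 2 * y * z + y ^ 2) ^ (lam - 1) := by
      rw [Real.rpow_sub_one hw.ne']; field_simp
    rw [e]
    linear_combination (1 - 2 * y * z + y ^ 2) ^ (lam - 1) * ho
  have hconst := isOpen_Ioo.is_const_of_deriv_eq_zero (s := Ioo (-1:ℝ) 1) isPreconnected_Ioo
    (fun y hy => (hd y hy).differentiableAt.differentiableWithinAt)
    (fun y hy => (hd y hy).deriv) (abs_lt.1 hr) (show (0:ℝ) ∈ Ioo (-1:ℝ) 1 by norm_num)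
  have h0 : ∑' n, cc lam n z * (0:ℝ) ^ n = 1 := by
    rw [tsum_eq_single 0]
    · simp [cc_zero]
    · intro n hn; simp [hn]
  simp only [h0] at hconst
  norm_num at hconst
  have hw := w_pos (r := r) hz
  rw [Real.rpow_neg hw.le]
  exact eq_inv_of_mul_eq_one_left hconst

lemma gen_hasSum (lam : ℝ) {z : ℝ} (hz : |z| < 1) {r : ℝ} (hr : |r| < 1) :
    HasSum (fun n : ℕ => ((n : ℝ) + lam) * (cc lam n z * r ^ n))
      (lam * (1 - r ^ 2) * (1 - 2 * r * z + r ^ 2) ^ (-lam - 1)) := by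
  have hA : HasSum (fun n => cc lam n z * r ^ n) (∑' n, cc lam n z * r ^ n) := by
    apply Summable.hasSum
    simpa using summable_cc lam hz 0 hr
  have hB := (hasDerivAt_gen lam hz hr).1.hasSum
  have h := (hB.mul_left r).add (hA.mul_left lam)
  have ho := gen_ode lam hz hr
  have hw := w_pos (r := r) hz
  set S1 := ∑' n : ℕ, cc lam n z * (n * r ^ (n - 1))
  rw [gen_eq lam hz hr] at h ho
  have e : (1 - 2 * r * z + r ^ 2) ^ (-lam)
        = (1 - 2 * r * z + r ^ 2) * (1 - 2 * r * z + r ^ 2) ^ (-lam - 1) := by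
      rw [Real.rpow_sub_one hw.ne']; field_simp
  have hS1 : S1 = 2 * lam * (z - r) * (1 - 2 * r * z + r ^ 2) ^ (-lam - 1) := by
    apply mul_left_cancel₀ hw.ne'
    rw [ho, e]; ring
  rw [hS1, e] at h
  have e2 : r * (2 * lam * (z - r) * (1 - 2 * r * z + r ^ 2) ^ (-lam - 1)) +
      lam * ((1 - 2 * r * z + r ^ 2) * (1 - 2 * r * z + r ^ 2) ^ (-lam - 1)) =
      lam * (1 - r ^ 2) * (1 - 2 * r * z + r ^ 2) ^ (-lam - 1) := by ring
  rw [e2] at h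
  refine h.congr_fun ?_
  intro n
  rcases n with _ | n
  · simp
  · rw [Nat.add_sub_cancel]; push_cast; ring

/-- the Poisson kernel profile -/
def kk (lam t z : ℝ) : ℝ := sinh (t / 2) * (cosh (t / 2) - z) ^ (-lam - 1)

lemma kk_hasSum {lam : ℝ} (hl : 0 < lam) {z : ℝ} (hz : |z| < 1) {t : ℝ} (ht : 0 < t) :
    HasSum (fun n : ℕ => 2 ^ lam * exp (-(t / 2) * (n + lam)) * (((n : ℝ) + lam) / lam) * cc lam n z)
      (kk lam t z) := by
  set r := exp (-(t / 2)) with hrdef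
  have hr0 : 0 < r := exp_pos _
  have hr1 : r < 1 := by rw [hrdef, exp_lt_one_iff]; linarith
  have hr : |r| < 1 := by rwa [abs_of_pos hr0]
  have h := (gen_hasSum lam hz hr).mul_left (2 ^ lam * r ^ lam / lam)
  have hrr : exp (t / 2) = r⁻¹ := by rw [hrdef, exp_neg, inv_inv]
  have hc : 1 - 2 * r * z + r ^ 2 = 2 * r * (cosh (t / 2) - z) := by
    rw [cosh_eq, ← hrdef, hrr]; field_simp; ring
  have hs : 1 - r ^ 2 = 2 * r * sinh (t / 2) := by
    rw [sinh_eq, ← hrdef, hrr]; field_simp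
  have hY : 0 < cosh (t / 2) - z := by
    have := one_le_cosh (t / 2)
    have := (abs_lt.1 hz).2
    linarith
  have e : 2 ^ lam * r ^ lam / lam * (lam * (1 - r ^ 2) * (1 - 2 * r * z + r ^ 2) ^ (-lam - 1)) =
      kk lam t z := by
    rw [hc, hs, Real.mul_rpow (by positivity) hY.le, Real.rpow_sub_one (by positivity),
      Real.rpow_neg (by positivity), Real.mul_rpow (by norm_num) hr0.le, kk]
    have : (2:ℝ) ^ lam ≠ 0 := by positivity
    have : r ^ lam ≠ 0 := by positivity
    field_simp
  rw [e] at h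
  refine h.congr_fun ?_
  intro n
  have : exp (-(t / 2) * (n + lam)) = r ^ n * r ^ lam := by
    rw [hrdef, ← Real.exp_nat_mul, ← Real.exp_mul, ← Real.exp_add]; ring_nf
  rw [this]; ring

end JR

namespace JR
open scoped Topology

/-! ### moments -/
def MM (a : ℝ) (k : ℕ) : ℝ := ∫ ω, cos ω ^ k ∂(Pm a)

lemma MM_odd {a : ℝ} (ha : 0 < a) {k : ℕ} (hk : Odd k) : MM a k = 0 := by
  have h : MM a k = - MM a k := by
    unfold MM
    rw [integral_Pm ha]
    have := intervalIntegral.integral_comp_sub_left (a := 0) (b := π)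
      (fun ω => sin ω ^ (2 * a) * cos ω ^ k) π
    simp only [sub_self, sub_zero, sin_pi_sub, cos_pi_sub, hk.neg_pow, mul_neg,
      intervalIntegral.integral_neg] at this
    linarith
  linarith

lemma MM_rec {a : ℝ} (ha : 0 < a) (k : ℕ) : (k + 2 * a + 2) * MM a (k + 2) = (k + 1) * MM a k := by
  have := isFinite_Pm ha
  have hd : ∀ ω, HasDerivAt (fun ω => cos ω ^ (k + 1)) (-((k + 1) * cos ω ^ k * sin ω)) ω := by
    intro ω
    have := (hasDerivAt_cos ω).pow (k + 1)
    exact this.congr_deriv (by push_cast; simp)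
  have h := ibp_Pm ha hd (by fun_prop)
  have hi : ∀ j : ℕ, Integrable (fun ω => cos ω ^ j) (Pm a) := by
    intro j
    refine Integrable.of_bound (Continuous.aestronglyMeasurable (by fun_prop)) 1
      (Filter.Eventually.of_forall fun ω => ?_)
    rw [norm_pow, Real.norm_eq_abs]
    exact pow_le_one₀ (abs_nonneg _) (abs_cos_le_one _)
  have e1 : ∀ ω, -((k + 1) * cos ω ^ k * sin ω) * sin ω =
      (k + 1) * cos ω ^ (k + 2) - (k + 1) * cos ω ^ k := by
    intro ω
    have := sin_sq_add_cos_sq ω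
    rw [pow_add]
    linear_combination (-((k:ℝ)+1) * cos ω ^ k) * this
  have e2 : ∀ ω, cos ω ^ (k + 1) * cos ω = cos ω ^ (k + 2) := by intro ω; ring
  simp only [e1, e2] at h
  rw [integral_sub ((hi _).const_mul _) ((hi _).const_mul _), integral_const_mul,
    integral_const_mul] at h
  unfold MM
  linarith

lemma MM_zero_pos {a : ℝ} (ha : 0 < a) : 0 < MM a 0 := by
  unfold MM
  rw [integral_Pm ha]
  simp only [pow_zero, mul_one]
  refine intervalIntegral.intervalIntegral_pos_of_pos_on
    ((cont_sinpow (by linarith)).intervalIntegrable _ _) ?_ pi_pos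
  intro x hx
  exact rpow_pos_of_pos (sin_pos_of_pos_of_lt_pi hx.1 hx.2) _

lemma MM_even_pos {a : ℝ} (ha : 0 < a) (n : ℕ) : 0 < MM a (2 * n) := by
  induction n with
  | zero => exact MM_zero_pos ha
  | succ n ih =>
    have h := MM_rec ha (2 * n)
    have h2 : 0 < (((2 * n : ℕ) : ℝ) + 2 * a + 2) * MM a (2 * n + 2) := by
      rw [h]; positivity
    exact pos_of_mul_pos_right h2 (by positivity)

/-! ### FF of monomials -/
section
variable {a b : ℝ} (ha : 0 < a) (hb : 0 < b)
include ha hb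

lemma FF_pow (k : ℕ) (θ φ : ℝ) : FF (nu a b) (fun z => z ^ k) θ φ =
    ∑ j ∈ Finset.range (k + 1), (sin (θ / 2) * sin (φ / 2)) ^ j *
      (cos (θ / 2) * cos (φ / 2)) ^ (k - j) * (k.choose j) * (MM a j * MM b (k - j)) := by
  have := isFinite_Pm ha
  have := isFinite_Pm hb
  unfold FF zz
  simp only [add_pow]
  rw [integral_finsetSum]
  · refine Finset.sum_congr rfl fun j _ => ?_
    unfold MM nu
    rw [← integral_prod_mul, ← integral_const_mul]
    congr 1; ext p; rw [mul_pow, mul_pow]; ring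
  · intro j _
    have hi : ∀ (c : ℝ) [IsFiniteMeasure (Pm c)] (j : ℕ), Integrable (fun ω => cos ω ^ j) (Pm c) := by
      intro c _ j
      refine Integrable.of_bound (Continuous.aestronglyMeasurable (by fun_prop)) 1
        (Filter.Eventually.of_forall fun ω => ?_)
      rw [norm_pow, Real.norm_eq_abs]
      exact pow_le_one₀ (abs_nonneg _) (abs_cos_le_one _)
    have := ((hi a j).mul_prod (hi b (k - j))).const_mul
      ((sin (θ / 2) * sin (φ / 2)) ^ j * (cos (θ / 2) * cos (φ / 2)) ^ (k - j) * (k.choose j))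
    refine this.congr (Filter.Eventually.of_forall fun p => ?_)
    simp only [mul_pow]; ring

lemma FF_odd {k : ℕ} (hk : Odd k) (θ φ : ℝ) : FF (nu a b) (fun z => z ^ k) θ φ = 0 := by
  rw [FF_pow ha hb]
  refine Finset.sum_eq_zero fun j hj => ?_
  rcases Nat.even_or_odd j with h | h
  · have : Odd (k - j) := by
      rw [Finset.mem_range] at hj
      exact Nat.Odd.sub_even (by omega) hk h
    rw [MM_odd hb this]; ring
  · rw [MM_odd ha h]; ring

lemma FF_cc (lam : ℝ) (n : ℕ) (θ φ : ℝ) : FF (nu a b) (cc lam n) θ φ =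
    ∑ k ∈ Finset.range (n + 1), (CP lam n).coeff k * FF (nu a b) (fun z => z ^ k) θ φ := by
  have := isFinite_nu ha hb
  unfold FF cc
  simp only [Polynomial.eval_eq_sum_range' (Nat.lt_succ_of_le (CP_natDegree lam n))]
  rw [integral_finsetSum]
  · simp only [integral_const_mul]
  · intro k _
    refine Integrable.const_mul (Integrable.of_bound
      (Continuous.aestronglyMeasurable ((continuous_zz θ φ).pow k)) 1
      (Filter.Eventually.of_forall fun p => ?_)) _
    show ‖zz p θ φ ^ k‖ ≤ 1
    rw [norm_pow, Real.norm_eq_abs]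
    exact pow_le_one₀ (abs_nonneg _) (abs_zz_le_one _ _ _)

lemma FF_cc_odd (lam : ℝ) {n : ℕ} (hn : Odd n) (θ φ : ℝ) : FF (nu a b) (cc lam n) θ φ = 0 := by
  have hc : ∀ k ∈ Finset.range (n + 1), (CP lam n).coeff k * FF (nu a b) (fun z => z ^ k) θ φ = 0 := by
    intro k _
    rcases Nat.even_or_odd k with h | h
    · have : (CP lam n).comp (Polynomial.C (-1) * Polynomial.X) = -(CP lam n) := by
        apply Polynomial.funext
        intro z
        have := cc_neg lam n z
        unfold cc at this
        rw [hn.neg_one_pow] at this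
        simp [this]
      have h2 := congrArg (fun p => Polynomial.coeff p k) this
      simp only [Polynomial.comp_C_mul_X_coeff, h.neg_one_pow, Polynomial.coeff_neg, mul_one] at h2
      have : (CP lam n).coeff k = 0 := by linarith
      rw [this, zero_mul]
    · rw [FF_odd ha hb h, mul_zero]
  rw [FF_cc ha hb, Finset.sum_eq_zero hc]

lemma FF_cc_cont (lam : ℝ) (n : ℕ) (θ : ℝ) : Continuous fun φ => FF (nu a b) (cc lam n) θ φ := by
  simp only [FF_cc ha hb, FF_pow ha hb]
  fun_prop

lemma FF_cc_zero (lam : ℝ) (n : ℕ) (θ : ℝ) : FF (nu a b) (cc lam n) θ 0 =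
    ∑ k ∈ Finset.range (n + 1), (CP lam n).coeff k * (MM a 0 * MM b k) * cos (θ / 2) ^ k := by
  rw [FF_cc ha hb]
  refine Finset.sum_congr rfl fun k _ => ?_
  rw [FF_pow ha hb, Finset.sum_eq_single 0]
  · simp; ring
  · intro j _ hj; simp [hj]
  · simp

lemma FF_pow_poly (k : ℕ) (φ : ℝ) : ∃ p : Polynomial ℝ, p.natDegree ≤ k / 2 ∧
    ∀ θ, FF (nu a b) (fun z => z ^ k) θ φ = p.eval ((cos θ - 1) / 2) := by
  have hterm : ∀ j ∈ Finset.range (k + 1), ∃ p : Polynomial ℝ, p.natDegree ≤ k / 2 ∧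
      ∀ θ, (sin (θ / 2) * sin (φ / 2)) ^ j *
      (cos (θ / 2) * cos (φ / 2)) ^ (k - j) * (k.choose j) * (MM a j * MM b (k - j))
        = p.eval ((cos θ - 1) / 2) := by
    intro j hj
    rw [Finset.mem_range] at hj
    rcases Nat.even_or_odd j with h | h
    swap
    · exact ⟨0, by simp, fun θ => by rw [MM_odd ha h]; simp⟩
    rcases Nat.even_or_odd (k - j) with h' | h'
    swap
    · exact ⟨0, by simp, fun θ => by rw [MM_odd hb h']; simp⟩
    obtain ⟨i, hi⟩ := h
    obtain ⟨l, hl⟩ := h'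
    refine ⟨Polynomial.C (sin (φ / 2) ^ j * cos (φ / 2) ^ (k - j) * (k.choose j) *
      (MM a j * MM b (k - j))) * ((-Polynomial.X) ^ i * (1 + Polynomial.X) ^ l), ?_, ?_⟩
    · refine (Polynomial.natDegree_C_mul_le _ _).trans ?_
      refine Polynomial.natDegree_mul_le.trans ?_
      have h1 : ((-Polynomial.X : Polynomial ℝ) ^ i).natDegree ≤ i := by
        refine Polynomial.natDegree_pow_le.trans ?_
        simp
      have h2 : ((1 + Polynomial.X : Polynomial ℝ) ^ l).natDegree ≤ l := by
        refine Polynomial.natDegree_pow_le.trans ?_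
        have : (1 + Polynomial.X : Polynomial ℝ).natDegree ≤ 1 := by
          refine (Polynomial.natDegree_add_le _ _).trans ?_
          simp
        nlinarith
      omega
    · intro θ
      have hc : cos θ = 2 * cos (θ / 2) ^ 2 - 1 := by
        rw [← cos_two_mul]; ring_nf
      have hs : cos θ = 1 - 2 * sin (θ / 2) ^ 2 := by
        linarith [sin_sq_add_cos_sq (θ / 2)]
      have e1 : sin (θ / 2) ^ j = (-((cos θ - 1) / 2)) ^ i := by
        rw [hi, ← two_mul, pow_mul, hs]; ring
      have e2 : cos (θ / 2) ^ (k - j) = (1 + (cos θ - 1) / 2) ^ l := by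
        rw [hl, ← two_mul, pow_mul, hc]; ring
      simp only [Polynomial.eval_mul, Polynomial.eval_C, Polynomial.eval_pow, Polynomial.eval_neg,
        Polynomial.eval_X, Polynomial.eval_add, Polynomial.eval_one]
      rw [mul_pow, mul_pow, e1, e2]
      ring
  choose! p hp1 hp2 using hterm
  refine ⟨∑ j ∈ Finset.range (k + 1), p j, Polynomial.natDegree_sum_le_of_forall_le _ _ hp1, ?_⟩
  intro θ
  rw [FF_pow ha hb, Polynomial.eval_finsetSum]
  exact Finset.sum_congr rfl fun j hj => hp2 j hj θ

lemma FF_cc_poly (lam : ℝ) (n : ℕ) (φ : ℝ) : ∃ p : Polynomial ℝ, p.natDegree ≤ n ∧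
    ∀ θ, FF (nu a b) (cc lam (2 * n)) θ φ = p.eval ((cos θ - 1) / 2) := by
  choose p hp1 hp2 using fun k => FF_pow_poly ha hb k φ
  refine ⟨∑ k ∈ Finset.range (2 * n + 1), Polynomial.C ((CP lam (2 * n)).coeff k) * p k,
    Polynomial.natDegree_sum_le_of_forall_le _ _ fun k hk => ?_, fun θ => ?_⟩
  · refine (Polynomial.natDegree_C_mul_le _ _).trans ((hp1 k).trans ?_)
    rw [Finset.mem_range] at hk; omega
  · rw [FF_cc ha hb, Polynomial.eval_finsetSum]
    exact Finset.sum_congr rfl fun j hj => by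
      rw [hp2, Polynomial.eval_mul, Polynomial.eval_C]
end

end JR

namespace JR
open scoped Topology

/-! ### Jacobi polynomials -/
def jc (a b : ℝ) (n m : ℕ) : ℝ :=
  (Real.Gamma (a + n + 1) * Real.Gamma (a + b + n + m + 1)) /
      ((m.factorial : ℝ) * ((n - m).factorial : ℝ) * Real.Gamma (a + b + n + 1) *
        Real.Gamma (a + m + 1))

def JPo (a b : ℝ) (n : ℕ) : Polynomial ℝ :=
  ∑ m ∈ Finset.range (n + 1), Polynomial.C (jc a b n m) * Polynomial.X ^ m

lemma JPo_eval (a b : ℝ) (n : ℕ) (x : ℝ) : (JPo a b n).eval ((x - 1) / 2) = jacobiP a b n x := by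
  simp [JPo, jacobiP, jc, Polynomial.eval_finsetSum]

lemma JPo_coeff (a b : ℝ) (n m : ℕ) : (JPo a b n).coeff m = if m ≤ n then jc a b n m else 0 := by
  simp [JPo, Polynomial.finsetSum_coeff, Polynomial.coeff_C_mul, Polynomial.coeff_X_pow,
    Nat.lt_succ_iff]

lemma JPo_natDegree (a b : ℝ) (n : ℕ) : (JPo a b n).natDegree ≤ n := by
  rw [Polynomial.natDegree_le_iff_coeff_eq_zero]
  intro m hm
  rw [JPo_coeff, if_neg (by omega)]

section
variable {a b : ℝ} (ha : 0 < a) (hb : 0 < b)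
include ha hb

lemma jc_pos (n m : ℕ) : 0 < jc a b n m := by
  unfold jc
  have := Real.Gamma_pos_of_pos (by positivity : 0 < a + n + 1)
  have := Real.Gamma_pos_of_pos (by positivity : 0 < a + b + n + m + 1)
  have := Real.Gamma_pos_of_pos (by positivity : 0 < a + b + n + 1)
  have := Real.Gamma_pos_of_pos (by positivity : 0 < a + m + 1)
  positivity

lemma jc_rec {n m : ℕ} (h : m < n) :
    ((m : ℝ) + 1) * (m + a + 1) * jc a b n (m + 1) = (n - m) * (n + m + (a + b + 1)) * jc a b n m := by
  obtain ⟨k, rfl⟩ : ∃ k, n = m + k + 1 := ⟨n - m - 1, by omega⟩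
  unfold jc
  have e1 : m + k + 1 - (m + 1) = k := by omega
  have e2 : m + k + 1 - m = k + 1 := by omega
  rw [e1, e2, Nat.factorial_succ, Nat.factorial_succ]
  push_cast
  have g1 : Real.Gamma (a + b + (m + k + 1) + (m + 1) + 1) =
      (a + b + (m + k + 1) + m + 1) * Real.Gamma (a + b + (m + k + 1) + m + 1) := by
    rw [← Real.Gamma_add_one (by positivity)]; ring_nf
  have g2 : Real.Gamma (a + (m + 1) + 1) = (a + m + 1) * Real.Gamma (a + m + 1) := by
    rw [← Real.Gamma_add_one (by positivity)]; ring_nf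
  rw [g1, g2]
  have := Real.Gamma_pos_of_pos (by positivity : 0 < a + b + (m + k + 1) + 1)
  have := Real.Gamma_pos_of_pos (by positivity : 0 < a + m + 1)
  field_simp
  ring

lemma JPo_rec (n m : ℕ) : ((m : ℝ) + 1) * (m + a + 1) * (JPo a b n).coeff (m + 1) =
    (n - m) * (n + m + (a + b + 1)) * (JPo a b n).coeff m := by
  rw [JPo_coeff, JPo_coeff]
  rcases lt_trichotomy m n with h | h | h
  · rw [if_pos (by omega), if_pos (by omega)]; exact jc_rec ha hb h
  · subst h; simp
  · rw [if_neg (by omega), if_neg (by omega)]; simp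
end

open Polynomial in
/-- Jacobi differential operator -/
def Dop (a b ν : ℝ) (p : ℝ[X]) : ℝ[X] :=
  X * (1 + X) * derivative (derivative p) + (C (a + 1) + C (a + b + 2) * X) * derivative p - C ν * p

lemma Dop_coeff (a b ν : ℝ) (p : Polynomial ℝ) (m : ℕ) : (Dop a b ν p).coeff m =
    ((m : ℝ) + 1) * (m + a + 1) * p.coeff (m + 1) - (ν - m * (m + (a + b + 1))) * p.coeff m := by
  unfold Dop
  have e : (Polynomial.X * (1 + Polynomial.X) * Polynomial.derivative (Polynomial.derivative p)
    + (Polynomial.C (a + 1) + Polynomial.C (a + b + 2) * Polynomial.X) * Polynomial.derivative p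
      - Polynomial.C ν * p) =
     Polynomial.X * (Polynomial.derivative (Polynomial.derivative p)) +
     Polynomial.X * (Polynomial.X * (Polynomial.derivative (Polynomial.derivative p))) +
     Polynomial.C (a + 1) * Polynomial.derivative p +
     Polynomial.C (a + b + 2) * (Polynomial.X * Polynomial.derivative p) - Polynomial.C ν * p := by
    ring
  rw [e]
  simp only [Polynomial.coeff_add, Polynomial.coeff_sub, Polynomial.coeff_C_mul]
  rcases m with _ | _ | m
  · simp [Polynomial.coeff_derivative]
  · simp [Polynomial.coeff_derivative, Polynomial.coeff_X_mul]
    ring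
  · simp only [Polynomial.coeff_derivative, Polynomial.coeff_X_mul]
    push_cast
    ring

lemma Dop_eval (a b ν : ℝ) (p : Polynomial ℝ) (u : ℝ) : (Dop a b ν p).eval u =
    u * (1 + u) * (Polynomial.derivative (Polynomial.derivative p)).eval u
     + ((a + 1) + (a + b + 2) * u) * (Polynomial.derivative p).eval u - ν * p.eval u := by
  simp [Dop]

section
variable {a b : ℝ} (ha : 0 < a) (hb : 0 < b)
include ha hb

lemma Dop_JPo (n : ℕ) : Dop a b (n * (n + (a + b + 1))) (JPo a b n) = 0 := by
  ext m
  rw [Dop_coeff, JPo_rec ha hb, Polynomial.coeff_zero]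
  ring

lemma poly_unique (n : ℕ) (p : Polynomial ℝ) (h : Dop a b (n * (n + (a + b + 1))) p = 0)
    (hd : p.natDegree ≤ n) :
    Polynomial.C (jc a b n 0) * p = Polynomial.C (p.coeff 0) * JPo a b n := by
  ext m
  rw [Polynomial.coeff_C_mul, Polynomial.coeff_C_mul]
  induction m with
  | zero => rw [JPo_coeff, if_pos (by omega)]; ring
  | succ m ih =>
    have h1 := JPo_rec ha hb n m
    have h2 := congrArg (fun q => Polynomial.coeff q m) h
    simp only [Dop_coeff, Polynomial.coeff_zero] at h2
    have hm : ((m : ℝ) + 1) * (m + a + 1) ≠ 0 := by positivity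
    apply mul_left_cancel₀ hm
    linear_combination jc a b n 0 * h2 - p.coeff 0 * h1 + ((n:ℝ) - m) * (n + m + (a + b + 1)) * ih

lemma hasDerivAt_u (θ : ℝ) : HasDerivAt (fun θ => (cos θ - 1) / 2) (-sin θ / 2) θ :=
  (((hasDerivAt_cos θ).sub_const 1).div_const 2)

lemma FF_cc_ode (n : ℕ) {φ : ℝ} (hφ : φ ∈ Ioo 0 π) (p : Polynomial ℝ)
    (hp : ∀ θ, FF (nu a b) (cc (a + b + 1) (2 * n)) θ φ = p.eval ((cos θ - 1) / 2)) :
    Dop a b (n * (n + (a + b + 1))) p = 0 := by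
  have := isFinite_nu ha hb
  set lam := a + b + 1 with hlam
  have hc1 : ∀ z < 1, HasDerivAt (cc lam (2 * n)) (cd lam (2 * n) z) z :=
    fun z _ => hasDerivAt_cc lam _ z
  have hc2 : ∀ z < 1, HasDerivAt (cd lam (2 * n)) (ce lam (2 * n) z) z :=
    fun z _ => hasDerivAt_cd lam _ z
  have hk1 : ContinuousOn (cd lam (2 * n)) (Iio 1) := cont_of_deriv hc2
  have hk2 : ContinuousOn (ce lam (2 * n)) (Iio 1) := (Polynomial.continuous _).continuousOn
  have hf1 : ∀ θ ∈ Ioo 0 π, θ ≠ φ → FFt (nu a b) (cd lam (2 * n)) θ φ =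
      (Polynomial.derivative p).eval ((cos θ - 1) / 2) * (-sin θ / 2) := by
    intro θ hθ hne
    have h1 := hasDerivAt_FF (ν := nu a b) hc1 hk1 hθ hφ hne
    have h2 := (p.hasDerivAt ((cos θ - 1) / 2)).comp θ (hasDerivAt_u ha hb θ)
    have he : (fun θ => FF (nu a b) (cc lam (2 * n)) θ φ) = (fun x => p.eval x) ∘ (fun θ => (cos θ - 1) / 2) := by
      ext y; exact hp y
    rw [he] at h1
    exact h1.unique h2
  have hf2 : ∀ θ ∈ Ioo 0 π, θ ≠ φ → FFtt (nu a b) (cd lam (2 * n)) (ce lam (2 * n)) θ φ =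
      (Polynomial.derivative (Polynomial.derivative p)).eval ((cos θ - 1) / 2) * (-sin θ / 2) *
        (-sin θ / 2) + (Polynomial.derivative p).eval ((cos θ - 1) / 2) * (-cos θ / 2) := by
    intro θ hθ hne
    have h1 := hasDerivAt_FFt (ν := nu a b) hc2 hk2 hθ hφ hne
    have h2 := (((Polynomial.derivative p).hasDerivAt ((cos θ - 1) / 2)).comp θ
      (hasDerivAt_u ha hb θ)).mul (((hasDerivAt_sin θ).neg).div_const 2)
    have hev : (fun θ => FFt (nu a b) (cd lam (2 * n)) θ φ) =ᶠ[𝓝 θ]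
      ((fun x => (Polynomial.derivative p).eval x) ∘ (fun θ => (cos θ - 1) / 2)) * (fun θ => -sin θ / 2) := by
      have : (Ioo 0 π ∩ {φ}ᶜ) ∈ 𝓝 θ :=
        (isOpen_Ioo.inter isOpen_compl_singleton).mem_nhds ⟨hθ, hne⟩
      filter_upwards [this] with y hy
      exact hf1 y hy.1 hy.2
    exact (h1.congr_of_eventuallyEq hev.symm).unique h2
  have hinf : ∀ θ ∈ Ioo 0 π, θ ≠ φ → (Dop a b (n * (n + lam)) p).eval ((cos θ - 1) / 2) = 0 := by
    intro θ hθ hne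
    have hi := intertwine ha hb hc2 hk2 hθ hφ hne
    have hA : FF (nu a b) (Aop (a + b + 1) (cd lam (2 * n)) (ce lam (2 * n))) θ φ =
        (n * (n + lam)) * FF (nu a b) (cc lam (2 * n)) θ φ := by
      unfold FF
      rw [← integral_const_mul]
      congr 1; ext q
      have := cc_ode lam (2 * n) (zz q θ φ)
      unfold Aop
      rw [← hlam]
      push_cast at this
      linear_combination (-(1/4)) * this
    rw [hA, hf1 θ hθ hne, hf2 θ hθ hne, hp] at hi
    rw [Dop_eval]
    obtain ⟨hs, hc⟩ := hpos hθ
    have es : sin θ = 2 * sin (θ / 2) * cos (θ / 2) := by rw [← sin_two_mul]; ring_nf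
    have ec : cos θ = 2 * cos (θ / 2) ^ 2 - 1 := by rw [← cos_two_mul]; ring_nf
    have e1 := sin_sq_add_cos_sq (θ / 2)
    rw [es] at hi
    generalize (Polynomial.eval ((cos θ - 1) / 2) p) = P0 at *
    generalize (Polynomial.eval ((cos θ - 1) / 2) (Polynomial.derivative p)) = P1 at *
    generalize (Polynomial.eval ((cos θ - 1) / 2) (Polynomial.derivative (Polynomial.derivative p))) = P2 at *
    rw [ec] at hi ⊢
    field_simp at hi
    have e1' : sin (θ / 2) ^ 2 = 1 - cos (θ / 2) ^ 2 := by linarith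
    linear_combination (-1/2) * hi + (P2 * cos (θ/2)^2 + (b + 1/2) * P1) * e1'
  apply Polynomial.eq_zero_of_infinite_isRoot
  have hinj : InjOn (fun θ => (cos θ - 1) / 2) (Ioo 0 π ∩ {φ}ᶜ) := by
    intro x hx y hy hxy
    have : cos x = cos y := by simp only at hxy; linarith
    exact injOn_cos ⟨hx.1.1.le, hx.1.2.le⟩ ⟨hy.1.1.le, hy.1.2.le⟩ this
  have hS : (Ioo 0 π ∩ {φ}ᶜ).Infinite := by
    rw [← sdiff_eq]
    exact (Ioo_infinite pi_pos).sdiff (finite_singleton φ)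
  refine (hS.image hinj).mono ?_
  rintro _ ⟨θ, hθ, rfl⟩
  exact hinf θ hθ.1 hθ.2

lemma FF_cc_eq (n : ℕ) {φ : ℝ} (hφ : φ ∈ Icc 0 π) (θ : ℝ) :
    jc a b n 0 * FF (nu a b) (cc (a + b + 1) (2 * n)) θ φ =
      FF (nu a b) (cc (a + b + 1) (2 * n)) 0 φ * jacobiP a b n (cos θ) := by
  have h1 : ∀ φ ∈ Ioo 0 π, jc a b n 0 * FF (nu a b) (cc (a + b + 1) (2 * n)) θ φ =
      FF (nu a b) (cc (a + b + 1) (2 * n)) 0 φ * jacobiP a b n (cos θ) := by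
    intro φ hφ
    obtain ⟨p, hd, hp⟩ := FF_cc_poly ha hb (a + b + 1) n φ
    have ho := FF_cc_ode ha hb n hφ p hp
    have hu := poly_unique ha hb n p ho hd
    have := congrArg (Polynomial.eval ((cos θ - 1) / 2)) hu
    rw [Polynomial.eval_mul, Polynomial.eval_mul, Polynomial.eval_C, Polynomial.eval_C, ← hp,
      JPo_eval] at this
    rw [this, hp 0, Polynomial.coeff_zero_eq_eval_zero]
    simp
  have hcl : IsClosed {φ | jc a b n 0 * FF (nu a b) (cc (a + b + 1) (2 * n)) θ φ =
      FF (nu a b) (cc (a + b + 1) (2 * n)) 0 φ * jacobiP a b n (cos θ)} :=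
    isClosed_eq (continuous_const.mul (FF_cc_cont ha hb _ _ _))
      ((FF_cc_cont ha hb _ _ _).mul continuous_const)
  have := closure_minimal (s := Ioo 0 π) (fun x hx => h1 x hx) hcl
  rw [closure_Ioo pi_pos.ne] at this
  exact this hφ

lemma FF_cc_prod (n : ℕ) {θ φ : ℝ} (hθ : θ ∈ Ioo 0 π) (hφ : φ ∈ Ioo 0 π) :
    jc a b n 0 ^ 2 * FF (nu a b) (cc (a + b + 1) (2 * n)) θ φ =
      FF (nu a b) (cc (a + b + 1) (2 * n)) 0 0 * (jacobiP a b n (cos θ) * jacobiP a b n (cos φ)) := by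
  have h1 := FF_cc_eq ha hb n ⟨hφ.1.le, hφ.2.le⟩ θ
  have h2 := FF_cc_eq ha hb n (φ := 0) ⟨le_rfl, pi_pos.le⟩ φ
  rw [FF_symm _ _ 0 φ] at h1
  linear_combination jc a b n 0 * h1 + jacobiP a b n (cos θ) * h2

lemma FF_cc_lead (n : ℕ) : FF (nu a b) (cc (a + b + 1) (2 * n)) 0 0 * jc a b n n =
    jc a b n 0 * ((CP (a + b + 1) (2 * n)).coeff (2 * n) * (MM a 0 * MM b (2 * n))) := by
  set q : Polynomial ℝ := ∑ k ∈ Finset.range (2 * n + 1), Polynomial.C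
    ((CP (a + b + 1) (2 * n)).coeff k * (MM a 0 * MM b k)) * Polynomial.X ^ k with hq
  set r : Polynomial ℝ := ∑ m ∈ Finset.range (n + 1), Polynomial.C (jc a b n m) *
    (Polynomial.X ^ 2 - Polynomial.C 1) ^ m with hr
  have heq : Polynomial.C (jc a b n 0) * q =
      Polynomial.C (FF (nu a b) (cc (a + b + 1) (2 * n)) 0 0) * r := by
    apply Polynomial.eq_of_infinite_eval_eq
    have hinj : InjOn (fun θ => cos (θ / 2)) (Ioo 0 π) := by
      intro x hx y hy hxy
      have := injOn_cos (x₁ := x / 2) (x₂ := y / 2) ⟨by linarith [hx.1], by linarith [hx.1, hx.2]⟩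
        ⟨by linarith [hy.1], by linarith [hy.1, hy.2]⟩ hxy
      linarith
    refine ((Ioo_infinite pi_pos).image hinj).mono ?_
    rintro _ ⟨θ, hθ, rfl⟩
    have h2 := FF_cc_eq ha hb n (φ := 0) ⟨le_rfl, pi_pos.le⟩ θ
    rw [FF_cc_zero ha hb] at h2
    have ec : cos θ = 2 * cos (θ / 2) ^ 2 - 1 := by rw [← cos_two_mul]; ring_nf
    have e3 : (cos θ - 1) / 2 = cos (θ / 2) ^ 2 - 1 := by rw [ec]; ring
    rw [← JPo_eval, e3] at h2
    simp only [mem_ofPred_eq, hq, hr, JPo, Polynomial.eval_mul, Polynomial.eval_C,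
      Polynomial.eval_finsetSum, Polynomial.eval_pow, Polynomial.eval_sub, Polynomial.eval_X] at h2 ⊢
    exact h2
  have h := congrArg (fun p => Polynomial.coeff p (2 * n)) heq
  simp only [Polynomial.coeff_C_mul] at h
  have hqc : q.coeff (2 * n) = (CP (a + b + 1) (2 * n)).coeff (2 * n) * (MM a 0 * MM b (2 * n)) := by
    rw [hq]
    simp only [Polynomial.finsetSum_coeff, Polynomial.coeff_C_mul, Polynomial.coeff_X_pow]
    simp
  have hmon : (Polynomial.X ^ 2 - Polynomial.C 1 : Polynomial ℝ).Monic :=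
    Polynomial.monic_X_pow_sub_C _ (by norm_num)
  have hdeg : ∀ m, ((Polynomial.X ^ 2 - Polynomial.C 1 : Polynomial ℝ) ^ m).natDegree = 2 * m := by
    intro m
    rw [hmon.natDegree_pow, Polynomial.natDegree_X_pow_sub_C, mul_comm]
  have hrc : r.coeff (2 * n) = jc a b n n := by
    rw [hr, Polynomial.finsetSum_coeff, Finset.sum_eq_single n]
    · rw [Polynomial.coeff_C_mul]
      have := (hmon.pow n).coeff_natDegree
      rw [hdeg] at this
      rw [this, mul_one]
    · intro m hm hne
      rw [Finset.mem_range] at hm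
      rw [Polynomial.coeff_C_mul, Polynomial.coeff_eq_zero_of_natDegree_lt (by rw [hdeg]; omega),
        mul_zero]
    · simp
  rw [hqc, hrc] at h
  linarith
end
end JR

namespace JR
open scoped Topology

/-- Jacobi weight -/
def WW (a b θ : ℝ) : ℝ := sin (θ / 2) ^ (2 * a + 1) * cos (θ / 2) ^ (2 * b + 1)

lemma half_nonneg {θ : ℝ} (h : θ ∈ Icc 0 π) : 0 ≤ sin (θ / 2) ∧ 0 ≤ cos (θ / 2) := by
  have := pi_pos
  exact ⟨sin_nonneg_of_nonneg_of_le_pi (by linarith [h.1]) (by linarith [h.2]),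
    cos_nonneg_of_neg_pi_div_two_le_of_le (by linarith [h.1]) (by linarith [h.2])⟩

lemma integral_jmp (a b : ℝ) (f : ℝ → ℝ) :
    ∫ θ, f θ ∂(jacobiMeasurePlus a b) = ∫ θ in (0 : ℝ)..π, WW a b θ * f θ := by
  unfold jacobiMeasurePlus jacobiMeasure
  have hpi := pi_pos
  rw [restrict_withDensity measurableSet_Ioo, Measure.restrict_restrict measurableSet_Ioo,
    inter_eq_left.2 (Ioo_subset_Ioo_left (by linarith)),
    intervalIntegral.integral_of_le pi_pos.le, integral_Ioc_eq_integral_Ioo,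
    integral_withDensity_eq_integral_toReal_smul₀]
  · refine setIntegral_congr_fun measurableSet_Ioo fun θ hθ => ?_
    obtain ⟨hs, hc⟩ := hpos hθ
    rw [ENNReal.toReal_ofReal (sq_nonneg _), smul_eq_mul]
    congr 1
    unfold jPsi WW
    rw [abs_of_pos hs, mul_pow, ← rpow_mul_natCast hs.le, ← rpow_mul_natCast hc.le]
    push_cast
    ring_nf
  · apply Measurable.aemeasurable
    unfold jPsi
    have m1 : Measurable fun θ : ℝ => |sin (θ / 2)| ^ (a + 1 / 2) := by fun_prop
    have m2 : Measurable fun θ : ℝ => cos (θ / 2) ^ (b + 1 / 2) := by fun_prop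
    exact ((m1.mul m2).pow_const 2).ennreal_ofReal
  · exact Filter.Eventually.of_forall fun _ => ENNReal.ofReal_lt_top

section
variable {a b : ℝ} (ha : 0 < a) (hb : 0 < b)
include ha hb

lemma cont_WW : Continuous (WW a b) := by
  unfold WW
  exact ((by fun_prop : Continuous fun θ : ℝ => sin (θ / 2)).rpow_const fun _ => Or.inr (by linarith)).mul
    ((by fun_prop : Continuous fun θ : ℝ => cos (θ / 2)).rpow_const fun _ => Or.inr (by linarith))

lemma ibpW {F F' : ℝ → ℝ} (hF : ∀ θ, HasDerivAt F (F' θ) θ) (hF' : Continuous F') :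
    ∫ θ in (0:ℝ)..π, WW a b θ * (((a + 1) * cos (θ / 2) ^ 2 - (b + 1) * sin (θ / 2) ^ 2) * F θ) =
      - ∫ θ in (0:ℝ)..π, WW a b θ * (sin (θ / 2) * cos (θ / 2) * F' θ) := by
  set V : ℝ → ℝ := fun θ => sin (θ / 2) ^ (2 * a + 2) * cos (θ / 2) ^ (2 * b + 2) with hV
  set V' : ℝ → ℝ := fun θ => (cos (θ / 2) / 2 * (2 * a + 2) * sin (θ / 2) ^ (2 * a + 2 - 1)) * cos (θ / 2) ^ (2 * b + 2)
      + sin (θ / 2) ^ (2 * a + 2) * (-sin (θ / 2) / 2 * (2 * b + 2) * cos (θ / 2) ^ (2 * b + 2 - 1)) with hV'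
  have hd : ∀ θ, HasDerivAt V (V' θ) θ := fun θ =>
    ((hasDerivAt_sin_half θ).rpow_const (p := 2 * a + 2) (Or.inr (by linarith))).mul
      ((hasDerivAt_cos_half θ).rpow_const (p := 2 * b + 2) (Or.inr (by linarith)))
  have cs : ∀ p : ℝ, 0 ≤ p → Continuous fun θ : ℝ => sin (θ / 2) ^ p := fun p hp =>
    (by fun_prop : Continuous fun θ : ℝ => sin (θ / 2)).rpow_const fun _ => Or.inr hp
  have cc' : ∀ p : ℝ, 0 ≤ p → Continuous fun θ : ℝ => cos (θ / 2) ^ p := fun p hp =>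
    (by fun_prop : Continuous fun θ : ℝ => cos (θ / 2)).rpow_const fun _ => Or.inr hp
  have hVc : Continuous V' := by
    have c1 := cs (2 * a + 2) (by linarith)
    have c2 := cs (2 * a + 2 - 1) (by linarith)
    have c3 := cc' (2 * b + 2) (by linarith)
    have c4 := cc' (2 * b + 2 - 1) (by linarith)
    simp only [hV']
    fun_prop
  have key := intervalIntegral.integral_mul_deriv_eq_deriv_mul (a := 0) (b := π)
    (u := V) (v := F) (u' := V') (v' := F') (fun x _ => hd x) (fun x _ => hF x)
    (hVc.intervalIntegrable _ _) (hF'.intervalIntegrable _ _)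
  have v0 : V 0 = 0 := by simp only [hV]; rw [zero_div, sin_zero, zero_rpow (by linarith)]; ring
  have v1 : V π = 0 := by
    simp only [hV]; rw [cos_pi_div_two, zero_rpow (by linarith : 2 * b + 2 ≠ 0)]; ring
  rw [v0, v1] at key
  have r1 : ∀ x p : ℝ, 0 ≤ x → 0 < p → x ^ (p + 1) = x ^ p * x := fun x p hx hp =>
    rpow_add_one' hx (by linarith)
  have i1 : ∫ θ in (0:ℝ)..π, V θ * F' θ =
      ∫ θ in (0:ℝ)..π, WW a b θ * (sin (θ / 2) * cos (θ / 2) * F' θ) := by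
    refine intervalIntegral.integral_congr fun θ hθ => ?_
    rw [uIcc_of_le pi_pos.le] at hθ
    obtain ⟨h1, h2⟩ := half_nonneg hθ
    simp only [hV, WW]
    rw [show 2 * a + 2 = (2 * a + 1) + 1 by ring, show 2 * b + 2 = (2 * b + 1) + 1 by ring,
      r1 _ _ h1 (by linarith), r1 _ _ h2 (by linarith)]
    ring
  have i2 : ∫ θ in (0:ℝ)..π, V' θ * F θ =
      ∫ θ in (0:ℝ)..π, WW a b θ * (((a + 1) * cos (θ / 2) ^ 2 - (b + 1) * sin (θ / 2) ^ 2) * F θ) := by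
    refine intervalIntegral.integral_congr fun θ hθ => ?_
    rw [uIcc_of_le pi_pos.le] at hθ
    obtain ⟨h1, h2⟩ := half_nonneg hθ
    simp only [hV', WW]
    have hA : sin (θ / 2) ^ (2 * a + 2) = sin (θ / 2) ^ (2 * a + 1) * sin (θ / 2) := by
      rw [← r1 _ _ h1 (by linarith)]; congr 1; ring
    have hB : cos (θ / 2) ^ (2 * b + 2) = cos (θ / 2) ^ (2 * b + 1) * cos (θ / 2) := by
      rw [← r1 _ _ h2 (by linarith)]; congr 1; ring
    have hA' : 2 * a + 2 - 1 = 2 * a + 1 := by ring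
    have hB' : 2 * b + 2 - 1 = 2 * b + 1 := by ring
    rw [hA', hB', hA, hB]
    generalize sin (θ / 2) ^ (2 * a + 1) = X
    generalize cos (θ / 2) ^ (2 * b + 1) = Y
    ring
  rw [i1, i2] at key
  linarith

end

def hN (a b : ℝ) (n : ℕ) : ℝ := ∫ θ in (0 : ℝ)..π, WW a b θ * jacobiP a b n (cos θ) ^ 2

section
variable {a b : ℝ} (ha : 0 < a) (hb : 0 < b)
include ha hb

lemma WW_succ {θ : ℝ} (hθ : θ ∈ Icc 0 π) :
    WW (a + 1) (b + 1) θ = WW a b θ * (sin (θ / 2) ^ 2 * cos (θ / 2) ^ 2) := by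
  obtain ⟨h1, h2⟩ := half_nonneg hθ
  unfold WW
  rw [show 2 * (a + 1) + 1 = (2 * a + 1) + ((2:ℕ):ℝ) by push_cast; ring,
    show 2 * (b + 1) + 1 = (2 * b + 1) + ((2:ℕ):ℝ) by push_cast; ring,
    rpow_add_natCast' h1 (by push_cast; linarith), rpow_add_natCast' h2 (by push_cast; linarith)]
  ring

lemma jP_zero (x : ℝ) : jacobiP a b 0 x = 1 := by
  have := Real.Gamma_pos_of_pos (by positivity : 0 < a + b + 1)
  have := Real.Gamma_pos_of_pos (by positivity : 0 < a + 1)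
  simp [jacobiP]
  field_simp

lemma cont_jP (n : ℕ) : Continuous fun θ => jacobiP a b n (cos θ) := by
  unfold jacobiP; fun_prop

lemma hN_zero_succ : (a + b + 2) * (a + b + 3) * hN (a + 1) (b + 1) 0 = (a + 1) * (b + 1) * hN a b 0 := by
  have cW := cont_WW ha hb
  have h1 := ibpW ha hb (F := fun _ => 1) (F' := fun _ => 0) (fun θ => hasDerivAt_const θ _)
    continuous_const
  have h2 := ibpW ha hb (F := fun θ => cos (θ / 2) ^ 2) (F' := fun θ => -(sin (θ / 2) * cos (θ / 2)))
    (fun θ => ((hasDerivAt_cos_half θ).pow 2).congr_deriv (by ring)) (by fun_prop)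
  have e0 : hN a b 0 = ∫ θ in (0:ℝ)..π, WW a b θ := by
    unfold hN; simp only [jP_zero ha hb]; simp
  have e1 : hN (a + 1) (b + 1) 0 = ∫ θ in (0:ℝ)..π, (WW a b θ * cos (θ / 2) ^ 2 - WW a b θ * cos (θ / 2) ^ 4) := by
    unfold hN
    refine intervalIntegral.integral_congr fun θ hθ => ?_
    rw [uIcc_of_le pi_pos.le] at hθ
    simp only [jP_zero (by linarith : 0 < a + 1) (by linarith : 0 < b + 1)]
    rw [WW_succ ha hb hθ]
    linear_combination (WW a b θ * cos (θ / 2) ^ 2) * sin_sq_add_cos_sq (θ / 2)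
  have i0 : IntervalIntegrable (fun θ => WW a b θ) volume 0 π := cW.intervalIntegrable _ _
  have i1 : IntervalIntegrable (fun θ => WW a b θ * cos (θ / 2) ^ 2) volume 0 π :=
    Continuous.intervalIntegrable (by fun_prop) _ _
  have i2 : IntervalIntegrable (fun θ => WW a b θ * cos (θ / 2) ^ 4) volume 0 π :=
    Continuous.intervalIntegrable (by fun_prop) _ _
  rw [intervalIntegral.integral_sub i1 i2] at e1
  set m0 := ∫ θ in (0:ℝ)..π, WW a b θ
  set m1 := ∫ θ in (0:ℝ)..π, WW a b θ * cos (θ / 2) ^ 2 with hm1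
  set m2 := ∫ θ in (0:ℝ)..π, WW a b θ * cos (θ / 2) ^ 4 with hm2
  have f1 : (a + b + 2) * m1 = (b + 1) * m0 := by
    have : ∀ θ, WW a b θ * (((a + 1) * cos (θ / 2) ^ 2 - (b + 1) * sin (θ / 2) ^ 2) * 1) =
        (a + b + 2) * (WW a b θ * cos (θ / 2) ^ 2) - (b + 1) * WW a b θ := by
      intro θ
      linear_combination (- WW a b θ * (b + 1)) * sin_sq_add_cos_sq (θ / 2)
    simp only [this, mul_zero] at h1
    rw [intervalIntegral.integral_sub (i1.const_mul _) (i0.const_mul _),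
      intervalIntegral.integral_const_mul, intervalIntegral.integral_const_mul] at h1
    simp at h1
    linarith
  have f2 : (a + b + 3) * m2 = (b + 2) * m1 := by
    have g1 : ∀ θ, WW a b θ * (((a + 1) * cos (θ / 2) ^ 2 - (b + 1) * sin (θ / 2) ^ 2) * cos (θ / 2) ^ 2) =
        (a + b + 2) * (WW a b θ * cos (θ / 2) ^ 4) - (b + 1) * (WW a b θ * cos (θ / 2) ^ 2) := by
      intro θ
      linear_combination (- WW a b θ * (b + 1) * cos (θ / 2) ^ 2) * sin_sq_add_cos_sq (θ / 2)
    have g2 : ∀ θ, WW a b θ * (sin (θ / 2) * cos (θ / 2) * -(sin (θ / 2) * cos (θ / 2))) =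
        WW a b θ * cos (θ / 2) ^ 4 - WW a b θ * cos (θ / 2) ^ 2 := by
      intro θ
      linear_combination (- WW a b θ * cos (θ / 2) ^ 2) * sin_sq_add_cos_sq (θ / 2)
    simp only [g1, g2] at h2
    rw [intervalIntegral.integral_sub (i2.const_mul _) (i1.const_mul _),
      intervalIntegral.integral_const_mul, intervalIntegral.integral_const_mul,
      intervalIntegral.integral_sub i2 i1] at h2
    linarith
  rw [e0, e1]
  linear_combination (a + 1) * f1 - (a + b + 2) * f2

lemma JPo_deriv (n : ℕ) : Polynomial.derivative (JPo a b (n + 1)) =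
    Polynomial.C (n + 1 + (a + b + 1)) * JPo (a + 1) (b + 1) n := by
  ext m
  rw [Polynomial.coeff_derivative, Polynomial.coeff_C_mul, JPo_coeff, JPo_coeff]
  by_cases h : m ≤ n
  · rw [if_pos (by omega), if_pos h]
    unfold jc
    rw [show n + 1 - (m + 1) = n - m by omega, Nat.factorial_succ]
    push_cast
    have g1 : Real.Gamma (a + 1 + (b + 1) + n + 1) = (a + b + (n + 1) + 1) * Real.Gamma (a + b + (n + 1) + 1) := by
      rw [← Real.Gamma_add_one (by positivity)]; ring_nf
    rw [g1, show a + 1 + (m:ℝ) + 1 = a + (m + 1) + 1 by ring, show a + 1 + (n:ℝ) + 1 = a + (n + 1) + 1 by ring,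
      show a + 1 + (b + 1) + (n:ℝ) + m + 1 = a + b + (n + 1) + (m + 1) + 1 by ring]
    have := Real.Gamma_pos_of_pos (by positivity : 0 < a + b + (n + 1) + 1)
    have := Real.Gamma_pos_of_pos (by positivity : 0 < a + (m + 1) + 1)
    field_simp
    ring
  · rw [if_neg (by omega), if_neg h]; simp

lemma hN_succ (n : ℕ) : (n + 1) * hN a b (n + 1) = (n + 1 + (a + b + 1)) * hN (a + 1) (b + 1) n := by
  have cW := cont_WW ha hb
  set p := JPo a b (n + 1) with hp
  set u : ℝ → ℝ := fun θ => (cos θ - 1) / 2 with hu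
  set p1 := Polynomial.derivative p with hp1
  set p2 := Polynomial.derivative p1 with hp2
  have hu' : ∀ θ, HasDerivAt u (-sin θ / 2) θ := hasDerivAt_u ha hb
  have huc : Continuous u := by simp only [hu]; fun_prop
  have c0 : Continuous fun θ => p.eval (u θ) := p.continuous.comp huc
  have c1 : Continuous fun θ => p1.eval (u θ) := p1.continuous.comp huc
  have c2 : Continuous fun θ => p2.eval (u θ) := p2.continuous.comp huc
  have h := ibpW ha hb (F := fun θ => p1.eval (u θ) * p.eval (u θ))
    (F' := fun θ => (p2.eval (u θ) * (-sin θ / 2)) * p.eval (u θ) + p1.eval (u θ) * (p1.eval (u θ) * (-sin θ / 2)))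
    (fun θ => ((p1.hasDerivAt (u θ)).comp θ (hu' θ)).mul ((p.hasDerivAt (u θ)).comp θ (hu' θ)))
    (by fun_prop)
  set ν : ℝ := ((n + 1 : ℕ) : ℝ) * ((n + 1 : ℕ) + (a + b + 1)) with hν
  have hode : ∀ θ, u θ * (1 + u θ) * p2.eval (u θ)
     + ((a + 1) + (a + b + 2) * u θ) * p1.eval (u θ) - ν * p.eval (u θ) = 0 := by
    intro θ
    rw [hp1, hp2, hp, ← Dop_eval, Dop_JPo ha hb]; simp
  have es : ∀ θ : ℝ, sin θ = 2 * sin (θ / 2) * cos (θ / 2) := fun θ => by rw [← sin_two_mul]; ring_nf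
  have eu : ∀ θ : ℝ, u θ = cos (θ / 2) ^ 2 - 1 := fun θ => by
    have : cos θ = 2 * cos (θ / 2) ^ 2 - 1 := by rw [← cos_two_mul]; ring_nf
    simp only [hu, this]; ring
  have g1 : ∀ θ, WW a b θ * (((a + 1) * cos (θ / 2) ^ 2 - (b + 1) * sin (θ / 2) ^ 2) *
      (p1.eval (u θ) * p.eval (u θ))) = ν * (WW a b θ * p.eval (u θ) ^ 2) +
        WW a b θ * (sin (θ / 2) ^ 2 * cos (θ / 2) ^ 2 * p2.eval (u θ) * p.eval (u θ)) := by
    intro θ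
    have h1 := hode θ
    have h2 := sin_sq_add_cos_sq (θ / 2)
    rw [show u θ * (1 + u θ) = -(sin (θ / 2) ^ 2 * cos (θ / 2) ^ 2) by
        rw [eu]; linear_combination cos (θ/2)^2 * h2,
      show (a + 1) + (a + b + 2) * u θ = (a + 1) * cos (θ / 2) ^ 2 - (b + 1) * sin (θ / 2) ^ 2 by
        rw [eu]; linear_combination (b + 1) * h2] at h1
    linear_combination (WW a b θ * p.eval (u θ)) * h1
  have g2 : ∀ θ, WW a b θ * (sin (θ / 2) * cos (θ / 2) * ((p2.eval (u θ) * (-sin θ / 2)) * p.eval (u θ) + p1.eval (u θ) * (p1.eval (u θ) * (-sin θ / 2)))) =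
      -(WW a b θ * (sin (θ / 2) ^ 2 * cos (θ / 2) ^ 2 * p2.eval (u θ) * p.eval (u θ))) -
        WW a b θ * (sin (θ / 2) ^ 2 * cos (θ / 2) ^ 2 * p1.eval (u θ) ^ 2) := by
    intro θ; rw [es θ]; ring
  simp only [g1, g2] at h
  rw [intervalIntegral.integral_add, intervalIntegral.integral_sub, intervalIntegral.integral_neg,
    intervalIntegral.integral_const_mul] at h
  rotate_left
  all_goals try exact Continuous.intervalIntegrable (by fun_prop) _ _
  have e0 : hN a b (n + 1) = ∫ θ in (0:ℝ)..π, WW a b θ * p.eval (u θ) ^ 2 := by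
    unfold hN
    simp only [hp, hu, JPo_eval]
  have e1 : (n + 1 + (a + b + 1)) ^ 2 * hN (a + 1) (b + 1) n =
      ∫ θ in (0:ℝ)..π, WW a b θ * (sin (θ / 2) ^ 2 * cos (θ / 2) ^ 2 * p1.eval (u θ) ^ 2) := by
    unfold hN
    rw [← intervalIntegral.integral_const_mul]
    refine intervalIntegral.integral_congr fun θ hθ => ?_
    rw [uIcc_of_le pi_pos.le] at hθ
    beta_reduce
    rw [WW_succ ha hb hθ, hp1, hp, JPo_deriv ha hb, Polynomial.eval_mul, Polynomial.eval_C]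
    simp only [hu, JPo_eval]
    ring
  rw [← e0, ← e1] at h
  have hne : ((n:ℝ) + 1 + (a + b + 1)) ≠ 0 := by positivity
  apply mul_left_cancel₀ hne
  push_cast at hν
  rw [hν] at h
  linarith

lemma hN_zero_pos : 0 < hN a b 0 := by
  unfold hN
  simp only [jP_zero ha hb, one_pow, mul_one]
  refine intervalIntegral.intervalIntegral_pos_of_pos_on ((cont_WW ha hb).intervalIntegrable _ _) ?_ pi_pos
  intro θ hθ
  obtain ⟨hs, hc⟩ := hpos hθ
  unfold WW
  positivity

end

lemma hN_ratio (n : ℕ) : ∀ {a b : ℝ}, 0 < a → 0 < b →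
    hN a b (n + 1) * ((2 * n + 2 + (a + b + 1)) * (n + 1) * (n + (a + b + 1))) =
      (n + a + 1) * (n + b + 1) * (2 * n + (a + b + 1)) * hN a b n := by
  induction n with
  | zero =>
    intro a b ha hb
    have h1 := hN_succ ha hb 0
    have h2 := hN_zero_succ ha hb
    push_cast at h1 ⊢
    linear_combination ((2 + (a + b + 1)) * (a + b + 1)) * h1 + (a + b + 1) * h2
  | succ n ih =>
    intro a b ha hb
    have h1 := hN_succ ha hb (n + 1)
    have h2 := hN_succ ha hb n
    have h3 := ih (by linarith : 0 < a + 1) (by linarith : 0 < b + 1)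
    push_cast at h1 h2 h3 ⊢
    have hne : (n : ℝ) + 1 ≠ 0 := by positivity
    apply mul_left_cancel₀ hne
    linear_combination ((n:ℝ) + 1) * ((2 * (n + 1) + 2 + (a + b + 1)) * (n + 1 + (a + b + 1))) * h1
      + (n + 1 + (a + b + 1)) * h3
      - ((n + 1 + a + 1) * (n + 1 + b + 1) * (2 * (n + 1) + (a + b + 1))) * h2

lemma hN_pos {a b : ℝ} (ha : 0 < a) (hb : 0 < b) (n : ℕ) : 0 < hN a b n := by
  induction n with
  | zero => exact hN_zero_pos ha hb
  | succ n ih =>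
    have h := hN_ratio n ha hb
    have : 0 < hN a b (n + 1) * ((2 * n + 2 + (a + b + 1)) * (n + 1) * (n + (a + b + 1))) := by
      rw [h]; positivity
    exact pos_of_mul_pos_left this (by positivity)

lemma cJ_sq (a b : ℝ) (n : ℕ) : cJ a b n * cJ a b n = (hN a b n)⁻¹ := by
  have h0 : 0 ≤ ∫ θ, jacobiP a b n (cos θ) ^ 2 ∂(jacobiMeasurePlus a b) :=
    integral_nonneg fun _ => sq_nonneg _
  unfold cJ hN
  rw [← integral_jmp, ← sq, ← rpow_mul_natCast h0, ← rpow_neg_one]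
  norm_num

section
variable {a b : ℝ} (ha : 0 < a) (hb : 0 < b)
include ha hb

lemma jc_diag (n : ℕ) : ((n:ℝ) + 1) * (a + b + 1 + n) * jc a b (n + 1) (n + 1) =
    (a + b + 1 + 2 * n) * (a + b + 1 + 2 * n + 1) * jc a b n n := by
  unfold jc
  simp only [Nat.sub_self, Nat.factorial_zero, Nat.factorial_succ]
  push_cast
  have g1 : Real.Gamma (a + b + (n + 1) + (n + 1) + 1) =
      (a + b + n + n + 1 + 1) * ((a + b + n + n + 1) * Real.Gamma (a + b + n + n + 1)) := by
    rw [← Real.Gamma_add_one (by positivity), ← Real.Gamma_add_one (by positivity)]; ring_nf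
  have g2 : Real.Gamma (a + b + (n + 1) + 1) = (a + b + n + 1) * Real.Gamma (a + b + n + 1) := by
    rw [← Real.Gamma_add_one (by positivity)]; ring_nf
  rw [g1, g2]
  have := Real.Gamma_pos_of_pos (by positivity : 0 < a + b + n + 1)
  have := Real.Gamma_pos_of_pos (by positivity : 0 < a + n + 1)
  have := Real.Gamma_pos_of_pos (by positivity : 0 < a + (n + 1) + 1)
  field_simp
  ring

lemma jc_zero (n : ℕ) : ((n:ℝ) + 1) * jc a b (n + 1) 0 = (a + n + 1) * jc a b n 0 := by
  unfold jc
  simp only [Nat.sub_zero, Nat.factorial_zero, Nat.factorial_succ]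
  push_cast
  have g1 : Real.Gamma (a + (n + 1) + 1) = (a + n + 1) * Real.Gamma (a + n + 1) := by
    rw [← Real.Gamma_add_one (by positivity)]; ring_nf
  rw [g1]
  have := Real.Gamma_pos_of_pos (by positivity : 0 < a + b + n + 1)
  have := Real.Gamma_pos_of_pos (by positivity : 0 < a + b + (n + 1) + 1)
  have := Real.Gamma_pos_of_pos (by positivity : 0 < a + 1)
  simp only [add_zero]
  field_simp

/-- the normalisation constant is independent of `n` -/
def Om (a b : ℝ) (n : ℕ) : ℝ := (2 * n + (a + b + 1)) *
  ((CP (a + b + 1) (2 * n)).coeff (2 * n) * (MM a 0 * MM b (2 * n))) / (jc a b n n * jc a b n 0) * hN a b n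

lemma Om_succ (n : ℕ) : Om a b (n + 1) = Om a b n := by
  have h1 := CP_lead (a + b + 1) (2 * n)
  have h2 := CP_lead (a + b + 1) (2 * n + 1)
  have h3 := MM_rec hb (2 * n)
  have h4 := jc_diag ha hb n
  have h5 := jc_zero ha hb n
  have h6 := hN_ratio n ha hb
  have p1 := jc_pos ha hb n n
  have p2 := jc_pos ha hb n 0
  have p3 := jc_pos ha hb (n + 1) (n + 1)
  have p4 := jc_pos ha hb (n + 1) 0
  unfold Om
  rw [show 2 * (n + 1) = 2 * n + 1 + 1 by ring]
  rw [show 2 * n + 1 + 1 = 2 * n + 2 from rfl] at *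
  generalize (CP (a + b + 1) (2 * n)).coeff (2 * n) = L0 at *
  generalize (CP (a + b + 1) (2 * n + 1)).coeff (2 * n + 1) = L1 at *
  generalize (CP (a + b + 1) (2 * n + 2)).coeff (2 * n + 2) = L2 at *
  generalize MM b (2 * n) = M0 at *
  generalize MM b (2 * n + 2) = M2 at *
  generalize MM a 0 = M at *
  generalize jc a b n n = A at *
  generalize jc a b n 0 = B at *
  generalize jc a b (n + 1) (n + 1) = A' at *
  generalize jc a b (n + 1) 0 = B' at *
  generalize hN a b n = H at *
  generalize hN a b (n + 1) = H' at *
  push_cast at *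
  have hn : (0:ℝ) ≤ n := by positivity
  generalize (n : ℝ) = x at *
  have eL1 : L1 = 2 * (2 * x + (a + b + 1)) * L0 / (2 * x + 1) := by
    field_simp; linarith
  have eL2 : L2 = 2 * (2 * x + 1 + (a + b + 1)) * L1 / (2 * x + 1 + 1) := by
    field_simp; linarith
  have eM : M2 = (2 * x + 1) * M0 / (2 * x + 2 * b + 2) := by
    field_simp; linarith
  have eA : A' = (a + b + 1 + 2 * x) * (a + b + 1 + 2 * x + 1) * A / ((x + 1) * (a + b + 1 + x)) := by
    field_simp; linarith
  have eB : B' = (a + x + 1) * B / (x + 1) := by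
    field_simp; linarith
  have eH : H' = (x + a + 1) * (x + b + 1) * (2 * x + (a + b + 1)) * H /
      ((2 * x + 2 + (a + b + 1)) * (x + 1) * (x + (a + b + 1))) := by
    field_simp; linarith
  rw [eL2, eL1, eM, eA, eB, eH]
  have q1 : 0 < x + a + 1 := by linarith
  have q2 : 0 < x + b + 1 := by linarith
  have q3 : 0 < a + x + 1 := by linarith
  have q4 : 0 < 2 * x + 2 * b + 2 := by linarith
  have q5 : 0 < a + b + 1 + 2 * x := by linarith
  have q6 : 0 < a + b + 1 + 2 * x + 1 := by linarith
  have q7 : 0 < a + b + 1 + x := by linarith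
  have q8 : 0 < x + (a + b + 1) := by linarith
  have q9 : 0 < 2 * x + 2 + (a + b + 1) := by linarith
  field_simp
  ring

lemma Om_const (n : ℕ) : Om a b n = Om a b 0 := by
  induction n with
  | zero => rfl
  | succ n ih => rw [Om_succ ha hb, ih]

lemma FF_cc_final (n : ℕ) {θ φ : ℝ} (hθ : θ ∈ Ioo 0 π) (hφ : φ ∈ Ioo 0 π) :
    (2 * n + (a + b + 1)) * FF (nu a b) (cc (a + b + 1) (2 * n)) θ φ = Om a b 0 *
      (trigP a b n θ * trigP a b n φ) := by
  have h1 := FF_cc_prod ha hb n hθ hφ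
  have h2 := FF_cc_lead ha hb n
  have h3 := cJ_sq a b n
  have hp := hN_pos ha hb n
  have p1 := jc_pos ha hb n n
  have p2 := jc_pos ha hb n 0
  rw [← Om_const ha hb n]
  have e : trigP a b n θ * trigP a b n φ = (hN a b n)⁻¹ * (jacobiP a b n (cos θ) * jacobiP a b n (cos φ)) := by
    unfold trigP; rw [← h3]; ring
  rw [e]
  unfold Om
  have e2 : FF (nu a b) (cc (a + b + 1) (2 * n)) 0 0 = jc a b n 0 * ((CP (a + b + 1) (2 * n)).coeff (2 * n) * (MM a 0 * MM b (2 * n))) / jc a b n n := by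
    field_simp; linarith
  rw [e2] at h1
  have e3 : FF (nu a b) (cc (a + b + 1) (2 * n)) θ φ = jc a b n 0 * ((CP (a + b + 1) (2 * n)).coeff (2 * n) * (MM a 0 * MM b (2 * n))) / jc a b n n * (jacobiP a b n (cos θ) * jacobiP a b n (cos φ)) / jc a b n 0 ^ 2 := by
    rw [eq_div_iff (by positivity)]; linarith
  rw [e3]
  field_simp

lemma Om_pos : 0 < Om a b 0 := by
  unfold Om
  have := jc_pos ha hb 0 0
  have := hN_pos ha hb 0
  have := MM_zero_pos ha
  have := MM_even_pos hb 0
  have := CP_lead_pos (by positivity : 0 < a + b + 1) (2 * 0)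
  positivity
end
end JR

namespace JR
open scoped Topology

lemma FF_kk_hasSum {a b : ℝ} (ha : 0 < a) (hb : 0 < b) {θ φ t : ℝ} (hθ : θ ∈ Ioo 0 π)
    (hφ : φ ∈ Ioo 0 π) (h : θ ≠ φ) (ht : 0 < t) {lam : ℝ} (hl : 0 < lam) :
    HasSum (fun n : ℕ => 2 ^ lam * exp (-(t / 2) * (n + lam)) * (((n : ℝ) + lam) / lam) *
      FF (nu a b) (cc lam n) θ φ) (FF (nu a b) (kk lam t) θ φ) := by
  have := isFinite_nu ha hb
  have hζ := cos_half_lt hθ hφ h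
  have hζ0 : 0 ≤ cos ((θ - φ) / 2) := (abs_nonneg _).trans (abs_zz_le (0, 0) hθ hφ)
  obtain ⟨M, K, hM, hb'⟩ := cc_bound lam hζ0 hζ
  set r := exp (-(t / 2)) with hr
  have hr0 : 0 < r := exp_pos _
  have hr1 : r < 1 := by rw [hr, exp_lt_one_iff]; linarith
  have hs := (summable_pow_geom (K + 1) hr0.le hr1).mul_left
    (2 ^ lam * exp (-(t / 2) * lam) * (1 / lam + 1) * M)
  have key := hasSum_integral_of_dominated_convergence (μ := nu a b)
    (F := fun (n : ℕ) p => 2 ^ lam * exp (-(t / 2) * (n + lam)) * (((n : ℝ) + lam) / lam) *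
      cc lam n (zz p θ φ)) (f := fun p => kk lam t (zz p θ φ))
    (fun n _ => 2 ^ lam * exp (-(t / 2) * lam) * (1 / lam + 1) * M * (((n:ℝ) + 2) ^ (K + 1) * r ^ n))
    ?_ ?_ ?_ ?_ ?_
  · unfold FF
    simp only [integral_const_mul] at key
    exact key
  · intro n
    have hc : Continuous (cc lam n) :=
      continuous_iff_continuousAt.2 fun z => (hasDerivAt_cc lam n z).continuousAt
    exact (continuous_const.mul (hc.comp (continuous_zz θ φ))).aestronglyMeasurable
  · intro n
    refine Filter.Eventually.of_forall fun p => ?_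
    have e1 := hb' n _ (abs_zz_le p hθ hφ)
    have e2 : exp (-(t / 2) * (n + lam)) = exp (-(t / 2) * lam) * r ^ n := by
      rw [hr, ← exp_nat_mul, ← exp_add]; congr 1; ring
    have e3 : ((n : ℝ) + lam) / lam ≤ (1 / lam + 1) * (n + 2) := by
      rw [div_le_iff₀ hl]
      have : (1 / lam + 1) * (n + 2) * lam = (1 + lam) * (n + 2) := by field_simp
      rw [this]
      nlinarith [(n.cast_nonneg : (0:ℝ) ≤ n)]
    have h2 : (0:ℝ) < 2 ^ lam := by positivity
    rw [norm_mul, Real.norm_of_nonneg (by positivity), Real.norm_eq_abs, e2]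
    calc 2 ^ lam * (exp (-(t / 2) * lam) * r ^ n) * (((n : ℝ) + lam) / lam) * |cc lam n (zz p θ φ)|
        ≤ 2 ^ lam * (exp (-(t / 2) * lam) * r ^ n) * ((1 / lam + 1) * (n + 2)) *
          (M * ((n : ℝ) + 2) ^ K) := by gcongr
      _ = _ := by ring
  · exact Filter.Eventually.of_forall fun p => hs
  · exact integrable_const _
  · exact Filter.Eventually.of_forall fun p =>
      kk_hasSum hl (lt_of_le_of_lt (abs_zz_le p hθ hφ) hζ) ht

lemma sqrt_jLam {α β : ℝ} (hα : -1 < α) (hβ : -1 < β) (n : ℕ) :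
    Real.sqrt (jLam α β (n + 1)) = n + (α + β + 3) / 2 := by
  unfold jLam
  rw [Real.sqrt_sq (by push_cast; nlinarith [(n.cast_nonneg : (0:ℝ) ≤ n)])]
  push_cast; ring

/-- constant in the kernel representation -/
def C0 (α β : ℝ) : ℝ := 1 / 8 * ((α + β + 3) / (2 ^ (α + β + 3) * Om (α + 1) (β + 1) 0))

lemma jHtil_eq {α β : ℝ} (hα : -1 < α) (hβ : -1 < β) {θ φ t : ℝ} (hθ : θ ∈ Ioo 0 π)
    (hφ : φ ∈ Ioo 0 π) (h : θ ≠ φ) (ht : 0 < t) :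
    jHtil α β t θ φ = C0 α β * sin φ * (sin θ *
      FF (nu (α + 1) (β + 1)) (kk (α + β + 3) t) θ φ) := by
  have ha : 0 < α + 1 := by linarith
  have hb : 0 < β + 1 := by linarith
  have hl : 0 < α + β + 3 := by linarith
  have key := FF_kk_hasSum ha hb hθ hφ h ht hl
  have k2 := (Function.Injective.hasSum_iff (g := fun n : ℕ => 2 * n)
    (fun x y hxy => by simpa using hxy) (fun n hn => by
      have : Odd n := by
        rw [← Nat.not_even_iff_odd]
        rintro ⟨k, hk⟩
        exact hn ⟨k, by simp; omega⟩
      rw [FF_cc_odd ha hb _ this]; ring)).2 key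
  have hO := Om_pos ha hb
  have h2 : (0:ℝ) < 2 ^ (α + β + 3) := by positivity
  have k3 := k2.mul_left ((α + β + 3) / (2 ^ (α + β + 3) * Om (α + 1) (β + 1) 0))
  have k4 : HasSum (fun n : ℕ => Real.exp (-t * Real.sqrt (jLam α β (n + 1))) *
      trigP (α + 1) (β + 1) n θ * trigP (α + 1) (β + 1) n φ)
      ((α + β + 3) / (2 ^ (α + β + 3) * Om (α + 1) (β + 1) 0) *
        FF (nu (α + 1) (β + 1)) (kk (α + β + 3) t) θ φ) := by
    refine k3.congr_fun fun n => ?_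
    have f1 := FF_cc_final ha hb n hθ hφ
    have el : α + 1 + (β + 1) + 1 = α + β + 3 := by ring
    rw [el] at f1
    rw [sqrt_jLam hα hβ]
    simp only [Function.comp]
    have e2 : -(t / 2) * (((2 * n : ℕ) : ℝ) + (α + β + 3)) = -t * (n + (α + β + 3) / 2) := by
      push_cast; ring
    rw [e2]
    push_cast
    generalize exp _ = E
    have : trigP (α + 1) (β + 1) n θ * trigP (α + 1) (β + 1) n φ =
      (2 * n + (α + β + 3)) * FF (nu (α + 1) (β + 1)) (cc (α + β + 3) (2 * n)) θ φ /
        Om (α + 1) (β + 1) 0 := by rw [f1]; field_simp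
    rw [mul_assoc, this]
    field_simp
  unfold jHtil
  rw [k4.tsum_eq]
  unfold C0
  ring

end JR

namespace JR
open scoped Topology

/-- The class of families of kernels generated by `k_t` under the operations we need. -/
inductive SS (lam : ℝ) (lo hi : ℕ) : (ℝ → ℝ → ℝ) → Prop
  | base (i j : ℕ) (h1 : lo ≤ i) (h2 : i ≤ hi) : SS lam lo hi (fun t z =>
      sinh (t / 2) * (1 - z) ^ j * (cosh (t / 2) - z) ^ (-(lam + 1 + (i : ℝ) + (j : ℝ))))
  | add {f g : ℝ → ℝ → ℝ} (hf : SS lam lo hi f) (hg : SS lam lo hi g) :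
      SS lam lo hi (fun t z => f t z + g t z)
  | smul (c : ℝ) {f : ℝ → ℝ → ℝ} (hf : SS lam lo hi f) : SS lam lo hi (fun t z => c * f t z)

lemma Ypos (t : ℝ) {z : ℝ} (hz : z < 1) : 0 < cosh (t / 2) - z := by
  have := one_le_cosh (t / 2); linarith

lemma SS.mono {lam : ℝ} {lo hi lo' hi' : ℕ} {g : ℝ → ℝ → ℝ} (h : SS lam lo hi g)
    (h1 : lo' ≤ lo) (h2 : hi ≤ hi') : SS lam lo' hi' g := by
  induction h with
  | base i j ha hb => exact SS.base i j (h1.trans ha) (hb.trans h2)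
  | add _ _ a b => exact a.add b
  | smul c _ a => exact a.smul c

lemma SS.mulq {lam : ℝ} {lo hi : ℕ} {g : ℝ → ℝ → ℝ} (h : SS lam (lo + 1) (hi + 1) g) :
    SS lam lo hi (fun t z => (1 - z) * g t z) := by
  induction h with
  | base i j ha hb =>
    obtain ⟨i, rfl⟩ : ∃ k, i = k + 1 := ⟨i - 1, by omega⟩
    convert SS.base (lam := lam) (lo := lo) (hi := hi) i (j + 1) (by omega) (by omega) using 3
    rw [show -(lam + 1 + ((i + 1 : ℕ) : ℝ) + (j : ℝ)) = -(lam + 1 + (i : ℝ) + ((j + 1 : ℕ) : ℝ)) by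
      push_cast; ring]
    ring
  | add _ _ a b => simpa only [mul_add] using a.add b
  | @smul c f _ a =>
    have := a.smul c
    convert this using 3
    ring

lemma SS.cont {lam : ℝ} {lo hi : ℕ} {g : ℝ → ℝ → ℝ} (h : SS lam lo hi g) :
    ContinuousOn (fun p : ℝ × ℝ => g p.1 p.2) {p | p.2 < 1} := by
  induction h with
  | base i j ha hb =>
    refine ContinuousOn.mul (by fun_prop) (ContinuousOn.rpow_const (by fun_prop) ?_)
    intro p hp
    exact Or.inl (Ypos p.1 hp).ne'
  | add _ _ a b => exact a.add b
  | smul c _ a => exact continuousOn_const.mul a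

lemma SS.deriv {lam : ℝ} {lo hi : ℕ} {g : ℝ → ℝ → ℝ} (h : SS lam lo hi g) :
    ∃ g1, SS lam (lo + 1) (hi + 1) g1 ∧ ∀ t, ∀ z < 1, HasDerivAt (g t) (g1 t z) z := by
  induction h with
  | base i j ha hb =>
    have hY : ∀ t, ∀ z < 1, ∀ q : ℝ, HasDerivAt (fun z => (cosh (t / 2) - z) ^ q)
        (-q * (cosh (t / 2) - z) ^ (q - 1)) z := by
      intro t z hz q
      have := ((hasDerivAt_id' z).const_sub (cosh (t / 2))).rpow_const (p := q)
        (Or.inl (Ypos t hz).ne')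
      exact this.congr_deriv (by ring)
    rcases j with _ | j
    · refine ⟨_, (SS.base (lam := lam) (lo := lo + 1) (hi := hi + 1) (i + 1) 0 (by omega)
        (by omega)).smul (lam + 1 + i), fun t z hz => ?_⟩
      have := (hY t z hz (-(lam + 1 + (i : ℝ) + ((0 : ℕ) : ℝ)))).const_mul (sinh (t / 2) * (1:ℝ))
      simp only [pow_zero]
      refine this.congr_deriv ?_
      rw [show -(lam + 1 + (i : ℝ) + ((0 : ℕ) : ℝ)) - 1 = -(lam + 1 + ((i + 1 : ℕ) : ℝ) + ((0 : ℕ) : ℝ)) by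
        push_cast; ring]
      push_cast
      ring
    · refine ⟨_, ((SS.base (lam := lam) (lo := lo + 1) (hi := hi + 1) (i + 1) (j + 1) (by omega)
        (by omega)).smul (lam + 1 + i + (j + 1))).add
        ((SS.base (lam := lam) (lo := lo + 1) (hi := hi + 1) (i + 1) j (by omega)
        (by omega)).smul (-(j + 1))), fun t z hz => ?_⟩
      have h1 : HasDerivAt (fun z : ℝ => sinh (t / 2) * (1 - z) ^ (j + 1))
          (sinh (t / 2) * (-((j + 1) * (1 - z) ^ j))) z := by
        have := (((hasDerivAt_id' z).const_sub 1).pow (j + 1)).const_mul (sinh (t / 2))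
        exact this.congr_deriv (by push_cast; simp)
      have := h1.mul (hY t z hz (-(lam + 1 + (i : ℝ) + ((j + 1 : ℕ) : ℝ))))
      refine this.congr_deriv ?_
      rw [show -(lam + 1 + (i : ℝ) + ((j + 1 : ℕ) : ℝ)) - 1 =
          -(lam + 1 + ((i + 1 : ℕ) : ℝ) + ((j + 1 : ℕ) : ℝ)) by push_cast; ring,
        show -(lam + 1 + (i : ℝ) + ((j + 1 : ℕ) : ℝ)) =
          -(lam + 1 + ((i + 1 : ℕ) : ℝ) + (j : ℝ)) by push_cast; ring]
      push_cast
      ring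
  | add _ _ a b =>
    obtain ⟨f1, hf, hf'⟩ := a
    obtain ⟨g1, hg, hg'⟩ := b
    exact ⟨_, hf.add hg, fun t z hz => (hf' t z hz).add (hg' t z hz)⟩
  | smul c _ a =>
    obtain ⟨f1, hf, hf'⟩ := a
    exact ⟨_, hf.smul c, fun t z hz => (hf' t z hz).const_mul c⟩

lemma SS.aop {lam : ℝ} {lo hi : ℕ} {g g1 g2 : ℝ → ℝ → ℝ} (h : SS lam lo hi g)
    (h1 : SS lam (lo + 1) (hi + 1) g1) (h2 : SS lam (lo + 2) (hi + 2) g2) (κ : ℝ) :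
    SS lam lo (hi + 1) (fun t z => Aop lam (g1 t) (g2 t) z + κ * g t z) := by
  have m1 := h1.mulq
  have m2 := h2.mulq
  have m3 := m2.mulq
  have := ((((m2.mono (lo' := lo) (hi' := hi + 1) (by omega) le_rfl).smul (-(1/2))).add
    ((m3.mono (lo' := lo) (hi' := hi + 1) le_rfl (by omega)).smul (1/4))).add
    (((h1.mono (lo' := lo) (hi' := hi + 1) (by omega) le_rfl).smul ((2 * lam + 1) / 4)).add
    ((m1.mono (lo' := lo) (hi' := hi + 1) le_rfl (by omega)).smul (-((2 * lam + 1) / 4))))).add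
    ((h.mono (lo' := lo) (hi' := hi + 1) le_rfl (by omega)).smul κ)
  convert this using 3
  unfold Aop
  ring

/-- dominating function -/
def SB (lam : ℝ) (lo hi : ℕ) (t z : ℝ) : ℝ :=
  sinh (t / 2) * (cosh (t / 2) - z) ^ (-(lam + 1 + (lo : ℝ))) +
  sinh (t / 2) * (cosh (t / 2) - z) ^ (-(lam + 1 + (hi : ℝ)))

lemma SB_nonneg (lam : ℝ) (lo hi : ℕ) {t z : ℝ} (ht : 0 < t) (hz : z < 1) :
    0 ≤ SB lam lo hi t z := by
  have h0 : 0 ≤ sinh (t / 2) := sinh_nonneg_iff.2 (by linarith)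
  have := rpow_nonneg (Ypos t hz).le (-(lam + 1 + (lo : ℝ)))
  have := rpow_nonneg (Ypos t hz).le (-(lam + 1 + (hi : ℝ)))
  unfold SB; positivity

lemma SB_mono {lam : ℝ} (hl : 0 < lam) (lo hi : ℕ) {t z ζ : ℝ} (ht : 0 < t) (hz : z ≤ ζ)
    (hζ : ζ < 1) : SB lam lo hi t z ≤ SB lam lo hi t ζ := by
  have h0 : 0 ≤ sinh (t / 2) := sinh_nonneg_iff.2 (by linarith)
  have hY := Ypos t hζ
  unfold SB
  refine add_le_add (mul_le_mul_of_nonneg_left ?_ h0) (mul_le_mul_of_nonneg_left ?_ h0)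
  · exact rpow_le_rpow_of_nonpos hY (by linarith) (by linarith [(lo.cast_nonneg : (0:ℝ) ≤ lo)])
  · exact rpow_le_rpow_of_nonpos hY (by linarith) (by linarith [(hi.cast_nonneg : (0:ℝ) ≤ hi)])

lemma SS.bound {lam : ℝ} {lo hi : ℕ} {g : ℝ → ℝ → ℝ} (h : SS lam lo hi g) :
    ∃ C, 0 ≤ C ∧ ∀ t > 0, ∀ z < 1, |g t z| ≤ C * SB lam lo hi t z := by
  induction h with
  | base i j ha hb =>
    refine ⟨1, zero_le_one, fun t ht z hz => ?_⟩
    have h0 : 0 ≤ sinh (t / 2) := sinh_nonneg_iff.2 (by linarith)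
    have hY := Ypos t hz
    set Y := cosh (t / 2) - z with hYd
    have h1 : 0 ≤ 1 - z := by linarith
    have h2 : 1 - z ≤ Y := by have := one_le_cosh (t / 2); linarith
    have e1 : (1 - z) ^ j * Y ^ (-(lam + 1 + (i : ℝ) + (j : ℝ))) ≤ Y ^ (-(lam + 1 + (i : ℝ))) := by
      have : Y ^ (-(lam + 1 + (i : ℝ))) = Y ^ j * Y ^ (-(lam + 1 + (i : ℝ) + (j : ℝ))) := by
        rw [← rpow_natCast, ← rpow_add hY]; congr 1; ring
      rw [this]
      have := rpow_nonneg hY.le (-(lam + 1 + (i : ℝ) + (j : ℝ)))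
      gcongr
    have e2 : Y ^ (-(lam + 1 + (i : ℝ))) ≤ Y ^ (-(lam + 1 + (lo : ℝ))) + Y ^ (-(lam + 1 + (hi : ℝ))) := by
      have c1 : (lo : ℝ) ≤ i := by exact_mod_cast ha
      have c2 : (i : ℝ) ≤ hi := by exact_mod_cast hb
      have n1 := rpow_nonneg hY.le (-(lam + 1 + (lo : ℝ)))
      have n2 := rpow_nonneg hY.le (-(lam + 1 + (hi : ℝ)))
      rcases le_total 1 Y with hc | hc
      · have := rpow_le_rpow_of_exponent_le hc (by linarith : -(lam + 1 + (i : ℝ)) ≤ -(lam + 1 + (lo : ℝ)))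
        linarith
      · have := rpow_le_rpow_of_exponent_ge hY hc (by linarith : -(lam + 1 + (hi : ℝ)) ≤ -(lam + 1 + (i : ℝ)))
        linarith
    have n3 := rpow_nonneg hY.le (-(lam + 1 + (i : ℝ) + (j : ℝ)))
    rw [abs_of_nonneg (by positivity), SB, ← mul_add, one_mul]
    beta_reduce
    rw [mul_assoc]
    exact mul_le_mul_of_nonneg_left (e1.trans e2) h0
  | add _ _ a b =>
    obtain ⟨C1, h1, h1'⟩ := a
    obtain ⟨C2, h2, h2'⟩ := b
    refine ⟨C1 + C2, by positivity, fun t ht z hz => ?_⟩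
    have := h1' t ht z hz
    have := h2' t ht z hz
    have := abs_add_le (_ : ℝ) (_ : ℝ) |>.trans (add_le_add (h1' t ht z hz) (h2' t ht z hz))
    linarith
  | smul c _ a =>
    obtain ⟨C1, h1, h1'⟩ := a
    refine ⟨|c| * C1, by positivity, fun t ht z hz => ?_⟩
    rw [abs_mul, mul_assoc]
    exact mul_le_mul_of_nonneg_left (h1' t ht z hz) (abs_nonneg c)

end JR

namespace JR
open scoped Topology

lemma sinh_int {z q : ℝ} (hz : z < 1) (hq : 1 < q) :
    IntegrableOn (fun t => sinh (t / 2) * (cosh (t / 2) - z) ^ (-q)) (Ioi 0) ∧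
    ∫ t in Ioi (0:ℝ), sinh (t / 2) * (cosh (t / 2) - z) ^ (-q) = 2 / (q - 1) * (1 - z) ^ (1 - q) := by
  have hd : ∀ t : ℝ, HasDerivAt (fun t => -(2 / (q - 1)) * (cosh (t / 2) - z) ^ (1 - q))
      (sinh (t / 2) * (cosh (t / 2) - z) ^ (-q)) t := by
    intro t
    have h1 : HasDerivAt (fun t => cosh (t / 2) - z) (sinh (t / 2) / 2) t := by
      have := (((hasDerivAt_id' t).div_const 2).cosh).sub_const z
      exact this.congr_deriv (by ring)
    have := (h1.rpow_const (p := 1 - q) (Or.inl (Ypos t hz).ne')).const_mul (-(2 / (q - 1)))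
    refine this.congr_deriv ?_
    rw [show 1 - q - 1 = -q by ring]
    have : q - 1 ≠ 0 := by linarith
    field_simp
    ring
  have hn : ∀ t ∈ Ioi (0:ℝ), 0 ≤ sinh (t / 2) * (cosh (t / 2) - z) ^ (-q) := by
    intro t ht
    have h0 : 0 ≤ sinh (t / 2) := sinh_nonneg_iff.2 (by have := mem_Ioi.1 ht; linarith)
    exact mul_nonneg h0 (rpow_nonneg (Ypos t hz).le _)
  have hl : Filter.Tendsto (fun t => -(2 / (q - 1)) * (cosh (t / 2) - z) ^ (1 - q)) Filter.atTop
      (𝓝 (-(2 / (q - 1)) * 0)) := by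
    refine Filter.Tendsto.const_mul _ ?_
    have h1 : Filter.Tendsto (fun t => cosh (t / 2) - z) Filter.atTop Filter.atTop := by
      refine Filter.tendsto_atTop_mono (f := fun t => t / 2 - z) (fun t => ?_) ?_
      · have h2 := (sinh_lt_cosh (t / 2)).le
        rcases le_total 0 (t / 2) with h | h
        · linarith [self_le_sinh_iff.2 h]
        · linarith [one_le_cosh (t / 2)]
      · exact Filter.tendsto_atTop_add_const_right _ _ (Filter.tendsto_id.atTop_div_const (by norm_num))
    have h2 := (tendsto_rpow_neg_atTop (show 0 < q - 1 by linarith)).comp h1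
    refine h2.congr fun t => ?_
    simp only [Function.comp]
    congr 1; ring
  have hc : ContinuousWithinAt (fun t => -(2 / (q - 1)) * (cosh (t / 2) - z) ^ (1 - q)) (Ici 0) 0 :=
    (hd 0).continuousAt.continuousWithinAt
  refine ⟨integrableOn_Ioi_deriv_of_nonneg hc (fun t _ => hd t) hn hl, ?_⟩
  rw [integral_Ioi_of_hasDerivAt_of_nonneg hc (fun t _ => hd t) hn hl]
  simp

lemma tpow_le (m : ℕ) {e : ℝ} (he : 0 ≤ e) (hem : 2 * e ≤ m) :
    ∃ C, 0 < C ∧ ∀ t > 0, ∀ z < 1, t ^ m ≤ C * ((cosh (t / 2) - z) ^ e + (cosh (t / 2) - z) ^ (e + 1 / 2)) := by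
  refine ⟨4 ^ (2 * e) + 6 * 4 ^ m * m.factorial * 8 ^ e, by positivity, fun t ht z hz => ?_⟩
  have hY := Ypos t hz
  set Y := cosh (t / 2) - z with hYd
  have hx : 0 < t / 4 := by linarith
  have hs : t / 4 ≤ sinh (t / 4) := self_le_sinh_iff.2 hx.le
  have hs0 : 0 < sinh (t / 4) := by linarith
  have hYs : 2 * sinh (t / 4) ^ 2 ≤ Y := by
    have h1 : cosh (t / 2) = cosh (t / 4) ^ 2 + sinh (t / 4) ^ 2 := by
      rw [← cosh_two_mul]; congr 1; ring
    have h2 := cosh_sq (t / 4)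
    rw [hYd, h1, h2]; linarith
  have n1 := rpow_pos_of_pos hY e
  have n2 := rpow_pos_of_pos hY (e + 1 / 2)
  have c1 : (0:ℝ) < 4 ^ (2 * e) := by positivity
  have c2 : (0:ℝ) < 6 * 4 ^ m * m.factorial * 8 ^ e := by positivity
  rcases le_total t 1 with h | h
  · have e1 : t ^ m ≤ t ^ (2 * e) := by
      rw [← rpow_natCast]
      exact rpow_le_rpow_of_exponent_ge ht h hem
    have e2 : t ^ (2 * e) ≤ 4 ^ (2 * e) * Y ^ e := by
      calc t ^ (2 * e) ≤ (4 * sinh (t / 4)) ^ (2 * e) := by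
            apply rpow_le_rpow ht.le (by linarith) (by linarith)
        _ = 4 ^ (2 * e) * (sinh (t / 4) ^ 2) ^ e := by
            rw [mul_rpow (by norm_num) hs0.le, rpow_mul hs0.le]; norm_num
        _ ≤ _ := by
            gcongr
            nlinarith
    nlinarith [mul_pos c1 n2, mul_pos c2 n1, mul_pos c2 n2]
  · have e1 : t ^ m ≤ 6 * 4 ^ m * m.factorial * sinh (t / 4) := by
      have h1 := pow_div_factorial_le_exp (t / 4) hx.le m
      have h2 : exp (t / 4) ≤ 6 * sinh (t / 4) := by
        have : exp (-(t / 4)) ≤ 1 := exp_le_one_iff.2 (by linarith)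
        have h3 := sinh_eq (t / 4)
        linarith
      have hf : (0:ℝ) < m.factorial := by positivity
      rw [div_le_iff₀ hf] at h1
      calc t ^ m = 4 ^ m * (t / 4) ^ m := by rw [← mul_pow]; congr 1; ring
        _ ≤ 4 ^ m * (6 * sinh (t / 4) * m.factorial) := by
          gcongr
          exact h1.trans (by gcongr)
        _ = _ := by ring
    have e2 : sinh (t / 4) ≤ 8 ^ e * Y ^ (e + 1 / 2) := by
      have h1 : sinh (t / 4) ≤ Y ^ (1 / 2 : ℝ) := by
        rw [← sqrt_eq_rpow]
        apply le_sqrt_of_sq_le; nlinarith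
      have h2 : 1 ≤ (8 * Y) ^ e := one_le_rpow (by nlinarith) he
      rw [mul_rpow (by norm_num) hY.le] at h2
      rw [rpow_add hY, ← mul_assoc]
      have := rpow_pos_of_pos hY (1/2)
      nlinarith
    calc t ^ m ≤ 6 * 4 ^ m * m.factorial * (8 ^ e * Y ^ (e + 1 / 2)) := e1.trans (by gcongr)
      _ = (6 * 4 ^ m * m.factorial * 8 ^ e) * Y ^ (e + 1 / 2) := by ring
      _ ≤ _ := by nlinarith [mul_pos c1 n2, mul_pos c2 n1, mul_pos c1 n1]

lemma one_sub_rpow_le {s s' z : ℝ} (h : s ≤ s') (hz : -1 ≤ z) (hz1 : z < 1) :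
    (1 - z) ^ (-s) ≤ 2 ^ (s' - s) * (1 - z) ^ (-s') := by
  have h0 : 0 < 1 - z := by linarith
  have : (1 - z) ^ (-s) = (1 - z) ^ (s' - s) * (1 - z) ^ (-s') := by
    rw [← rpow_add h0]; congr 1; ring
  rw [this]
  have := rpow_nonneg h0.le (-s')
  gcongr
  · linarith

lemma L_int (m : ℕ) {p e : ℝ} (he : 0 ≤ e) (hem : 2 * e ≤ m) (hp : 3 / 2 < p - e) :
    ∃ C, 0 < C ∧ ∀ z < 1,
      IntegrableOn (fun t => t ^ m * (sinh (t / 2) * (cosh (t / 2) - z) ^ (-p))) (Ioi 0) ∧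
      (-1 ≤ z → ∫ t in Ioi (0:ℝ), t ^ m * (sinh (t / 2) * (cosh (t / 2) - z) ^ (-p)) ≤
        C * (1 - z) ^ (-(p - 1 - e))) := by
  obtain ⟨C, hC, hb⟩ := tpow_le m he hem
  have q1 : 0 < p - e - 1 := by linarith
  have q2 : 0 < p - e - 1 / 2 - 1 := by linarith
  refine ⟨C * (2 / (p - e - 1) + 2 / (p - e - 1 / 2 - 1) * 2 ^ (1 / 2 : ℝ)), by positivity, fun z hz => ?_⟩
  obtain ⟨i1, v1⟩ := sinh_int hz (by linarith : 1 < p - e)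
  obtain ⟨i2, v2⟩ := sinh_int hz (by linarith : 1 < p - e - 1 / 2)
  have hi := (i1.add i2).const_mul C
  have hle : ∀ t ∈ Ioi (0:ℝ), t ^ m * (sinh (t / 2) * (cosh (t / 2) - z) ^ (-p)) ≤
      C * (sinh (t / 2) * (cosh (t / 2) - z) ^ (-(p - e)) +
        sinh (t / 2) * (cosh (t / 2) - z) ^ (-(p - e - 1 / 2))) := by
    intro t ht
    have h0 : 0 ≤ sinh (t / 2) := sinh_nonneg_iff.2 (by have := mem_Ioi.1 ht; linarith)
    have hY := Ypos t hz
    have h1 := hb t ht z hz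
    have e1 : (cosh (t / 2) - z) ^ (-(p - e)) = (cosh (t / 2) - z) ^ e * (cosh (t / 2) - z) ^ (-p) := by
      rw [← rpow_add hY]; congr 1; ring
    have e2 : (cosh (t / 2) - z) ^ (-(p - e - 1 / 2)) =
        (cosh (t / 2) - z) ^ (e + 1 / 2) * (cosh (t / 2) - z) ^ (-p) := by
      rw [← rpow_add hY]; congr 1; ring
    rw [e1, e2]
    have := mul_le_mul_of_nonneg_right h1 (mul_nonneg h0 (rpow_nonneg hY.le (-p)))
    linarith
  have hn : ∀ t ∈ Ioi (0:ℝ), 0 ≤ t ^ m * (sinh (t / 2) * (cosh (t / 2) - z) ^ (-p)) := by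
    intro t ht
    have h0 : 0 ≤ sinh (t / 2) := sinh_nonneg_iff.2 (by have := mem_Ioi.1 ht; linarith)
    have ht := mem_Ioi.1 ht
    have := rpow_nonneg (Ypos t hz).le (-p)
    positivity
  have hintg : IntegrableOn (fun t => t ^ m * (sinh (t / 2) * (cosh (t / 2) - z) ^ (-p))) (Ioi 0) := by
    refine Integrable.mono' hi ?_ ?_
    · refine Continuous.aestronglyMeasurable ?_
      refine Continuous.mul (by fun_prop) (Continuous.mul (by fun_prop) ?_)
      exact Continuous.rpow_const (by fun_prop) fun t => Or.inl (Ypos t hz).ne'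
    · refine (ae_restrict_iff' measurableSet_Ioi).2 (Filter.Eventually.of_forall fun t ht => ?_)
      rw [Real.norm_of_nonneg (hn t ht)]
      exact hle t ht
  refine ⟨hintg, fun hz1 => ?_⟩
  have := setIntegral_mono_on hintg hi measurableSet_Ioi hle
  refine this.trans ?_
  simp only [Pi.add_apply]
  rw [integral_const_mul, integral_add i1 i2, v1, v2]
  have e1 : 1 - (p - e) = -(p - 1 - e) := by ring
  have e2 : 1 - (p - e - 1 / 2) = -(p - 3/2 - e) := by ring
  rw [e1, e2]
  have h3 := one_sub_rpow_le (by linarith : p - 3/2 - e ≤ p - 1 - e) hz1 hz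
  rw [show p - 1 - e - (p - 3 / 2 - e) = 1 / 2 by ring] at h3
  rw [mul_assoc]
  refine mul_le_mul_of_nonneg_left ?_ hC.le
  have := mul_le_mul_of_nonneg_left h3 (by positivity : 0 ≤ 2 / (p - e - 1 / 2 - 1))
  linarith

end JR

namespace JR
open scoped Topology

/-- `ρ(z) = ∫₀^∞ t^m g(t,z) dt`. -/
def rho (m : ℕ) (g : ℝ → ℝ → ℝ) (z : ℝ) : ℝ := ∫ t in Ioi (0:ℝ), t ^ m * g t z

section
variable {lam : ℝ} (hl : 1 < lam)
include hl

lemma SB_int (m lo hi : ℕ) {z : ℝ} (hz : z < 1) :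
    IntegrableOn (fun t => t ^ m * SB lam lo hi t z) (Ioi 0) := by
  obtain ⟨C1, -, h1⟩ := L_int m (p := lam + 1 + lo) (e := 0) le_rfl (by simp)
    (by linarith [(lo.cast_nonneg : (0:ℝ) ≤ lo)])
  obtain ⟨C2, -, h2⟩ := L_int m (p := lam + 1 + hi) (e := 0) le_rfl (by simp)
    (by linarith [(hi.cast_nonneg : (0:ℝ) ≤ hi)])
  have := (h1 z hz).1.add (h2 z hz).1
  refine this.congr (Filter.Eventually.of_forall fun t => ?_)
  simp only [SB, Pi.add_apply]; ring

lemma SB_int_le (m lo hi : ℕ) {e s : ℝ} (he : 0 ≤ e) (hem : 2 * e ≤ m) (heh : e ≤ hi)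
    (h1s : lam + lo ≤ s) (h2s : lam + hi - e ≤ s) :
    ∃ C, 0 < C ∧ ∀ z < 1, -1 ≤ z →
      ∫ t in Ioi (0:ℝ), t ^ m * SB lam lo hi t z ≤ C * (1 - z) ^ (-s) := by
  obtain ⟨C1, hC1, h1⟩ := L_int m (p := lam + 1 + lo) (e := 0) le_rfl (by simp)
    (by linarith [(lo.cast_nonneg : (0:ℝ) ≤ lo)])
  obtain ⟨C2, hC2, h2⟩ := L_int m (p := lam + 1 + hi) (e := e) he hem (by linarith)
  refine ⟨C1 * 2 ^ (s - (lam + lo)) + C2 * 2 ^ (s - (lam + hi - e)), by positivity, fun z hz hz1 => ?_⟩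
  have e1 : ∫ t in Ioi (0:ℝ), t ^ m * SB lam lo hi t z =
      ∫ t in Ioi (0:ℝ), (t ^ m * (sinh (t / 2) * (cosh (t / 2) - z) ^ (-(lam + 1 + (lo:ℝ)))) +
        t ^ m * (sinh (t / 2) * (cosh (t / 2) - z) ^ (-(lam + 1 + (hi:ℝ))))) := by
    congr 1; funext t; simp only [SB]; ring
  rw [e1, integral_add (h1 z hz).1 (h2 z hz).1]
  have a1 := (h1 z hz).2 hz1
  have a2 := (h2 z hz).2 hz1
  rw [show lam + 1 + (lo:ℝ) - 1 - 0 = lam + lo by ring] at a1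
  rw [show lam + 1 + (hi:ℝ) - 1 - e = lam + hi - e by ring] at a2
  have b1 := mul_le_mul_of_nonneg_left (one_sub_rpow_le h1s hz1 hz) hC1.le
  have b2 := mul_le_mul_of_nonneg_left (one_sub_rpow_le h2s hz1 hz) hC2.le
  linarith

variable {lo hi : ℕ} {g g1 : ℝ → ℝ → ℝ} (hg : SS lam lo hi g)
include hg

omit hl in
lemma SS.cont_t {z : ℝ} (hz : z < 1) (m : ℕ) : Continuous fun t => t ^ m * g t z := by
  refine Continuous.mul (by fun_prop) ?_
  exact hg.cont.comp_continuous (f := fun t : ℝ => (t, z)) (by fun_prop) fun t => hz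

lemma SS.int (m : ℕ) {z : ℝ} (hz : z < 1) : IntegrableOn (fun t => t ^ m * g t z) (Ioi 0) := by
  obtain ⟨C, hC, hb⟩ := hg.bound
  refine Integrable.mono' ((SB_int hl m lo hi hz).const_mul C) (hg.cont_t hz m).aestronglyMeasurable ?_
  refine (ae_restrict_iff' measurableSet_Ioi).2 (Filter.Eventually.of_forall fun t ht => ?_)
  have ht := mem_Ioi.1 ht
  rw [norm_mul, Real.norm_of_nonneg (by positivity), Real.norm_eq_abs]
  have := mul_le_mul_of_nonneg_left (hb t ht z hz) (by positivity : 0 ≤ t ^ m)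
  linarith

lemma rho_bound (m : ℕ) {e s : ℝ} (he : 0 ≤ e) (hem : 2 * e ≤ m) (heh : e ≤ hi)
    (h1s : lam + lo ≤ s) (h2s : lam + hi - e ≤ s) :
    ∃ C, 0 < C ∧ ∀ z < 1, -1 ≤ z → |rho m g z| ≤ C * (1 - z) ^ (-s) := by
  obtain ⟨C, hC, hb⟩ := hg.bound
  obtain ⟨C1, hC1, hb1⟩ := SB_int_le hl m lo hi he hem heh h1s h2s
  refine ⟨(C + 1) * C1, by positivity, fun z hz hz1 => ?_⟩
  have h1 : |rho m g z| ≤ ∫ t in Ioi (0:ℝ), (C + 1) * (t ^ m * SB lam lo hi t z) := by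
    unfold rho
    rw [← Real.norm_eq_abs]
    refine norm_integral_le_of_norm_le ((SB_int hl m lo hi hz).const_mul (C + 1)) ?_
    refine (ae_restrict_iff' measurableSet_Ioi).2 (Filter.Eventually.of_forall fun t ht => ?_)
    have ht := mem_Ioi.1 ht
    rw [norm_mul, Real.norm_of_nonneg (by positivity), Real.norm_eq_abs]
    have := mul_le_mul_of_nonneg_left (hb t ht z hz) (by positivity : 0 ≤ t ^ m)
    have := mul_nonneg (by positivity : 0 ≤ t ^ m) (SB_nonneg lam lo hi ht hz)
    linarith
  rw [integral_const_mul] at h1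
  have := mul_le_mul_of_nonneg_left (hb1 z hz hz1) (by positivity : 0 ≤ C + 1)
  linarith

lemma rho_deriv (m : ℕ) (hg1 : SS lam (lo + 1) (hi + 1) g1)
    (hd : ∀ t, ∀ z < 1, HasDerivAt (g t) (g1 t z) z) {z : ℝ} (hz : z < 1) :
    HasDerivAt (rho m g) (rho m g1 z) z := by
  obtain ⟨C, hC, hb⟩ := hg1.bound
  obtain ⟨ζ, h1, h2⟩ := exists_between hz
  refine (hasDerivAt_integral_of_dominated_loc_of_deriv_le (μ := volume.restrict (Ioi 0))
    (F := fun z t => t ^ m * g t z) (F' := fun z t => t ^ m * g1 t z)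
    (bound := fun t => C * (t ^ m * SB lam (lo + 1) (hi + 1) t ζ)) (Iio_mem_nhds h1) ?_ ?_ ?_ ?_ ?_ ?_).2
  · filter_upwards [Iio_mem_nhds h1] with x hx
    exact (hg.cont_t (lt_trans hx h2) m).aestronglyMeasurable
  · exact hg.int hl m hz
  · exact (hg1.cont_t hz m).aestronglyMeasurable
  · refine (ae_restrict_iff' measurableSet_Ioi).2 (Filter.Eventually.of_forall fun t ht x hx => ?_)
    have ht := mem_Ioi.1 ht
    have hx := mem_Iio.1 hx
    rw [norm_mul, Real.norm_of_nonneg (by positivity), Real.norm_eq_abs]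
    have := mul_le_mul_of_nonneg_left ((hb t ht x (hx.trans h2)).trans
      (mul_le_mul_of_nonneg_left (SB_mono (by linarith) (lo + 1) (hi + 1) ht hx.le h2) hC))
      (by positivity : 0 ≤ t ^ m)
    linarith
  · exact (SB_int hl m (lo + 1) (hi + 1) h2).const_mul C
  · refine Filter.Eventually.of_forall fun t x hx => ?_
    exact (hd t x (lt_trans hx h2)).const_mul _

lemma rho_cont (m : ℕ) : ContinuousOn (rho m g) (Iio 1) := by
  obtain ⟨g1, h1, h2⟩ := hg.deriv
  exact cont_of_deriv fun z hz => rho_deriv hl hg m h1 h2 hz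

lemma fubini (m : ℕ) {ν : Measure (ℝ × ℝ)} [IsFiniteMeasure ν] {θ φ : ℝ} (hθ : θ ∈ Ioo 0 π)
    (hφ : φ ∈ Ioo 0 π) (h : θ ≠ φ) {k : ℝ × ℝ → ℝ} (hk : Continuous k) (hk1 : ∀ p, |k p| ≤ 1) :
    IntegrableOn (fun t => t ^ m * ∫ p, g t (zz p θ φ) * k p ∂ν) (Ioi 0) ∧
    ∫ t in Ioi (0:ℝ), t ^ m * ∫ p, g t (zz p θ φ) * k p ∂ν = ∫ p, rho m g (zz p θ φ) * k p ∂ν := by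
  obtain ⟨C, hC, hb⟩ := hg.bound
  have hζ := cos_half_lt hθ hφ h
  set ζ := cos ((θ - φ) / 2) with hζd
  have hcont : Continuous (fun q : ℝ × (ℝ × ℝ) => q.1 ^ m * (g q.1 (zz q.2 θ φ) * k q.2)) := by
    refine Continuous.mul (by fun_prop) (Continuous.mul ?_ (by fun_prop))
    refine hg.cont.comp_continuous (f := fun q : ℝ × (ℝ × ℝ) => (q.1, zz q.2 θ φ)) ?_ ?_
    · exact continuous_fst.prodMk ((continuous_zz θ φ).comp continuous_snd)
    · intro q
      exact zz_lt_one q.2 hθ hφ h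
  have hprod : Integrable (fun q : ℝ × (ℝ × ℝ) => q.1 ^ m * (g q.1 (zz q.2 θ φ) * k q.2))
      ((volume.restrict (Ioi 0)).prod ν) := by
    have hbd : Integrable (fun q : ℝ × (ℝ × ℝ) => (C * (q.1 ^ m * SB lam lo hi q.1 ζ)) * 1)
        ((volume.restrict (Ioi 0)).prod ν) :=
      Integrable.mul_prod (f := fun t => C * (t ^ m * SB lam lo hi t ζ)) (g := fun _ => (1:ℝ))
        ((SB_int hl m lo hi hζ).const_mul C) (integrable_const _)
    refine Integrable.mono' hbd hcont.aestronglyMeasurable ?_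
    have : ∀ᵐ t ∂(volume.restrict (Ioi (0:ℝ))), 0 < t :=
      (ae_restrict_iff' measurableSet_Ioi).2 (Filter.Eventually.of_forall fun t ht => ht)
    have := Measure.quasiMeasurePreserving_fst (μ := volume.restrict (Ioi (0:ℝ))) (ν := ν) |>.ae this
    filter_upwards [this] with q hq
    rw [norm_mul, Real.norm_of_nonneg (by positivity), Real.norm_eq_abs, abs_mul]
    have hz := zz_lt_one q.2 hθ hφ h
    have e1 := (hb q.1 hq _ hz).trans
      (mul_le_mul_of_nonneg_left (SB_mono (by linarith) lo hi hq (zz_mem q.2 hθ hφ le_rfl).2 hζ) hC)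
    have e2 := mul_le_of_le_one_right (abs_nonneg (g q.1 (zz q.2 θ φ))) (hk1 q.2)
    have := mul_le_mul_of_nonneg_left (e2.trans e1) (by positivity : 0 ≤ q.1 ^ m)
    linarith
  constructor
  · have := hprod.integral_prod_left
    simp only [integral_const_mul] at this
    exact this
  · have := integral_integral_swap (f := fun t p => t ^ m * (g t (zz p θ φ) * k p)) hprod
    simp only [integral_const_mul] at this
    rw [this]
    congr 1; funext p
    unfold rho
    rw [← integral_mul_const]
    congr 1; funext t; ring

end

end JR

namespace JR
open scoped Topology

def mm (α β θ : ℝ) : ℝ := cos θ + (α + 1 / 2) * (1 + cos θ) - (β + 1 / 2) * (1 - cos θ)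

lemma hasDerivAt_mm (α β θ : ℝ) : HasDerivAt (mm α β) (-(α + β + 2) * sin θ) θ := by
  unfold mm
  have h := hasDerivAt_cos θ
  have := (h.add ((h.const_add 1).const_mul (α + 1 / 2))).sub ((h.const_sub 1).const_mul (β + 1 / 2))
  exact this.congr_deriv (by ring)

lemma sin_half_mul (θ : ℝ) : sin θ = 2 * sin (θ / 2) * cos (θ / 2) := by
  rw [← sin_two_mul]; congr 1; ring

lemma cos_half_sq (θ : ℝ) : cos θ = 2 * cos (θ / 2) ^ 2 - 1 := by
  rw [← cos_two_mul]; congr 1; ring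

lemma mem_open {θ φ : ℝ} (hθ : θ ∈ Ioo 0 π) (h : θ ≠ φ) :
    ∀ᶠ x in 𝓝 θ, x ∈ Ioo 0 π ∧ x ≠ φ :=
  (show ∀ᶠ x in 𝓝 θ, x ∈ Ioo 0 π from isOpen_Ioo.mem_nhds hθ).and (isOpen_ne.mem_nhds h)

variable {α β : ℝ}

lemma delStar_step {ν : Measure (ℝ × ℝ)} [IsFiniteMeasure ν] {g g1 : ℝ → ℝ} {θ φ c : ℝ} {f : ℝ → ℝ}
    (hf : ∀ x ∈ Ioo 0 π, x ≠ φ → f x = c * (sin x * FF ν g x φ))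
    (hg : ∀ z < 1, HasDerivAt g (g1 z) z) (hg1 : ContinuousOn g1 (Iio 1))
    (hθ : θ ∈ Ioo 0 π) (hφ : φ ∈ Ioo 0 π) (h : θ ≠ φ) :
    delStar α β f θ = -c * (sin θ * FFt ν g1 θ φ + mm α β θ * FF ν g θ φ) := by
  have hd := ((hasDerivAt_sin θ).mul (hasDerivAt_FF (ν := ν) hg hg1 hθ hφ h)).const_mul c
  have hd' : HasDerivAt f _ θ := hd.congr_of_eventuallyEq (by
    filter_upwards [mem_open hθ h] with x hx using hf x hx.1 hx.2)
  unfold delStar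
  rw [hd'.deriv, hf θ hθ h, tan_eq_sin_div_cos]
  obtain ⟨h1, h2⟩ := hpos hθ
  unfold mm
  rw [sin_half_mul θ, cos_half_sq θ]
  have h3 := sin_sq_add_cos_sq (θ / 2)
  have h4 : sin (θ / 2) ^ 2 = 1 - cos (θ / 2) ^ 2 := by linarith
  field_simp
  rw [h4]
  ring

lemma deriv_step (hα : -1 < α) (hβ : -1 < β) {g g1 g2 : ℝ → ℝ} {θ φ c : ℝ} {f : ℝ → ℝ}
    (hf : ∀ x ∈ Ioo 0 π, x ≠ φ → f x = -c * (sin x * FFt (nu (α + 1) (β + 1)) g1 x φ +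
      mm α β x * FF (nu (α + 1) (β + 1)) g x φ))
    (hg : ∀ z < 1, HasDerivAt g (g1 z) z) 
    (hg1 : ∀ z < 1, HasDerivAt g1 (g2 z) z) (hg2 : ContinuousOn g2 (Iio 1))
    (hθ : θ ∈ Ioo 0 π) (hφ : φ ∈ Ioo 0 π) (h : θ ≠ φ) :
    deriv f θ = c * (sin θ * FF (nu (α + 1) (β + 1))
      (fun z => Aop (α + β + 3) g1 g2 z + (α + β + 2) * g z) θ φ) := by
  have ha : 0 < α + 1 := by linarith
  have hb : 0 < β + 1 := by linarith
  have := isFinite_nu ha hb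
  have hc1 := cont_of_deriv hg1
  have hd := (((hasDerivAt_sin θ).mul (hasDerivAt_FFt (ν := nu (α + 1) (β + 1)) hg1 hg2 hθ hφ h)).add
    ((hasDerivAt_mm α β θ).mul (hasDerivAt_FF (ν := nu (α + 1) (β + 1)) hg hc1 hθ hφ h))).const_mul (-c)
  have hd' : HasDerivAt f _ θ := hd.congr_of_eventuallyEq (by
    filter_upwards [mem_open hθ h] with x hx using hf x hx.1 hx.2)
  rw [hd'.deriv]
  have key := intertwine ha hb hg1 hg2 hθ hφ h
  rw [show α + 1 + (β + 1) + 1 = α + β + 3 by ring] at key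
  have hA : ContinuousOn (Aop (α + β + 3) g1 g2) (Iio 1) := by
    unfold Aop
    fun_prop
  have e : FF (nu (α + 1) (β + 1)) (fun z => Aop (α + β + 3) g1 g2 z + (α + β + 2) * g z) θ φ =
      FF (nu (α + 1) (β + 1)) (Aop (α + β + 3) g1 g2) θ φ + (α + β + 2) * FF (nu (α + 1) (β + 1)) g θ φ := by
    have i1 := integrable_zz (ν := nu (α + 1) (β + 1)) hA hθ hφ h (k := fun _ => 1) continuous_const
      (by simp)
    have i2 := integrable_zz (ν := nu (α + 1) (β + 1)) (cont_of_deriv hg) hθ hφ h (k := fun _ => 1)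
      continuous_const (by simp)
    simp only [mul_one] at i1 i2
    unfold FF
    rw [integral_add i1 (i2.const_mul _), integral_const_mul]
  rw [e, key]
  obtain ⟨h1, h2⟩ := hpos hθ
  unfold mm
  rw [sin_half_mul θ, cos_half_sq θ]
  have h3 := sin_sq_add_cos_sq (θ / 2)
  have h4 : sin (θ / 2) ^ 2 = 1 - cos (θ / 2) ^ 2 := by linarith
  field_simp
  rw [h4]
  ring

lemma deltaOdd_even (hα : -1 < α) (hβ : -1 < β) (k : ℕ) :
    ∃ g, SS (α + β + 3) 0 k g ∧ ∀ t > 0, ∀ θ ∈ Ioo 0 π, ∀ φ ∈ Ioo 0 π, θ ≠ φ →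
      deltaOdd α β (2 * k) (fun θ' => jHtil α β t θ' φ) θ =
        C0 α β * sin φ * (sin θ * FF (nu (α + 1) (β + 1)) (g t) θ φ) := by
  have ha : 0 < α + 1 := by linarith
  have hb : 0 < β + 1 := by linarith
  have := isFinite_nu ha hb
  induction k with
  | zero =>
    refine ⟨_, SS.base 0 0 le_rfl le_rfl, fun t ht θ hθ φ hφ h => ?_⟩
    have e := jHtil_eq hα hβ hθ hφ h ht
    show jHtil α β t θ φ = _
    rw [e]
    congr 3
    funext z
    unfold kk
    simp only [pow_zero, mul_one]
    congr 2
    push_cast; ring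
  | succ k ih =>
    obtain ⟨g, hg, hrep⟩ := ih
    obtain ⟨g1, hg1, hd1⟩ := hg.deriv
    obtain ⟨g2, hg2, hd2⟩ := hg1.deriv
    refine ⟨_, hg.aop hg1 hg2 (α + β + 2), fun t ht θ hθ φ hφ h => ?_⟩
    have cz : ∀ {lo hi : ℕ} {G : ℝ → ℝ → ℝ}, SS (α + β + 3) lo hi G → ContinuousOn (G t) (Iio 1) := by
      intro lo hi G hG
      exact hG.cont.comp (f := fun z : ℝ => (t, z)) (by fun_prop) fun z hz => hz
    have s1 : ∀ x ∈ Ioo 0 π, x ≠ φ → deltaOdd α β (2 * k + 1) (fun θ' => jHtil α β t θ' φ) x =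
        -(C0 α β * sin φ) * (sin x * FFt (nu (α + 1) (β + 1)) (g1 t) x φ +
          mm α β x * FF (nu (α + 1) (β + 1)) (g t) x φ) := by
      intro x hx hxφ
      have : deltaOdd α β (2 * k + 1) (fun θ' => jHtil α β t θ' φ) =
        delStar α β (deltaOdd α β (2 * k) (fun θ' => jHtil α β t θ' φ)) := by
        simp [deltaOdd]
      rw [this]
      exact delStar_step (fun y hy hyφ => hrep t ht y hy φ hφ hyφ) (hd1 t) (cz hg1) hx hφ hxφ
    have : deltaOdd α β (2 * (k + 1)) (fun θ' => jHtil α β t θ' φ) =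
        deriv (deltaOdd α β (2 * k + 1) (fun θ' => jHtil α β t θ' φ)) := by
      rw [show 2 * (k + 1) = (2 * k + 1) + 1 by ring, deltaOdd]
      simp only [show (2 * k + 1) % 2 ≠ 0 by omega, if_false]
    rw [this]
    exact deriv_step hα hβ s1 (hd1 t) (hd2 t) (cz hg2) hθ hφ h

lemma rieszKer_even (hα : -1 < α) (hβ : -1 < β) (k : ℕ) :
    ∃ g, SS (α + β + 3) 0 (k + 1) g ∧ ∀ θ ∈ Ioo 0 π, ∀ φ ∈ Ioo 0 π, θ ≠ φ →
      rieszKer α β (2 * (k + 1)) θ φ = (1 / Real.Gamma ((2 * (k + 1) : ℕ) : ℝ) * C0 α β) * (sin φ *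
        (sin θ * FF (nu (α + 1) (β + 1)) (rho (2 * k + 1) g) θ φ)) := by
  have ha : 0 < α + 1 := by linarith
  have hb : 0 < β + 1 := by linarith
  have := isFinite_nu ha hb
  obtain ⟨g, hg, hrep⟩ := deltaOdd_even hα hβ (k + 1)
  refine ⟨g, hg, fun θ hθ φ hφ h => ?_⟩
  have e := (fubini (by linarith : 1 < α + β + 3) hg (2 * k + 1) (ν := nu (α + 1) (β + 1)) hθ hφ h
    (k := fun _ => 1) continuous_const (by simp)).2
  simp only [mul_one] at e
  unfold rieszKer
  have : ∫ t in Ioi (0:ℝ), deltaOdd α β (2 * (k + 1)) (fun θ' => jHtil α β t θ' φ) θ *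
      t ^ (2 * (k + 1) - 1) = ∫ t in Ioi (0:ℝ), (C0 α β * sin φ * sin θ) * (t ^ (2 * k + 1) *
        ∫ p, g t (zz p θ φ) ∂(nu (α + 1) (β + 1))) := by
    refine setIntegral_congr_fun measurableSet_Ioi fun t ht => ?_
    beta_reduce
    rw [hrep t ht θ hθ φ hφ h, show 2 * (k + 1) - 1 = 2 * k + 1 by omega]
    unfold FF
    ring
  rw [this, integral_const_mul, e]
  unfold FF
  ring

lemma rieszKer_odd (hα : -1 < α) (hβ : -1 < β) (k : ℕ) :
    ∃ g, SS (α + β + 3) 0 k g ∧ ∀ g1, SS (α + β + 3) 1 (k + 1) g1 →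
      (∀ t, ∀ z < 1, HasDerivAt (g t) (g1 t z) z) → ∀ θ ∈ Ioo 0 π, ∀ φ ∈ Ioo 0 π, θ ≠ φ →
      rieszKer α β (2 * k + 1) θ φ = (-(1 / Real.Gamma ((2 * k + 1 : ℕ) : ℝ) * C0 α β)) * (sin φ *
        (sin θ * FFt (nu (α + 1) (β + 1)) (rho (2 * k) g1) θ φ +
          mm α β θ * FF (nu (α + 1) (β + 1)) (rho (2 * k) g) θ φ)) := by
  have ha : 0 < α + 1 := by linarith
  have hb : 0 < β + 1 := by linarith
  have := isFinite_nu ha hb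
  obtain ⟨g, hg, hrep⟩ := deltaOdd_even hα hβ k
  refine ⟨g, hg, fun g1 hg1 hd1 θ hθ φ hφ h => ?_⟩
  obtain ⟨i1, e1⟩ := (fubini (by linarith : 1 < α + β + 3) hg (2 * k) (ν := nu (α + 1) (β + 1)) hθ hφ h
    (k := fun _ => 1) continuous_const (by simp))
  obtain ⟨i2, e2⟩ := (fubini (by linarith : 1 < α + β + 3) hg1 (2 * k) (ν := nu (α + 1) (β + 1)) hθ hφ h
    (k := fun p => zt p θ φ) (continuous_zt θ φ) (fun p => abs_zt_le_one p θ φ))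
  simp only [mul_one] at i1 e1
  unfold rieszKer
  have : ∫ t in Ioi (0:ℝ), deltaOdd α β (2 * k + 1) (fun θ' => jHtil α β t θ' φ) θ *
      t ^ (2 * k + 1 - 1) = ∫ t in Ioi (0:ℝ), ((-(C0 α β * sin φ) * sin θ) * (t ^ (2 * k) *
        ∫ p, g1 t (zz p θ φ) * zt p θ φ ∂(nu (α + 1) (β + 1))) +
        (-(C0 α β * sin φ) * mm α β θ) * (t ^ (2 * k) * ∫ p, g t (zz p θ φ) ∂(nu (α + 1) (β + 1)))) := by
    refine setIntegral_congr_fun measurableSet_Ioi fun t ht => ?_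
    beta_reduce
    have e : deltaOdd α β (2 * k + 1) (fun θ' => jHtil α β t θ' φ) =
        delStar α β (deltaOdd α β (2 * k) (fun θ' => jHtil α β t θ' φ)) := by
      simp [deltaOdd]
    have hc : ContinuousOn (g1 t) (Iio 1) :=
      hg1.cont.comp (f := fun z : ℝ => (t, z)) (by fun_prop) fun z hz => hz
    rw [e, delStar_step (ν := nu (α + 1) (β + 1)) (fun y hy hyφ => hrep t ht y hy φ hφ hyφ) (hd1 t) hc hθ hφ h,
      show 2 * k + 1 - 1 = 2 * k by omega]
    unfold FF FFt
    ring
  rw [this, integral_add (i2.const_mul _) (i1.const_mul _), integral_const_mul, integral_const_mul, e1, e2]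
  unfold FF FFt
  ring

end JR

namespace JR
open scoped Topology

lemma lin_int {u v ξ : ℝ} (hu : 0 < u) (hv : 0 < v) (hξ : 0 < ξ) :
    ∫ ω in (0:ℝ)..π, (u + v * ω) ^ (-1 - 2 * ξ) ≤ u ^ (-(2 * ξ)) / (2 * ξ * v) := by
  have hp : ∀ ω ∈ uIcc 0 π, 0 < u + v * ω := by
    intro ω hω
    rw [uIcc_of_le pi_pos.le] at hω
    have := mul_nonneg hv.le hω.1
    linarith
  have hd : ∀ ω ∈ uIcc 0 π, HasDerivAt (fun ω => -(1 / (2 * ξ * v)) * (u + v * ω) ^ (-(2 * ξ)))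
      ((u + v * ω) ^ (-1 - 2 * ξ)) ω := by
    intro ω hω
    have h1 : HasDerivAt (fun ω => u + v * ω) v ω := by
      exact (((hasDerivAt_id' ω).const_mul v).const_add u).congr_deriv (by ring)
    have := (h1.rpow_const (p := -(2 * ξ)) (Or.inl (hp ω hω).ne')).const_mul (-(1 / (2 * ξ * v)))
    refine this.congr_deriv ?_
    rw [show -(2 * ξ) - 1 = -1 - 2 * ξ by ring]
    field_simp
  have hc : ContinuousOn (fun ω => (u + v * ω) ^ (-1 - 2 * ξ)) (uIcc 0 π) :=
    ContinuousOn.rpow_const (by fun_prop) fun ω hω => Or.inl (hp ω hω).ne'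
  rw [intervalIntegral.integral_eq_sub_of_hasDerivAt hd hc.intervalIntegrable]
  have := rpow_pos_of_pos (hp π right_mem_uIcc) (-(2 * ξ))
  have h2 : 0 < 1 / (2 * ξ * v) := by positivity
  rw [mul_zero, add_zero]
  have e : u ^ (-(2 * ξ)) / (2 * ξ * v) = 1 / (2 * ξ * v) * u ^ (-(2 * ξ)) := by ring
  rw [e]
  have := mul_pos h2 this
  linarith

lemma cos_low {A B : ℝ} (hB : 0 ≤ B) (hAB : B < A) (ω : ℝ) : A - B ≤ A - B * cos ω := by
  nlinarith [cos_le_one ω]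

lemma cos_pos {A B : ℝ} (hB : 0 ≤ B) (hAB : B < A) (ω : ℝ) : 0 < A - B * cos ω := by
  linarith [cos_low hB hAB ω]

lemma int_Pm_of {a : ℝ} (ha : 0 < a) {f : ℝ → ℝ} (hf : Continuous f) : Integrable f (Pm a) := by
  have := isFinite_Pm ha
  obtain ⟨M, hM⟩ := (isCompact_Icc (a := (0:ℝ)) (b := π)).exists_bound_of_continuousOn hf.continuousOn
  refine Integrable.of_bound hf.aestronglyMeasurable M ?_
  unfold Pm
  refine withDensity_absolutelyContinuous _ _ |>.ae_le ?_
  exact (ae_restrict_iff' measurableSet_Ioc).2 (Filter.Eventually.of_forall fun t ht => hM t ⟨ht.1.le, ht.2⟩)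

lemma cont_Ab {A B s : ℝ} (hB : 0 ≤ B) (hAB : B < A) : Continuous fun ω => (A - B * cos ω) ^ s :=
  Continuous.rpow_const (by fun_prop) fun ω => Or.inl (cos_pos hB hAB ω).ne'

lemma K0 {a ξ : ℝ} (ha : 0 < a) (hξ : 0 < ξ) : ∃ C, 0 < C ∧ ∀ A B : ℝ, 0 ≤ B → B < A →
    ∫ ω, (A - B * cos ω) ^ (-(a + 1 / 2 + ξ)) ∂(Pm a) ≤ C * (A ^ (-(a + 1 / 2)) * (A - B) ^ (-ξ)) := by
  have := isFinite_Pm ha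
  set s := a + 1 / 2 + ξ with hs
  have hs0 : 0 < s := by positivity
  set M := (Pm a).real univ with hM
  have hM0 : 0 ≤ M := measureReal_nonneg
  refine ⟨(1 / 2) ^ (-s) * M + (π ^ 2) ^ (a + 1 / 2) * 2 ^ (1 / 2 + ξ) / (2 * ξ), by positivity,
    fun A B hB hAB => ?_⟩
  have hA : 0 < A := by linarith
  have hd : 0 < A - B := by linarith
  have n1 := rpow_pos_of_pos hA (-(a + 1 / 2))
  have n2 := rpow_pos_of_pos hd (-ξ)
  have n3 := mul_pos n1 n2
  rcases le_total B (A / 2) with h | h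
  · have h1 : ∫ ω, (A - B * cos ω) ^ (-s) ∂(Pm a) ≤ ∫ ω, (A / 2) ^ (-s) ∂(Pm a) := by
      refine integral_mono (int_Pm_of ha (cont_Ab hB hAB)) (integrable_const _) fun ω => ?_
      refine rpow_le_rpow_of_nonpos (by linarith) ?_ (by linarith)
      have := cos_low hB hAB ω
      linarith
    rw [integral_const, smul_eq_mul] at h1
    refine h1.trans ?_
    have e1 : (A / 2) ^ (-s) = (1 / 2) ^ (-s) * (A ^ (-(a + 1 / 2)) * A ^ (-ξ)) := by
      rw [← rpow_add hA, div_eq_mul_one_div, mul_rpow hA.le (by norm_num), mul_comm]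
      congr 2; rw [hs]; ring
    have e2 : A ^ (-ξ) ≤ (A - B) ^ (-ξ) :=
      rpow_le_rpow_of_nonpos hd (by linarith) (by linarith)
    rw [e1]
    have e3 := mul_le_mul_of_nonneg_left e2 n1.le
    have e4 := mul_le_mul_of_nonneg_left e3 (by positivity : 0 ≤ (1 / 2 : ℝ) ^ (-s) * M)
    have e5 : 0 ≤ (π ^ 2) ^ (a + 1 / 2) * 2 ^ (1 / 2 + ξ) / (2 * ξ) := by positivity
    nlinarith [mul_nonneg e5 n3.le]
  · rw [integral_Pm ha]
    set c := A / π ^ 2 with hc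
    have hc0 : 0 < c := by positivity
    have hsd : 0 < √(A - B) := sqrt_pos.2 hd
    have hsc : 0 < √c := sqrt_pos.2 hc0
    have hsd2 := sq_sqrt hd.le
    have hsc2 := sq_sqrt hc0.le
    have pt : ∀ ω ∈ Icc 0 π, sin ω ^ (2 * a) * (A - B * cos ω) ^ (-s) ≤
        (c ^ (-a) * 2 ^ (1 / 2 + ξ)) * (√(A - B) + √c * ω) ^ (-1 - 2 * ξ) := by
      intro ω hω
      have h0 : 0 ≤ sin ω := sin_nonneg_of_nonneg_of_le_pi hω.1 hω.2
      have hlin : 0 < √(A - B) + √c * ω := by have := mul_nonneg hsc.le hω.1; linarith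
      set X := (A - B) + c * ω ^ 2 with hX
      have hX0 : 0 < X := by positivity
      have a1 : X ≤ A - B * cos ω := by
        have := cos_le_one_sub_mul_cos_sq (x := ω) (by rw [abs_of_nonneg hω.1]; exact hω.2)
        have h3 : c * ω ^ 2 ≤ B * (2 / π ^ 2 * ω ^ 2) := by
          have : c * ω ^ 2 = (A / 2) * (2 / π ^ 2 * ω ^ 2) := by rw [hc]; ring
          rw [this]; gcongr
        nlinarith
      have a2 : (A - B * cos ω) ^ (-s) ≤ X ^ (-s) := rpow_le_rpow_of_nonpos hX0 a1 (by linarith)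
      have a3 : sin ω ^ (2 * a) ≤ c ^ (-a) * X ^ a := by
        calc sin ω ^ (2 * a) ≤ ω ^ (2 * a) := rpow_le_rpow h0 (sin_le hω.1) (by linarith)
          _ = (ω ^ 2) ^ a := by rw [rpow_mul hω.1]; norm_num
          _ = c ^ (-a) * (c * ω ^ 2) ^ a := by
            rw [mul_rpow hc0.le (sq_nonneg _), ← mul_assoc, ← rpow_add hc0]; simp
          _ ≤ _ := by gcongr; linarith
      have a4 : X ^ (-(1 / 2 + ξ)) ≤ 2 ^ (1 / 2 + ξ) * (√(A - B) + √c * ω) ^ (-1 - 2 * ξ) := by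
        have b1 : (√(A - B) + √c * ω) ^ 2 / 2 ≤ X := by
          nlinarith [sq_nonneg (√(A - B) - √c * ω), mul_pow (√c) ω 2]
        have b2 := rpow_le_rpow_of_nonpos (z := -(1 / 2 + ξ)) (by positivity) b1 (by linarith)
        refine b2.trans (le_of_eq ?_)
        rw [div_rpow (by positivity) (by norm_num), rpow_neg (by norm_num : (0:ℝ) ≤ 2), div_inv_eq_mul,
          mul_comm, ← rpow_natCast, ← rpow_mul hlin.le]
        congr 2; push_cast; ring
      calc sin ω ^ (2 * a) * (A - B * cos ω) ^ (-s) ≤ (c ^ (-a) * X ^ a) * X ^ (-s) :=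
            mul_le_mul a3 a2 (rpow_nonneg (cos_pos hB hAB ω).le _) (by positivity)
        _ = c ^ (-a) * X ^ (-(1 / 2 + ξ)) := by
          rw [mul_assoc, ← rpow_add hX0]; congr 2; rw [hs]; ring
        _ ≤ c ^ (-a) * (2 ^ (1 / 2 + ξ) * (√(A - B) + √c * ω) ^ (-1 - 2 * ξ)) := by gcongr
        _ = _ := by ring
    have i1 : IntervalIntegrable (fun ω => sin ω ^ (2 * a) * (A - B * cos ω) ^ (-s)) volume 0 π :=
      ((cont_sinpow (by linarith)).mul (cont_Ab hB hAB)).intervalIntegrable _ _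
    have i2 : IntervalIntegrable (fun ω => (c ^ (-a) * 2 ^ (1 / 2 + ξ)) *
        (√(A - B) + √c * ω) ^ (-1 - 2 * ξ)) volume 0 π := by
      refine (ContinuousOn.mul continuousOn_const (ContinuousOn.rpow_const (by fun_prop) ?_)).intervalIntegrable
      intro ω hω
      rw [uIcc_of_le pi_pos.le] at hω
      have := mul_nonneg hsc.le hω.1
      exact Or.inl (by linarith)
    have h1 := intervalIntegral.integral_mono_on pi_pos.le i1 i2 pt
    rw [intervalIntegral.integral_const_mul] at h1
    have h2 := mul_le_mul_of_nonneg_left (lin_int hsd hsc hξ)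
      (by positivity : 0 ≤ c ^ (-a) * 2 ^ (1 / 2 + ξ))
    refine (h1.trans h2).trans ?_
    have e1 : √(A - B) ^ (-(2 * ξ)) = (A - B) ^ (-ξ) := by
      rw [sqrt_eq_rpow, ← rpow_mul hd.le]; congr 1; ring
    have e2 : c ^ (-a) * (√c)⁻¹ = (π ^ 2) ^ (a + 1 / 2) * A ^ (-(a + 1 / 2)) := by
      rw [sqrt_eq_rpow, ← rpow_neg hc0.le, ← rpow_add hc0, hc, div_rpow hA.le (by positivity),
        show -a + -(1 / 2) = -(a + 1 / 2) by ring, rpow_neg (by positivity : 0 ≤ π ^ 2)]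
      field_simp
    have e3 : c ^ (-a) * 2 ^ (1 / 2 + ξ) * (√(A - B) ^ (-(2 * ξ)) / (2 * ξ * √c)) =
        (π ^ 2) ^ (a + 1 / 2) * 2 ^ (1 / 2 + ξ) / (2 * ξ) * (A ^ (-(a + 1 / 2)) * (A - B) ^ (-ξ)) := by
      rw [e1]
      calc _ = (c ^ (-a) * (√c)⁻¹) * 2 ^ (1 / 2 + ξ) * (A - B) ^ (-ξ) / (2 * ξ) := by field_simp
        _ = _ := by rw [e2]; ring
    rw [e3]
    have e5 : 0 ≤ (1 / 2 : ℝ) ^ (-s) * M := by positivity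
    nlinarith [mul_nonneg e5 n3.le]

lemma K1 {a ξ s : ℝ} (ha : 0 < a) (hξ : 0 < ξ) (hsa : s ≤ a + 1 / 2) :
    ∃ C, 0 < C ∧ ∀ A B : ℝ, 0 ≤ B → B < A →
    ∫ ω, (A - B * cos ω) ^ (-(s + ξ)) ∂(Pm a) ≤ C * (A ^ (-s) * (A - B) ^ (-ξ)) := by
  obtain ⟨C, hC, h⟩ := K0 ha hξ
  refine ⟨2 ^ (a + 1 / 2 - s) * C, by positivity, fun A B hB hAB => ?_⟩
  have hA : 0 < A := by linarith
  have h1 : ∫ ω, (A - B * cos ω) ^ (-(s + ξ)) ∂(Pm a) ≤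
      ∫ ω, (2 * A) ^ (a + 1 / 2 - s) * (A - B * cos ω) ^ (-(a + 1 / 2 + ξ)) ∂(Pm a) := by
    refine integral_mono (int_Pm_of ha (cont_Ab hB hAB)) ((int_Pm_of ha (cont_Ab hB hAB)).const_mul _)
      fun ω => ?_
    have hp := cos_pos hB hAB ω
    have e : (A - B * cos ω) ^ (-(s + ξ)) = (A - B * cos ω) ^ (a + 1 / 2 - s) *
        (A - B * cos ω) ^ (-(a + 1 / 2 + ξ)) := by
      rw [← rpow_add hp]; congr 1; ring
    beta_reduce
    rw [e]
    have n := rpow_pos_of_pos hp (-(a + 1 / 2 + ξ))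
    gcongr
    nlinarith [neg_one_le_cos ω]
  rw [integral_const_mul] at h1
  have h2 := mul_le_mul_of_nonneg_left (h A B hB hAB) (by positivity : 0 ≤ (2 * A) ^ (a + 1 / 2 - s))
  refine (h1.trans h2).trans (le_of_eq ?_)
  rw [mul_rpow (by norm_num) hA.le]
  have : A ^ (-s) = A ^ (a + 1 / 2 - s) * A ^ (-(a + 1 / 2)) := by
    rw [← rpow_add hA]; congr 1; ring
  rw [this]; ring

def Ab (θ φ : ℝ) : ℝ := 1 - cos (θ / 2) * cos (φ / 2)
def Bb (θ φ : ℝ) : ℝ := 1 - sin (θ / 2) * sin (φ / 2)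
def Qb (θ φ : ℝ) : ℝ := 1 - cos ((θ - φ) / 2)

lemma Qb_eq (θ φ : ℝ) : Qb θ φ = 1 - sin (θ / 2) * sin (φ / 2) - cos (θ / 2) * cos (φ / 2) := by
  unfold Qb; rw [sub_div, cos_sub]; ring

lemma Qb_pos {θ φ : ℝ} (hθ : θ ∈ Ioo 0 π) (hφ : φ ∈ Ioo 0 π) (h : θ ≠ φ) : 0 < Qb θ φ := by
  have := cos_half_lt hθ hφ h; unfold Qb; linarith

lemma cont_q (s : ℝ) : ContinuousOn (fun z : ℝ => (1 - z) ^ s) (Iio 1) :=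
  ContinuousOn.rpow_const (by fun_prop) fun z hz => Or.inl (by have := mem_Iio.1 hz; linarith)

lemma K2 {a b ξ s1 s2 : ℝ} (ha : 0 < a) (hb : 0 < b) (hξ : 0 < ξ) (h1 : 0 ≤ s1) (h1a : s1 ≤ a + 1 / 2)
    (h2 : 0 ≤ s2) (h2b : s2 ≤ b + 1 / 2) : ∃ C, 0 < C ∧ ∀ θ ∈ Ioo 0 π, ∀ φ ∈ Ioo 0 π, θ ≠ φ →
      FF (nu a b) (fun z => (1 - z) ^ (-(s1 + s2 + ξ))) θ φ ≤
        C * (Ab θ φ ^ (-s1) * Bb θ φ ^ (-s2) * Qb θ φ ^ (-ξ)) := by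
  obtain ⟨C1, hC1, k1⟩ := K1 (a := a) (ξ := s2 + ξ) (s := s1) ha (by linarith) h1a
  obtain ⟨C2, hC2, k2⟩ := K1 (a := b) (ξ := ξ) (s := s2) hb hξ h2b
  have := isFinite_Pm ha
  have := isFinite_Pm hb
  have := isFinite_nu ha hb
  refine ⟨C1 * C2, by positivity, fun θ hθ φ hφ h => ?_⟩
  obtain ⟨p1, p2⟩ := hpos hθ
  obtain ⟨p3, p4⟩ := hpos hφ
  have hQ := Qb_pos hθ hφ h
  rw [Qb_eq] at hQ
  have ss := mul_pos p1 p3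
  have cc' := mul_pos p2 p4
  set S := sin (θ / 2) * sin (φ / 2) with hS
  set K := cos (θ / 2) * cos (φ / 2) with hK
  have hA : 0 < Ab θ φ := by unfold Ab; linarith
  have hintg := integrable_zz (ν := nu a b) (cont_q (-(s1 + s2 + ξ))) hθ hφ h (k := fun _ => 1)
    continuous_const (by simp)
  simp only [mul_one] at hintg
  have hintg' := hintg
  unfold nu at hintg'
  unfold FF nu
  rw [integral_prod_symm _ hintg']
  have hlow : ∀ y, Ab θ φ ≤ 1 - cos y * K := fun y => by
    unfold Ab; nlinarith [cos_le_one y]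
  have inner : ∀ y, ∫ x, (1 - zz (x, y) θ φ) ^ (-(s1 + s2 + ξ)) ∂(Pm a) ≤
      C1 * Ab θ φ ^ (-s1) * (Bb θ φ - K * cos y) ^ (-(s2 + ξ)) := by
    intro y
    have hl := hlow y
    have hlt : S < 1 - cos y * K := by nlinarith [cos_le_one y]
    have := k1 (1 - cos y * K) S ss.le hlt
    have e1 : ∀ x, 1 - zz (x, y) θ φ = 1 - cos y * K - S * cos x := fun x => by
      simp only [zz, hS, hK]; ring
    simp only [e1]
    rw [show -(s1 + s2 + ξ) = -(s1 + (s2 + ξ)) by ring]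
    refine this.trans ?_
    have e2 : (1 - cos y * K) ^ (-s1) ≤ Ab θ φ ^ (-s1) :=
      rpow_le_rpow_of_nonpos hA hl (by linarith)
    have e3 : 1 - cos y * K - S = Bb θ φ - K * cos y := by unfold Bb; rw [← hS]; ring
    rw [e3, mul_assoc C1]
    have : 0 ≤ (Bb θ φ - K * cos y) ^ (-(s2 + ξ)) := by
      refine rpow_nonneg ?_ _
      rw [← e3]; linarith
    exact mul_le_mul_of_nonneg_left (mul_le_mul_of_nonneg_right e2 this) hC1.le
  have hKB : K < Bb θ φ := by unfold Bb; linarith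
  have outer := k2 (Bb θ φ) K cc'.le hKB
  calc ∫ y, ∫ x, (1 - zz (x, y) θ φ) ^ (-(s1 + s2 + ξ)) ∂(Pm a) ∂(Pm b)
      ≤ ∫ y, C1 * Ab θ φ ^ (-s1) * (Bb θ φ - K * cos y) ^ (-(s2 + ξ)) ∂(Pm b) :=
        integral_mono hintg'.integral_prod_right ((int_Pm_of hb (cont_Ab cc'.le hKB)).const_mul _) inner
    _ = C1 * Ab θ φ ^ (-s1) * ∫ y, (Bb θ φ - K * cos y) ^ (-(s2 + ξ)) ∂(Pm b) := integral_const_mul _ _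
    _ ≤ C1 * Ab θ φ ^ (-s1) * (C2 * (Bb θ φ ^ (-s2) * (Bb θ φ - K) ^ (-ξ))) :=
        mul_le_mul_of_nonneg_left outer (by positivity)
    _ = _ := by
      have : Bb θ φ - K = Qb θ φ := by rw [Qb_eq]; unfold Bb; rw [← hS]
      rw [this]; ring

end JR

namespace JR
open scoped Topology

lemma gen_le {ν : Measure (ℝ × ℝ)} [IsFiniteMeasure ν] {G : ℝ × ℝ → ℝ} {C s θ φ : ℝ} (hθ : θ ∈ Ioo 0 π)
    (hφ : φ ∈ Ioo 0 π) (h : θ ≠ φ) (hG : ∀ p, |G p| ≤ C * (1 - zz p θ φ) ^ (-s)) :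
    |∫ p, G p ∂ν| ≤ C * FF ν (fun z => (1 - z) ^ (-s)) θ φ := by
  have hintg := integrable_zz (ν := ν) (cont_q (-s)) hθ hφ h (k := fun _ => 1)
    continuous_const (by simp)
  simp only [mul_one] at hintg
  unfold FF
  rw [← integral_const_mul]
  exact norm_integral_le_of_norm_le (f := G) (hintg.const_mul C)
    (Filter.Eventually.of_forall fun p => hG p)

lemma zt_half (p : ℝ × ℝ) {θ φ : ℝ} : |zt p θ φ| ≤ √(1 - zz p θ φ) := by
  apply abs_le_sqrt
  have := zt_sq_le p θ φ
  have h1 := abs_le.1 (abs_zz_le_one p θ φ)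
  nlinarith

lemma FF_le {ν : Measure (ℝ × ℝ)} [IsFiniteMeasure ν] {f : ℝ → ℝ} {C s θ φ : ℝ} (hθ : θ ∈ Ioo 0 π)
    (hφ : φ ∈ Ioo 0 π) (h : θ ≠ φ) (hf : ∀ z < 1, -1 ≤ z → |f z| ≤ C * (1 - z) ^ (-s)) :
    |FF ν f θ φ| ≤ C * FF ν (fun z => (1 - z) ^ (-s)) θ φ :=
  gen_le hθ hφ h fun p => hf _ (zz_lt_one p hθ hφ h) (abs_le.1 (abs_zz_le_one p θ φ)).1

lemma FFt_le {ν : Measure (ℝ × ℝ)} [IsFiniteMeasure ν] {f : ℝ → ℝ} {C s θ φ : ℝ} (hθ : θ ∈ Ioo 0 π)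
    (hφ : φ ∈ Ioo 0 π) (h : θ ≠ φ) (hf : ∀ z < 1, -1 ≤ z → |f z| ≤ C * (1 - z) ^ (-(s + 1 / 2))) :
    |FFt ν f θ φ| ≤ C * FF ν (fun z => (1 - z) ^ (-s)) θ φ := by
  refine gen_le hθ hφ h fun p => ?_
  have hz := zz_lt_one p hθ hφ h
  have h1 := hf _ hz (abs_le.1 (abs_zz_le_one p θ φ)).1
  have h0 : 0 < 1 - zz p θ φ := by linarith
  rw [abs_mul]
  refine (mul_le_mul h1 (zt_half p) (abs_nonneg _) ((abs_nonneg _).trans h1)).trans (le_of_eq ?_)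
  rw [sqrt_eq_rpow, mul_assoc, ← rpow_add h0]; congr 2; ring

lemma FFs_pt {z C1 C2 s A B x y w : ℝ} (hz : z < 1) (h2 : |A| ≤ C2 * (1 - z) ^ (-(s + 1)))
    (h1 : |B| ≤ C1 * (1 - z) ^ (-s)) (hx : |x| ≤ √(1 - z)) (hy : |y| ≤ √(1 - z)) (hw : |w| ≤ 1) :
    |A * x * y + B * w| ≤ (C2 + C1) * (1 - z) ^ (-s) := by
  have h0 : 0 < 1 - z := by linarith
  refine (abs_add_le _ _).trans ?_
  rw [add_mul]
  refine add_le_add ?_ ?_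
  · rw [mul_assoc, abs_mul, abs_mul]
    have hxy : |x| * |y| ≤ 1 - z := by
      have := mul_le_mul hx hy (abs_nonneg _) (sqrt_nonneg _)
      rwa [mul_self_sqrt h0.le] at this
    refine (mul_le_mul h2 hxy (by positivity) ((abs_nonneg _).trans h2)).trans (le_of_eq ?_)
    nth_rewrite 2 [← rpow_one (1 - z)]
    rw [mul_assoc, ← rpow_add h0]; congr 2; ring
  · rw [abs_mul]
    exact (mul_le_of_le_one_right (abs_nonneg _) hw).trans h1

lemma FFtt_le {ν : Measure (ℝ × ℝ)} [IsFiniteMeasure ν] {f f2 : ℝ → ℝ} {C1 C2 s θ φ : ℝ} (hθ : θ ∈ Ioo 0 π)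
    (hφ : φ ∈ Ioo 0 π) (h : θ ≠ φ) (hf : ∀ z < 1, -1 ≤ z → |f z| ≤ C1 * (1 - z) ^ (-s))
    (hf2 : ∀ z < 1, -1 ≤ z → |f2 z| ≤ C2 * (1 - z) ^ (-(s + 1))) :
    |FFtt ν f f2 θ φ| ≤ (C2 + C1) * FF ν (fun z => (1 - z) ^ (-s)) θ φ := by
  refine gen_le hθ hφ h fun p => ?_
  have hz := zz_lt_one p hθ hφ h
  have hm := (abs_le.1 (abs_zz_le_one p θ φ)).1
  exact FFs_pt hz (hf2 _ hz hm) (hf _ hz hm) (zt_half p) (zt_half p) (abs_zz4 p θ φ)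

lemma FFtx_le {ν : Measure (ℝ × ℝ)} [IsFiniteMeasure ν] {f f2 : ℝ → ℝ} {C1 C2 s θ φ : ℝ} (hθ : θ ∈ Ioo 0 π)
    (hφ : φ ∈ Ioo 0 π) (h : θ ≠ φ) (hf : ∀ z < 1, -1 ≤ z → |f z| ≤ C1 * (1 - z) ^ (-s))
    (hf2 : ∀ z < 1, -1 ≤ z → |f2 z| ≤ C2 * (1 - z) ^ (-(s + 1))) :
    |FFtx ν f f2 θ φ| ≤ (C2 + C1) * FF ν (fun z => (1 - z) ^ (-s)) θ φ := by
  refine gen_le hθ hφ h fun p => ?_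
  have hz := zz_lt_one p hθ hφ h
  have hm := (abs_le.1 (abs_zz_le_one p θ φ)).1
  refine FFs_pt hz (hf2 _ hz hm) (hf _ hz hm) ?_ (zt_half p) (abs_zx_le_one p θ φ)
  rw [zz_symm]; exact zt_half p

def PP (a b θ φ : ℝ) : ℝ := Ab θ φ ^ (-a) * Bb θ φ ^ (-b)
def ww (θ φ : ℝ) : ℝ := √(Ab θ φ * Bb θ φ)
def qq (θ φ : ℝ) : ℝ := √(Qb θ φ)

section
variable {θ φ : ℝ} (hθ : θ ∈ Ioo 0 π) (hφ : φ ∈ Ioo 0 π) (h : θ ≠ φ)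

include hθ hφ in
lemma AB_basic : sin (θ / 2) * sin (φ / 2) ≤ Ab θ φ ∧ cos (θ / 2) * cos (φ / 2) ≤ Bb θ φ ∧
    Ab θ φ ≤ 1 ∧ Bb θ φ ≤ 1 ∧ sin (θ / 2) ^ 2 ≤ 2 * Ab θ φ ∧ cos (θ / 2) ^ 2 ≤ 2 * Bb θ φ ∧
    sin (φ / 2) ^ 2 ≤ 2 * Ab θ φ ∧ cos (φ / 2) ^ 2 ≤ 2 * Bb θ φ ∧ Ab θ φ + Bb θ φ = 1 + Qb θ φ ∧
    Qb θ φ ≤ 1 := by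
  obtain ⟨p1, p2⟩ := hpos hθ
  obtain ⟨p3, p4⟩ := hpos hφ
  have e1 := sin_sq_add_cos_sq (θ / 2)
  have e2 := sin_sq_add_cos_sq (φ / 2)
  have hS := mul_pos p1 p3
  have hK := mul_pos p2 p4
  have q0 : 0 ≤ 1 - sin (θ / 2) * sin (φ / 2) - cos (θ / 2) * cos (φ / 2) := by
    nlinarith [sq_nonneg (sin (θ / 2) - sin (φ / 2)), sq_nonneg (cos (θ / 2) - cos (φ / 2))]
  rw [Qb_eq]
  unfold Ab Bb
  refine ⟨by linarith, by linarith, by linarith, by linarith, ?_, ?_, ?_, ?_, by ring, by linarith⟩ <;>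
  nlinarith [sq_nonneg (cos (θ / 2) - cos (φ / 2)), sq_nonneg (sin (θ / 2) - sin (φ / 2)),
    mul_nonneg p2.le p4.le, sq_nonneg (cos (θ / 2)), sq_nonneg (cos (φ / 2)), sq_nonneg (sin (θ / 2)),
    sq_nonneg (sin (φ / 2))]

include hθ hφ in
lemma AB_pos : 0 < Ab θ φ ∧ 0 < Bb θ φ := by
  obtain ⟨p1, p2⟩ := hpos hθ
  obtain ⟨p3, p4⟩ := hpos hφ
  have := AB_basic hθ hφ
  exact ⟨lt_of_lt_of_le (mul_pos p1 p3) this.1, lt_of_lt_of_le (mul_pos p2 p4) this.2.1⟩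

include hθ hφ in
lemma ww_pos : 0 < ww θ φ := sqrt_pos.2 (mul_pos (AB_pos hθ hφ).1 (AB_pos hθ hφ).2)
include hθ hφ h in
lemma qq_pos : 0 < qq θ φ := sqrt_pos.2 (Qb_pos hθ hφ h)
include hθ hφ in
lemma PP_pos (a b : ℝ) : 0 < PP a b θ φ :=
  mul_pos (rpow_pos_of_pos (AB_pos hθ hφ).1 _) (rpow_pos_of_pos (AB_pos hθ hφ).2 _)

include hθ hφ in
lemma qq_le_one : qq θ φ ≤ 1 := sqrt_le_one.2 (AB_basic hθ hφ).2.2.2.2.2.2.2.2.2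

include hθ hφ h in
lemma qq_le : qq θ φ ≤ 2 * ww θ φ := by
  have hQ := Qb_pos hθ hφ h
  obtain ⟨hA, hB⟩ := AB_pos hθ hφ
  obtain ⟨a1, a2, a3, a4, a5, a6, a7, a8, a9, a10⟩ := AB_basic hθ hφ
  have e : (2 : ℝ) = √4 := by rw [show (4:ℝ) = 2 ^ 2 by norm_num, sqrt_sq (by norm_num)]
  unfold qq ww
  rw [e, ← sqrt_mul (by norm_num)]
  apply sqrt_le_sqrt
  nlinarith [mul_nonneg (sub_nonneg.2 a3) (sub_nonneg.2 a4)]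

include hθ hφ in
lemma sin_le_ww : sin θ ≤ 4 * ww θ φ ∧ sin φ ≤ 4 * ww θ φ := by
  obtain ⟨p1, p2⟩ := hpos hθ
  obtain ⟨p3, p4⟩ := hpos hφ
  obtain ⟨hA, hB⟩ := AB_pos hθ hφ
  obtain ⟨a1, a2, a3, a4, a5, a6, a7, a8, a9, a10⟩ := AB_basic hθ hφ
  have e : (4 : ℝ) = √16 := by rw [show (16:ℝ) = 4 ^ 2 by norm_num, sqrt_sq (by norm_num)]
  unfold ww
  rw [e, ← sqrt_mul (by norm_num)]
  constructor
  · apply le_sqrt_of_sq_le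
    have : sin θ = 2 * sin (θ / 2) * cos (θ / 2) := by rw [← sin_two_mul]; congr 1; ring
    rw [this]
    nlinarith [mul_le_mul a5 a6 (by positivity) (by positivity)]
  · apply le_sqrt_of_sq_le
    have : sin φ = 2 * sin (φ / 2) * cos (φ / 2) := by rw [← sin_two_mul]; congr 1; ring
    rw [this]
    nlinarith [mul_le_mul a7 a8 (by positivity) (by positivity)]

end

lemma qneg {x : ℝ} (hx : 0 < x) : x ^ (-(1 / 2) : ℝ) = (√x)⁻¹ := by
  rw [sqrt_eq_rpow, rpow_neg hx.le]

lemma E2 {a b : ℝ} (ha : 0 < a) (hb : 0 < b) : ∃ C, 0 < C ∧ ∀ θ ∈ Ioo 0 π, ∀ φ ∈ Ioo 0 π, θ ≠ φ →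
    FF (nu a b) (fun z => (1 - z) ^ (-(a + b + 1 + 1 / 2))) θ φ ≤
      C * (PP a b θ φ / (ww θ φ * qq θ φ)) := by
  obtain ⟨C, hC, k⟩ := K2 (ξ := 1 / 2) (s1 := a + 1 / 2) (s2 := b + 1 / 2) ha hb (by norm_num)
    (by linarith) le_rfl (by linarith) le_rfl
  refine ⟨C, hC, fun θ hθ φ hφ h => ?_⟩
  have := k θ hθ φ hφ h
  rw [show a + b + 1 + 1 / 2 = a + 1 / 2 + (b + 1 / 2) + 1 / 2 by ring]
  refine this.trans (le_of_eq ?_)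
  obtain ⟨hA, hB⟩ := AB_pos hθ hφ
  unfold PP ww qq
  rw [qneg (Qb_pos hθ hφ h), neg_add, neg_add, rpow_add hA, rpow_add hB, qneg hA, qneg hB, sqrt_mul hA.le]
  field_simp

lemma E3 {a b : ℝ} (ha : 0 < a) (hb : 0 < b) : ∃ C, 0 < C ∧ ∀ θ ∈ Ioo 0 π, ∀ φ ∈ Ioo 0 π, θ ≠ φ →
    FF (nu a b) (fun z => (1 - z) ^ (-(a + b + 1 + 1))) θ φ ≤
      C * (PP a b θ φ / (ww θ φ * qq θ φ ^ 2)) := by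
  obtain ⟨C, hC, k⟩ := K2 (ξ := 1) (s1 := a + 1 / 2) (s2 := b + 1 / 2) ha hb (by norm_num)
    (by linarith) le_rfl (by linarith) le_rfl
  refine ⟨C, hC, fun θ hθ φ hφ h => ?_⟩
  have := k θ hθ φ hφ h
  rw [show a + b + 1 + 1 = a + 1 / 2 + (b + 1 / 2) + 1 by ring]
  refine this.trans (le_of_eq ?_)
  obtain ⟨hA, hB⟩ := AB_pos hθ hφ
  have hQ := Qb_pos hθ hφ h
  unfold PP ww qq
  rw [sq_sqrt hQ.le, neg_add a, neg_add b, rpow_add hA, rpow_add hB, qneg hA, qneg hB, sqrt_mul hA.le,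
    rpow_neg_one]
  field_simp

lemma E1 {a b : ℝ} (ha : 0 < a) (hb : 0 < b) : ∃ C, 0 < C ∧ ∀ θ ∈ Ioo 0 π, ∀ φ ∈ Ioo 0 π, θ ≠ φ →
    FF (nu a b) (fun z => (1 - z) ^ (-(a + b + 1))) θ φ ≤
      C * (PP a b θ φ / qq θ φ) := by
  obtain ⟨C, hC, k⟩ := K2 (ξ := 1 / 2) (s1 := a + 1 / 2) (s2 := b) ha hb (by norm_num)
    (by linarith) le_rfl (by linarith) (by linarith)
  obtain ⟨C', hC', k'⟩ := K2 (ξ := 1 / 2) (s1 := a) (s2 := b + 1 / 2) ha hb (by norm_num)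
    (by linarith) (by linarith) (by linarith) le_rfl
  have hs : ∀ x : ℝ, 1 / 2 ≤ x → (√x)⁻¹ ≤ 2 := fun x hx => by
    rw [show (2:ℝ) = (1 / 2)⁻¹ by norm_num]
    apply inv_anti₀ (by norm_num)
    apply le_sqrt_of_sq_le
    linarith
  refine ⟨2 * (C + C'), by positivity, fun θ hθ φ hφ h => ?_⟩
  have k := k θ hθ φ hφ h
  have k' := k' θ hθ φ hφ h
  rw [show a + 1 / 2 + b + 1 / 2 = a + b + 1 by ring] at k
  rw [show a + (b + 1 / 2) + 1 / 2 = a + b + 1 by ring] at k'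
  obtain ⟨hA, hB⟩ := AB_pos hθ hφ
  have hQ := Qb_pos hθ hφ h
  have hab := (AB_basic hθ hφ).2.2.2.2.2.2.2.2.1
  have hq := qq_pos hθ hφ h
  have hP := PP_pos hθ hφ a b
  rw [qneg hQ, neg_add a (1 / 2), rpow_add hA, qneg hA] at k
  rw [qneg hQ, neg_add b (1 / 2), rpow_add hB, qneg hB] at k'
  have n : 0 < PP a b θ φ / qq θ φ := by positivity
  rcases le_total (1 / 2) (Ab θ φ) with hh | hh
  · have e := hs _ hh
    refine k.trans ?_
    calc _ = C * (√(Ab θ φ))⁻¹ * (PP a b θ φ / qq θ φ) := by unfold PP qq; ring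
      _ ≤ C * 2 * (PP a b θ φ / qq θ φ) := by gcongr
      _ ≤ _ := by gcongr ?_ * _; linarith
  · have e := hs (Bb θ φ) (by linarith)
    refine k'.trans ?_
    calc _ = C' * (√(Bb θ φ))⁻¹ * (PP a b θ φ / qq θ φ) := by unfold PP qq; ring
      _ ≤ C' * 2 * (PP a b θ φ / qq θ φ) := by gcongr
      _ ≤ _ := by gcongr ?_ * _; linarith

end JR

namespace JR
open scoped Topology

lemma cmp_rpow {x y K : ℝ} (e : ℝ) (hx : 0 < x) (hy : 0 < y) (hK : 1 ≤ K) (h1 : x ≤ K * y) (h2 : y ≤ K * x) :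
    x ^ e ≤ K ^ |e| * y ^ e := by
  have hK0 : 0 < K := by linarith
  rcases le_total 0 e with he | he
  · rw [abs_of_nonneg he, ← mul_rpow hK0.le hy.le]
    exact rpow_le_rpow hx.le h1 he
  · have h3 : y / K ≤ x := by rw [div_le_iff₀ hK0]; linarith
    have := rpow_le_rpow_of_nonpos (by positivity) h3 he
    rw [abs_of_nonpos he, rpow_neg hK0.le]
    rw [div_rpow hy.le hK0.le] at this
    refine this.trans (le_of_eq ?_)
    field_simp

lemma pow_diff {u v p : ℝ} (hp : 0 < p) (hu : 0 ≤ u) (huv : u ≤ v) (hv : 0 < v) :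
    (v ^ p - u ^ p) / p ≤ (1 + 1 / p) * ((v - u) * v ^ (p - 1)) := by
  have hv1 : v ^ p = v * v ^ (p - 1) := by
    nth_rewrite 2 [← rpow_one v]; rw [← rpow_add hv]; congr 1; ring
  have n : 0 < v ^ (p - 1) := rpow_pos_of_pos hv _
  have hd : 0 ≤ v - u := by linarith
  rcases le_total p 1 with h | h
  · have : u * v ^ (p - 1) ≤ u ^ p := by
      rcases hu.eq_or_lt with rfl | hu0
      · rw [zero_mul]; positivity
      · have hu1 : u ^ p = u * u ^ (p - 1) := by
          nth_rewrite 2 [← rpow_one u]; rw [← rpow_add hu0]; congr 1; ring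
        rw [hu1]
        exact mul_le_mul_of_nonneg_left (rpow_le_rpow_of_nonpos hu0 huv (by linarith)) hu
    have h3 : (v ^ p - u ^ p) ≤ (v - u) * v ^ (p - 1) := by nlinarith
    have h4 : (v ^ p - u ^ p) / p ≤ (1 / p) * ((v - u) * v ^ (p - 1)) := by
      rw [one_div, inv_mul_eq_div]; gcongr
    nlinarith [mul_nonneg hd n.le]
  · have h3 : v ^ p - u ^ p ≤ p * ((v - u) * v ^ (p - 1)) := by
      have hb := one_add_mul_self_le_rpow_one_add (s := u / v - 1) (p := p)
        (by have : 0 ≤ u / v := by positivity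
            linarith) h
      rw [show 1 + (u / v - 1) = u / v by ring, div_rpow hu hv.le, le_div_iff₀ (by positivity)] at hb
      have : (1 + p * (u / v - 1)) * v ^ p = v ^ p - p * ((v - u) * v ^ (p - 1)) := by
        rw [hv1]; field_simp; ring
      linarith
    have h4 : (v ^ p - u ^ p) / p ≤ (v - u) * v ^ (p - 1) := by
      rw [div_le_iff₀ hp]; linarith
    have : 0 ≤ 1 / p * ((v - u) * v ^ (p - 1)) := by positivity
    linarith

lemma J_int {e : ℝ} (he : -1 < e) : ∃ C, 0 < C ∧ ∀ θ D : ℝ, 0 < θ → 0 < D →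
    ∫⁻ x in Ioo (θ - D) (θ + D) ∩ Ioi 0, ENNReal.ofReal (x ^ e) ≤
      ENNReal.ofReal (C * (D * (θ + D) ^ e)) := by
  have hp : 0 < e + 1 := by linarith
  refine ⟨2 * (1 + 1 / (e + 1)), by positivity, fun θ D hθ hD => ?_⟩
  set u := max 0 (θ - D) with hu
  have hu0 : 0 ≤ u := le_max_left _ _
  have huv : u ≤ θ + D := max_le (by linarith) (by linarith)
  have hv : 0 < θ + D := by linarith
  have hd : θ + D - u ≤ 2 * D := by have := le_max_right 0 (θ - D); linarith
  have hi := intervalIntegral.intervalIntegrable_rpow' he (a := u) (b := θ + D)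
  have hi' := (intervalIntegrable_iff_integrableOn_Ioc_of_le huv).1 hi
  calc ∫⁻ x in Ioo (θ - D) (θ + D) ∩ Ioi 0, ENNReal.ofReal (x ^ e)
      ≤ ∫⁻ x in Ioc u (θ + D), ENNReal.ofReal (x ^ e) :=
        lintegral_mono_set fun x hx => ⟨max_lt hx.2 hx.1.1, hx.1.2.le⟩
    _ = ENNReal.ofReal (∫ x in Ioc u (θ + D), x ^ e) := by
        refine (ofReal_integral_eq_lintegral_ofReal hi' ?_).symm
        exact (ae_restrict_iff' measurableSet_Ioc).2 (Filter.Eventually.of_forall fun x hx =>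
          rpow_nonneg (hu0.trans hx.1.le) _)
    _ ≤ _ := by
        apply ENNReal.ofReal_le_ofReal
        rw [← intervalIntegral.integral_of_le huv, integral_rpow (Or.inl he)]
        refine (pow_diff hp hu0 huv hv).trans ?_
        rw [add_sub_cancel_right]
        have n : 0 < (θ + D) ^ e := rpow_pos_of_pos hv _
        calc _ ≤ (1 + 1 / (e + 1)) * ((2 * D) * (θ + D) ^ e) := by gcongr
          _ = _ := by ring

lemma J_int' {e : ℝ} (he : -1 < e) : ∃ C, 0 < C ∧ ∀ θ D : ℝ, θ < π → 0 < D →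
    ∫⁻ x in Ioo (θ - D) (θ + D) ∩ Iio π, ENNReal.ofReal ((π - x) ^ e) ≤
      ENNReal.ofReal (C * (D * (π - θ + D) ^ e)) := by
  obtain ⟨C, hC, h⟩ := J_int he
  refine ⟨C, hC, fun θ D hθ hD => ?_⟩
  refine le_trans (le_of_eq ?_) (h (π - θ) D (by linarith) hD)
  have := (Measure.measurePreserving_sub_left (volume : Measure ℝ) π).setLIntegral_comp_preimage
    (s := Ioo (π - θ - D) (π - θ + D) ∩ Ioi 0) (measurableSet_Ioo.inter measurableSet_Ioi)
    (f := fun x => ENNReal.ofReal (x ^ e)) (by fun_prop)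
  rw [← this]
  congr 2
  ext x
  simp only [mem_inter_iff, mem_Ioo, mem_Iio, mem_preimage, mem_Ioi]
  constructor
  · rintro ⟨⟨h1, h2⟩, h3⟩; exact ⟨⟨by linarith, by linarith⟩, by linarith⟩
  · rintro ⟨⟨h1, h2⟩, h3⟩; exact ⟨⟨by linarith, by linarith⟩, by linarith⟩

lemma jPsi_sq (α β : ℝ) {x : ℝ} (hx : x ∈ Ioo 0 π) :
    jPsi α β x ^ 2 = sin (x / 2) ^ (2 * α + 1) * cos (x / 2) ^ (2 * β + 1) := by
  obtain ⟨h1, h2⟩ := hpos hx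
  unfold jPsi
  rw [abs_of_pos h1, mul_pow, ← rpow_natCast, ← rpow_natCast, ← rpow_mul h1.le, ← rpow_mul h2.le]
  congr 2 <;> push_cast <;> ring

lemma half_sin {x : ℝ} (h0 : 0 < x) (h1 : x < π) : x ≤ π * sin (x / 2) ∧ sin (x / 2) ≤ x := by
  constructor
  · have := mul_le_sin (x := x / 2) (by linarith) (by linarith)
    calc x = π * (2 / π * (x / 2)) := by field_simp
      _ ≤ _ := mul_le_mul_of_nonneg_left this pi_pos.le
  · have := sin_le (x := x / 2) (by linarith); linarith

lemma sc_bound (e1 e2 : ℝ) {x : ℝ} (h0 : 0 < x) (h1 : x ≤ π / 2) :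
    sin (x / 2) ^ e1 * cos (x / 2) ^ e2 ≤ π ^ |e1| * 2 ^ |e2| * x ^ e1 := by
  have hx : x ∈ Ioo 0 π := ⟨h0, by linarith [pi_pos]⟩
  obtain ⟨p1, p2⟩ := hpos hx
  obtain ⟨q1, q2⟩ := half_sin h0 hx.2
  have hp3 := pi_gt_three
  have a1 := cmp_rpow (K := π) e1 p1 h0 (by linarith) (by nlinarith) q1
  have c1 : 1 / 2 ≤ cos (x / 2) := by
    have := one_sub_mul_le_cos (x := x / 2) (by linarith) (by linarith)
    have e : 2 / π * (x / 2) ≤ 2 / π * (π / 4) :=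
      mul_le_mul_of_nonneg_left (by linarith) (by positivity)
    have e' : 2 / π * (π / 4) = 1 / 2 := by field_simp; norm_num
    linarith
  have a2 := cmp_rpow (K := 2) e2 p2 one_pos (by norm_num) (by linarith [cos_le_one (x / 2)]) (by linarith)
  rw [one_rpow, mul_one] at a2
  calc _ ≤ (π ^ |e1| * x ^ e1) * 2 ^ |e2| := mul_le_mul a1 a2 (by positivity) (by positivity)
    _ = _ := by ring

lemma ball_eq (α β θ r : ℝ) : ballMeasure α β θ r =
    ∫⁻ x in Ioo (θ - r) (θ + r) ∩ Ioo 0 π,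
      ENNReal.ofReal (sin (x / 2) ^ (2 * α + 1) * cos (x / 2) ^ (2 * β + 1)) := by
  unfold ballMeasure jacobiMeasurePlus jacobiMeasure
  rw [Measure.restrict_apply measurableSet_Ioo,
    withDensity_apply _ (measurableSet_Ioo.inter measurableSet_Ioo),
    Measure.restrict_restrict (measurableSet_Ioo.inter measurableSet_Ioo)]
  have : Ioo (θ - r) (θ + r) ∩ Ioo 0 π ∩ Ioo (-π) π = Ioo (θ - r) (θ + r) ∩ Ioo 0 π := by
    ext x; simp only [mem_inter_iff, mem_Ioo]
    constructor
    · exact fun h => h.1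
    · exact fun h => ⟨h, by linarith [h.2.1, pi_pos], h.2.2⟩
  rw [this]
  refine setLIntegral_congr_fun (measurableSet_Ioo.inter measurableSet_Ioo) fun x hx => ?_
  beta_reduce
  rw [jPsi_sq α β hx.2]

lemma D_le_qq {θ φ : ℝ} (hθ : θ ∈ Ioo 0 π) (hφ : φ ∈ Ioo 0 π) : |θ - φ| ≤ 2 * π * qq θ φ := by
  have h1 : |(θ - φ) / 2| ≤ π := by
    rw [abs_le]; constructor <;> linarith [hθ.1, hθ.2, hφ.1, hφ.2]
  have h2 := cos_le_one_sub_mul_cos_sq h1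
  have h3 : ((θ - φ) / (2 * π)) ^ 2 ≤ Qb θ φ := by
    unfold Qb
    have : 2 / π ^ 2 * ((θ - φ) / 2) ^ 2 = 2 * ((θ - φ) / (2 * π)) ^ 2 := by field_simp
    nlinarith [sq_nonneg ((θ - φ) / (2 * π))]
  have h4 := abs_le_sqrt h3
  rw [abs_div, abs_of_pos (by positivity : 0 < 2 * π), div_le_iff₀ (by positivity)] at h4
  unfold qq; linarith

lemma half_cos_low {x : ℝ} (h0 : 0 < x) (h1 : x ≤ 3 * π / 4) : 1 / 4 ≤ cos (x / 2) := by
  have := one_sub_mul_le_cos (x := x / 2) (by linarith) (by linarith [pi_pos])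
  have e : 2 / π * (x / 2) ≤ 2 / π * (3 * π / 8) :=
    mul_le_mul_of_nonneg_left (by linarith) (by positivity)
  have e' : 2 / π * (3 * π / 8) = 3 / 4 := by field_simp; norm_num
  linarith

lemma core (e1 e2 : ℝ) : ∃ C, 0 < C ∧ ∀ θ ∈ Ioo 0 π, ∀ φ ∈ Ioo 0 π, θ ≠ φ →
    θ - |θ - φ| ≤ π / 2 → |θ - φ| * (θ + |θ - φ|) ^ (2 * e1) ≤
      C * (qq θ φ * (Ab θ φ ^ e1 * Bb θ φ ^ e2)) := by
  refine ⟨2 * π * ((4 * π) ^ |2 * e1| * 32 ^ |(-e2)|), by positivity, fun θ hθ φ hφ h hc => ?_⟩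
  obtain ⟨hA, hB⟩ := AB_pos hθ hφ
  obtain ⟨a1, a2, a3, a4, a5, a6, a7, a8, a9, a10⟩ := AB_basic hθ hφ
  obtain ⟨p1, p2⟩ := hpos hθ
  obtain ⟨p3, p4⟩ := hpos hφ
  have hD : 0 < |θ - φ| := abs_pos.2 (sub_ne_zero.2 h)
  have hθ0 := hθ.1
  have hφ0 := hφ.1
  have hsA : 0 < √(Ab θ φ) := sqrt_pos.2 hA
  have s1 : sin (θ / 2) ≤ 2 * √(Ab θ φ) := by
    have : sin (θ / 2) ≤ √(4 * Ab θ φ) := le_sqrt_of_sq_le (by linarith)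
    rwa [sqrt_mul (by norm_num), show (4:ℝ) = 2 ^ 2 by norm_num, sqrt_sq (by norm_num)] at this
  have s2 : sin (φ / 2) ≤ 2 * √(Ab θ φ) := by
    have : sin (φ / 2) ≤ √(4 * Ab θ φ) := le_sqrt_of_sq_le (by linarith)
    rwa [sqrt_mul (by norm_num), show (4:ℝ) = 2 ^ 2 by norm_num, sqrt_sq (by norm_num)] at this
  have t1 := (half_sin hθ.1 hθ.2).1
  have t2 := (half_sin hφ.1 hφ.2).1
  have u1 : θ ≤ 2 * π * √(Ab θ φ) := by nlinarith [pi_pos]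
  have u2 : φ ≤ 2 * π * √(Ab θ φ) := by nlinarith [pi_pos]
  have v1 : θ + |θ - φ| ≤ 4 * π * √(Ab θ φ) := by
    rcases abs_cases (θ - φ) with ⟨e, _⟩ | ⟨e, _⟩ <;> rw [e] <;> linarith
  have v2 : √(Ab θ φ) ≤ θ + |θ - φ| := by
    rw [sqrt_le_left (by linarith)]
    have w1 := one_sub_sq_div_two_le_cos (x := θ / 2)
    have w2 := one_sub_sq_div_two_le_cos (x := φ / 2)
    have w3 : φ ≤ θ + |θ - φ| := by linarith [neg_abs_le (θ - φ)]
    have w4 : φ ^ 2 ≤ (θ + |θ - φ|) ^ 2 := by gcongr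
    have w5 : θ ^ 2 ≤ (θ + |θ - φ|) ^ 2 := by gcongr; linarith
    unfold Ab
    nlinarith [mul_nonneg (sub_nonneg.2 (cos_le_one (θ / 2))) (sub_nonneg.2 (cos_le_one (φ / 2)))]
  have v3 := cmp_rpow (K := 4 * π) (2 * e1) (by linarith : 0 < θ + |θ - φ|) hsA
    (by linarith [pi_gt_three]) v1 (by nlinarith [pi_gt_three])
  have v4 : √(Ab θ φ) ^ (2 * e1) = Ab θ φ ^ e1 := by
    rw [sqrt_eq_rpow, ← rpow_mul hA.le]; congr 1; ring
  rw [v4] at v3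
  have hBl : 1 / 32 ≤ Bb θ φ := by
    rcases abs_cases (θ - φ) with ⟨e, _⟩ | ⟨e, _⟩
    · have := half_cos_low hφ.1 (by linarith [pi_pos])
      nlinarith
    · have := half_cos_low hθ.1 (by linarith [pi_pos, hφ.2])
      nlinarith
  have v5 := cmp_rpow (K := 32) (-e2) hB one_pos (by norm_num) (by linarith) (by linarith)
  rw [one_rpow, mul_one, rpow_neg hB.le] at v5
  have v6 : 1 ≤ 32 ^ |(-e2)| * Bb θ φ ^ e2 := by
    have hpB := rpow_pos_of_pos hB e2
    calc 1 = (Bb θ φ ^ e2)⁻¹ * Bb θ φ ^ e2 := by field_simp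
      _ ≤ _ := by gcongr
  have v7 := D_le_qq hθ hφ
  have hq := qq_pos hθ hφ h
  have nA := rpow_pos_of_pos hA e1
  calc |θ - φ| * (θ + |θ - φ|) ^ (2 * e1)
      ≤ (2 * π * qq θ φ) * ((4 * π) ^ |2 * e1| * Ab θ φ ^ e1) :=
        mul_le_mul v7 v3 (by positivity) (by positivity)
    _ = ((2 * π * qq θ φ) * ((4 * π) ^ |2 * e1| * Ab θ φ ^ e1)) * 1 := by ring
    _ ≤ ((2 * π * qq θ φ) * ((4 * π) ^ |2 * e1| * Ab θ φ ^ e1)) * (32 ^ |(-e2)| * Bb θ φ ^ e2) := by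
        gcongr
    _ = _ := by ring

lemma refl_AB (θ φ : ℝ) : Ab (π - θ) (π - φ) = Bb θ φ ∧ Bb (π - θ) (π - φ) = Ab θ φ ∧
    qq (π - θ) (π - φ) = qq θ φ := by
  have e : ∀ x : ℝ, (π - x) / 2 = π / 2 - x / 2 := fun x => by ring
  refine ⟨?_, ?_, ?_⟩
  · unfold Ab Bb; rw [e, e, cos_pi_div_two_sub, cos_pi_div_two_sub]
  · unfold Ab Bb; rw [e, e, sin_pi_div_two_sub, sin_pi_div_two_sub]
  · unfold qq Qb; rw [← cos_neg]; congr 3; ring_nf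

lemma ball_le {α β : ℝ} (hα : -1 < α) (hβ : -1 < β) : ∃ C, 0 < C ∧ ∀ θ ∈ Ioo 0 π, ∀ φ ∈ Ioo 0 π, θ ≠ φ →
    ballMeasure α β θ |θ - φ| ≤
      ENNReal.ofReal (C * (qq θ φ * (Ab θ φ ^ (α + 1 / 2) * Bb θ φ ^ (β + 1 / 2)))) := by
  obtain ⟨C1, hC1, j1⟩ := J_int (e := 2 * α + 1) (by linarith)
  obtain ⟨C2, hC2, j2⟩ := J_int' (e := 2 * β + 1) (by linarith)
  obtain ⟨C3, hC3, c1⟩ := core (α + 1 / 2) (β + 1 / 2)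
  obtain ⟨C4, hC4, c2⟩ := core (β + 1 / 2) (α + 1 / 2)
  set M1 : ℝ := π ^ |2 * α + 1| * 2 ^ |2 * β + 1| with hM1
  set M2 : ℝ := π ^ |2 * β + 1| * 2 ^ |2 * α + 1| with hM2
  have hM10 : 0 < M1 := by positivity
  have hM20 : 0 < M2 := by positivity
  refine ⟨M1 * (C1 * C3) + M2 * (C2 * C4), by positivity, fun θ hθ φ hφ h => ?_⟩
  have hD : 0 < |θ - φ| := abs_pos.2 (sub_ne_zero.2 h)
  set D := |θ - φ| with hDd
  obtain ⟨hA, hB⟩ := AB_pos hθ hφ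
  have hq := qq_pos hθ hφ h
  set T := qq θ φ * (Ab θ φ ^ (α + 1 / 2) * Bb θ φ ^ (β + 1 / 2)) with hT
  have hT0 : 0 < T := by positivity
  have I1 : ∫⁻ x in Ioo (θ - D) (θ + D) ∩ Ioc 0 (π / 2),
      ENNReal.ofReal (sin (x / 2) ^ (2 * α + 1) * cos (x / 2) ^ (2 * β + 1)) ≤
      ENNReal.ofReal (M1 * (C1 * C3) * T) := by
    by_cases hc : θ - D ≤ π / 2
    · calc _ ≤ ∫⁻ x in Ioo (θ - D) (θ + D) ∩ Ioc 0 (π / 2),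
            ENNReal.ofReal M1 * ENNReal.ofReal (x ^ (2 * α + 1)) := by
            refine setLIntegral_mono' (measurableSet_Ioo.inter measurableSet_Ioc) fun x hx => ?_
            rw [← ENNReal.ofReal_mul hM10.le]
            exact ENNReal.ofReal_le_ofReal (sc_bound _ _ hx.2.1 hx.2.2)
        _ = ENNReal.ofReal M1 * ∫⁻ x in Ioo (θ - D) (θ + D) ∩ Ioc 0 (π / 2),
            ENNReal.ofReal (x ^ (2 * α + 1)) := lintegral_const_mul _ (by fun_prop)
        _ ≤ ENNReal.ofReal M1 * ∫⁻ x in Ioo (θ - D) (θ + D) ∩ Ioi 0,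
            ENNReal.ofReal (x ^ (2 * α + 1)) := by
            gcongr; exact fun x hx => hx.1
        _ ≤ ENNReal.ofReal M1 * ENNReal.ofReal (C1 * (D * (θ + D) ^ (2 * α + 1))) := by
            gcongr; exact j1 θ D hθ.1 hD
        _ ≤ _ := by
            rw [← ENNReal.ofReal_mul hM10.le]
            apply ENNReal.ofReal_le_ofReal
            have := c1 θ hθ φ hφ h hc
            rw [show 2 * (α + 1 / 2) = 2 * α + 1 by ring] at this
            calc M1 * (C1 * (D * (θ + D) ^ (2 * α + 1))) ≤ M1 * (C1 * (C3 * T)) := by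
                  exact mul_le_mul_of_nonneg_left (mul_le_mul_of_nonneg_left this hC1.le) hM10.le
              _ = _ := by ring
    · have : Ioo (θ - D) (θ + D) ∩ Ioc 0 (π / 2) = ∅ := by
        ext x; simp only [mem_inter_iff, mem_Ioo, mem_Ioc, mem_empty_iff_false, iff_false]
        rintro ⟨⟨h1, _⟩, _, h2⟩; linarith
      rw [this]; simp
  have I2 : ∫⁻ x in Ioo (θ - D) (θ + D) ∩ Ico (π / 2) π,
      ENNReal.ofReal (sin (x / 2) ^ (2 * α + 1) * cos (x / 2) ^ (2 * β + 1)) ≤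
      ENNReal.ofReal (M2 * (C2 * C4) * T) := by
    by_cases hc : π - θ - D ≤ π / 2
    · calc _ ≤ ∫⁻ x in Ioo (θ - D) (θ + D) ∩ Ico (π / 2) π,
            ENNReal.ofReal M2 * ENNReal.ofReal ((π - x) ^ (2 * β + 1)) := by
            refine setLIntegral_mono' (measurableSet_Ioo.inter measurableSet_Ico) fun x hx => ?_
            rw [← ENNReal.ofReal_mul hM20.le]
            refine ENNReal.ofReal_le_ofReal ?_
            have := sc_bound (2 * β + 1) (2 * α + 1) (x := π - x) (by linarith [hx.2.2])
              (by linarith [hx.2.1])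
            rw [show (π - x) / 2 = π / 2 - x / 2 by ring, sin_pi_div_two_sub, cos_pi_div_two_sub] at this
            rw [mul_comm]; exact this
        _ = ENNReal.ofReal M2 * ∫⁻ x in Ioo (θ - D) (θ + D) ∩ Ico (π / 2) π,
            ENNReal.ofReal ((π - x) ^ (2 * β + 1)) := lintegral_const_mul _ (by fun_prop)
        _ ≤ ENNReal.ofReal M2 * ∫⁻ x in Ioo (θ - D) (θ + D) ∩ Iio π,
            ENNReal.ofReal ((π - x) ^ (2 * β + 1)) := by
            gcongr; exact fun x hx => hx.2
        _ ≤ ENNReal.ofReal M2 * ENNReal.ofReal (C2 * (D * (π - θ + D) ^ (2 * β + 1))) := by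
            gcongr; exact j2 θ D hθ.2 hD
        _ ≤ _ := by
            rw [← ENNReal.ofReal_mul hM20.le]
            apply ENNReal.ofReal_le_ofReal
            have e : |π - θ - (π - φ)| = D := by
              rw [hDd, abs_sub_comm θ φ]; congr 1; ring
            have := c2 (π - θ) ⟨by linarith [hθ.2], by linarith [hθ.1]⟩ (π - φ)
              ⟨by linarith [hφ.2], by linarith [hφ.1]⟩ (fun h' => h (by linarith)) (by rw [e]; exact hc)
            obtain ⟨r1, r2, r3⟩ := refl_AB θ φ
            rw [e, r1, r2, r3, show 2 * (β + 1 / 2) = 2 * β + 1 by ring,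
              mul_comm (Bb θ φ ^ (β + 1 / 2))] at this
            calc M2 * (C2 * (D * (π - θ + D) ^ (2 * β + 1))) ≤ M2 * (C2 * (C4 * T)) := by
                  exact mul_le_mul_of_nonneg_left (mul_le_mul_of_nonneg_left this hC2.le) hM20.le
              _ = _ := by ring
    · have : Ioo (θ - D) (θ + D) ∩ Ico (π / 2) π = ∅ := by
        ext x; simp only [mem_inter_iff, mem_Ioo, mem_Ico, mem_empty_iff_false, iff_false]
        rintro ⟨⟨_, h1⟩, h2, _⟩; linarith
      rw [this]; simp
  rw [ball_eq, add_mul, ENNReal.ofReal_add (by positivity) (by positivity)]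
  refine le_trans ?_ (add_le_add I1 I2)
  refine le_trans (lintegral_mono_set ?_) (lintegral_union_le _ _ _)
  intro x hx
  rcases le_total x (π / 2) with h1 | h1
  · exact Or.inl ⟨hx.1, hx.2.1, h1⟩
  · exact Or.inr ⟨hx.1, h1, hx.2.2⟩

lemma ball_pos (α β : ℝ) {θ r : ℝ} (hθ : θ ∈ Ioo 0 π) (hr : 0 < r) : 0 < ballMeasure α β θ r := by
  rw [ball_eq]
  have hm : MeasurableSet (Ioo (θ - r) (θ + r) ∩ Ioo 0 π) := measurableSet_Ioo.inter measurableSet_Ioo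
  rw [setLIntegral_pos_iff (by fun_prop)]
  have hsub : Ioo (θ - r) (θ + r) ∩ Ioo 0 π ⊆ Function.support (fun x : ℝ =>
      ENNReal.ofReal (sin (x / 2) ^ (2 * α + 1) * cos (x / 2) ^ (2 * β + 1))) := by
    intro x hx
    obtain ⟨p1, p2⟩ := hpos hx.2
    have : 0 < sin (x / 2) ^ (2 * α + 1) * cos (x / 2) ^ (2 * β + 1) := by positivity
    exact (ENNReal.ofReal_pos.2 this).ne'
  rw [inter_eq_self_of_subset_right hsub]
  exact (isOpen_Ioo.inter isOpen_Ioo).measure_pos volume ⟨θ, ⟨by linarith, by linarith⟩, hθ⟩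

/-- Final form of the measure estimate. -/
lemma ball_final {α β : ℝ} (hα : -1 < α) (hβ : -1 < β) : ∃ C, 0 < C ∧ ∀ θ ∈ Ioo 0 π, ∀ φ ∈ Ioo 0 π, θ ≠ φ →
    PP (α + 1) (β + 1) θ φ * ww θ φ / qq θ φ ≤ C / (ballMeasure α β θ |θ - φ|).toReal ∧
    PP (α + 1) (β + 1) θ φ * ww θ φ / qq θ φ ^ 2 ≤
      C / (|θ - φ| * (ballMeasure α β θ |θ - φ|).toReal) := by
  obtain ⟨C, hC, h⟩ := ball_le hα hβ
  have h7 : 1 ≤ 2 * π := by linarith [pi_gt_three]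
  refine ⟨2 * π * C, by positivity, fun θ hθ φ hφ hne => ?_⟩
  have hb := h θ hθ φ hφ hne
  have hD : 0 < |θ - φ| := abs_pos.2 (sub_ne_zero.2 hne)
  have hp := ball_pos α β hθ hD
  obtain ⟨hA, hB⟩ := AB_pos hθ hφ
  have hq := qq_pos hθ hφ hne
  have hw := ww_pos hθ hφ
  have hP := PP_pos hθ hφ (α + 1) (β + 1)
  have hfin : ballMeasure α β θ |θ - φ| ≠ ⊤ := ne_top_of_le_ne_top ENNReal.ofReal_ne_top hb
  have hpos' := ENNReal.toReal_pos hp.ne' hfin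
  have hle := ENNReal.toReal_le_of_le_ofReal (by positivity) hb
  set m := (ballMeasure α β θ |θ - φ|).toReal
  have key : Ab θ φ ^ (α + 1 / 2) * Bb θ φ ^ (β + 1 / 2) * (PP (α + 1) (β + 1) θ φ * ww θ φ) = 1 := by
    unfold PP ww
    rw [sqrt_mul hA.le, sqrt_eq_rpow, sqrt_eq_rpow]
    calc _ = (Ab θ φ ^ (α + 1 / 2) * Ab θ φ ^ (-(α + 1)) * Ab θ φ ^ (1 / 2 : ℝ)) *
          (Bb θ φ ^ (β + 1 / 2) * Bb θ φ ^ (-(β + 1)) * Bb θ φ ^ (1 / 2 : ℝ)) := by ring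
      _ = 1 := by
        rw [← rpow_add hA, ← rpow_add hA, ← rpow_add hB, ← rpow_add hB]
        ring_nf; simp
  have hPw : 0 < PP (α + 1) (β + 1) θ φ * ww θ φ := by positivity
  have hm : m * (PP (α + 1) (β + 1) θ φ * ww θ φ) ≤ C * qq θ φ := by
    calc _ ≤ C * (qq θ φ * (Ab θ φ ^ (α + 1 / 2) * Bb θ φ ^ (β + 1 / 2))) *
          (PP (α + 1) (β + 1) θ φ * ww θ φ) := mul_le_mul_of_nonneg_right hle hPw.le
      _ = C * qq θ φ * (Ab θ φ ^ (α + 1 / 2) * Bb θ φ ^ (β + 1 / 2) * (PP (α + 1) (β + 1) θ φ * ww θ φ)) := by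
        ring
      _ = _ := by rw [key, mul_one]
  have hCq : 0 < C * qq θ φ := by positivity
  constructor
  · rw [div_le_div_iff₀ hq hpos']
    nlinarith
  · rw [div_le_div_iff₀ (by positivity) (by positivity)]
    have := D_le_qq hθ hφ
    calc _ = |θ - φ| * (m * (PP (α + 1) (β + 1) θ φ * ww θ φ)) := by ring
      _ ≤ (2 * π * qq θ φ) * (C * qq θ φ) := mul_le_mul this hm (by positivity) (by positivity)
      _ = _ := by ring

end JR

namespace JR
open scoped Topology

lemma alg {P w q s t : ℝ} (hP : 0 < P) (hw : 0 < w) (hq : 0 < q) (hq1 : q ≤ 1) (hqw : q ≤ 2 * w)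
    (hs0 : 0 ≤ s) (hs : s ≤ 4 * w) (ht0 : 0 ≤ t) (ht : t ≤ 4 * w) :
    s * t * (P / (w * q)) ≤ 16 * (P * w / q) ∧ s * (P / (w * q)) ≤ 8 * (P * w / q ^ 2) ∧
    P / q ≤ 2 * (P * w / q ^ 2) ∧ s * t * (P / (w * q ^ 2)) ≤ 16 * (P * w / q ^ 2) ∧
    s * (P / q) ≤ 4 * (P * w / q) := by
  have hst : s * t ≤ 16 * w ^ 2 := by
    have := mul_le_mul hs ht ht0 (by positivity); nlinarith
  have e3 : P / q ≤ 2 * (P * w / q ^ 2) := by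
    calc P / q = P * q / q ^ 2 := by field_simp
      _ ≤ P * (2 * w) / q ^ 2 := by gcongr
      _ = _ := by ring
  refine ⟨?_, ?_, e3, ?_, ?_⟩
  · calc s * t * (P / (w * q)) ≤ 16 * w ^ 2 * (P / (w * q)) := by gcongr
      _ = _ := by field_simp
  · calc s * (P / (w * q)) ≤ 4 * w * (P / (w * q)) := by gcongr
      _ = 4 * (P / q) := by field_simp
      _ ≤ _ := by linarith
  · calc s * t * (P / (w * q ^ 2)) ≤ 16 * w ^ 2 * (P / (w * q ^ 2)) := by gcongr
      _ = _ := by field_simp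
  · calc s * (P / q) ≤ 4 * w * (P / q) := by gcongr
      _ = _ := by ring

lemma abs_mm_le (α β θ : ℝ) : |mm α β θ| ≤ 1 + 2 * |α + 1 / 2| + 2 * |β + 1 / 2| := by
  have h1 := neg_one_le_cos θ
  have h2 := cos_le_one θ
  unfold mm
  refine (abs_sub _ _).trans ?_
  refine add_le_add ((abs_add_le _ _).trans (add_le_add (abs_le.2 ⟨h1, h2⟩) ?_)) ?_
  · rw [abs_mul, abs_of_nonneg (by linarith : 0 ≤ 1 + cos θ), mul_comm]; gcongr; linarith
  · rw [abs_mul, abs_of_nonneg (by linarith : 0 ≤ 1 - cos θ), mul_comm]; gcongr; linarith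

def SZ (α β θ φ : ℝ) : ℝ := PP (α + 1) (β + 1) θ φ * ww θ φ / qq θ φ
def GR (α β θ φ : ℝ) : ℝ := PP (α + 1) (β + 1) θ φ * ww θ φ / qq θ φ ^ 2

lemma mul_abs_le {A y K X Y c : ℝ} (hA : 0 ≤ A) (hK : 0 ≤ K) (hy : |y| ≤ K * X) (hX : A * X ≤ c * Y) :
    A * |y| ≤ K * c * Y := by
  calc A * |y| ≤ A * (K * X) := by gcongr
    _ = K * (A * X) := by ring
    _ ≤ K * (c * Y) := by gcongr
    _ = _ := by ring

lemma even_est {α β : ℝ} (hα : -1 < α) (hβ : -1 < β) (k : ℕ) : ∃ C, 0 < C ∧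
    ∀ θ ∈ Ioo 0 π, ∀ φ ∈ Ioo 0 π, θ ≠ φ →
      |rieszKer α β (2 * (k + 1)) θ φ| ≤ C * SZ α β θ φ ∧
      |deriv (fun θ' => rieszKer α β (2 * (k + 1)) θ' φ) θ| +
        |deriv (fun φ' => rieszKer α β (2 * (k + 1)) θ φ') φ| ≤ C * GR α β θ φ := by
  have ha : 0 < α + 1 := by linarith
  have hb : 0 < β + 1 := by linarith
  have hl : 1 < α + β + 3 := by linarith
  have := isFinite_nu ha hb
  obtain ⟨g, hg, hrep⟩ := rieszKer_even hα hβ k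
  obtain ⟨g1, hg1, hd1⟩ := hg.deriv
  set ν := nu (α + 1) (β + 1) with hν
  set c := 1 / Real.Gamma ((2 * (k + 1) : ℕ) : ℝ) * C0 α β with hc
  set L : ℝ := α + 1 + (β + 1) + 1 with hL
  obtain ⟨B0, hB0, b0⟩ := rho_bound hl hg (2 * k + 1) (e := k + 1 / 2) (s := L + 1 / 2) (by positivity)
    (by push_cast; linarith) (by push_cast; linarith) (by push_cast; linarith) (by push_cast; linarith)
  obtain ⟨B1, hB1, b1⟩ := rho_bound hl hg1 (2 * k + 1) (e := k + 1 / 2) (s := L + 1 + 1 / 2) (by positivity)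
    (by push_cast; linarith) (by push_cast; linarith) (by push_cast; linarith) (by push_cast; linarith)
  obtain ⟨D2, hD2, d2⟩ := E2 ha hb
  obtain ⟨D3, hD3, d3⟩ := E3 ha hb
  have hr1 : ∀ z < 1, HasDerivAt (rho (2 * k + 1) g) (rho (2 * k + 1) g1 z) z :=
    fun z hz => rho_deriv hl hg _ hg1 hd1 hz
  have hr1c := rho_cont hl hg1 (2 * k + 1)
  refine ⟨|c| * (B0 * D2 * 16 + (B0 * D2 * 8 + B1 * D3 * 16) + (B0 * D2 * 8 + B1 * D3 * 16)) + 1,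
    by positivity, fun θ hθ φ hφ h => ?_⟩
  have hP := PP_pos hθ hφ (α + 1) (β + 1)
  have hw := ww_pos hθ hφ
  have hq := qq_pos hθ hφ h
  have sθ : 0 < sin θ := sin_pos_of_mem_Ioo hθ
  have sφ : 0 < sin φ := sin_pos_of_mem_Ioo hφ
  obtain ⟨w1, w2⟩ := sin_le_ww hθ hφ
  obtain ⟨l1, l2, l3, l4, l5⟩ := alg hP hw hq (qq_le_one hθ hφ) (qq_le hθ hφ h) sφ.le w2 sθ.le w1
  obtain ⟨l1', l2', -⟩ := alg hP hw hq (qq_le_one hθ hφ) (qq_le hθ hφ h) sθ.le w1 sφ.le w2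
  have hS : 0 < SZ α β θ φ := by unfold SZ; positivity
  have hG : 0 < GR α β θ φ := by unfold GR; positivity
  have F0 : |FF ν (rho (2 * k + 1) g) θ φ| ≤ B0 * D2 * _ :=
    ((FF_le hθ hφ h b0).trans (mul_le_mul_of_nonneg_left (d2 θ hθ φ hφ h) hB0.le)).trans
      (le_of_eq (mul_assoc _ _ _).symm)
  have F1 : |FFt ν (rho (2 * k + 1) g1) θ φ| ≤ B1 * D3 * _ :=
    ((FFt_le hθ hφ h b1).trans (mul_le_mul_of_nonneg_left (d3 θ hθ φ hφ h) hB1.le)).trans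
      (le_of_eq (mul_assoc _ _ _).symm)
  have F1' : |FFt ν (rho (2 * k + 1) g1) φ θ| ≤ B1 * D3 * _ :=
    ((FFt_le hφ hθ h.symm b1).trans (mul_le_mul_of_nonneg_left (by rw [FF_symm]; exact d3 θ hθ φ hφ h)
      hB1.le)).trans (le_of_eq (mul_assoc _ _ _).symm)
  have m0 := mul_abs_le (by positivity) (by positivity) F0 l1
  have m1 := mul_abs_le sφ.le (by positivity) F0 l2
  have m1' := mul_abs_le sθ.le (by positivity) F0 l2'
  have m2 := mul_abs_le (by positivity) (by positivity) F1 l4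
  have m2' := mul_abs_le (by positivity) (by positivity) F1' l4
  change _ ≤ _ * SZ α β θ φ at m0
  change _ ≤ _ * GR α β θ φ at m1 m1' m2 m2'
  have cc := abs_nonneg c
  have cθ := abs_cos_le_one θ
  have cφ := abs_cos_le_one φ
  constructor
  · rw [hrep θ hθ φ hφ h, abs_mul c, abs_mul (sin φ), abs_mul (sin θ), abs_of_pos sθ, abs_of_pos sφ, ← mul_assoc (sin φ)]
    refine (mul_le_mul_of_nonneg_left m0 cc).trans ?_
    rw [← mul_assoc]
    apply mul_le_mul_of_nonneg_right _ hS.le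
    have : 0 ≤ |c| * (B0 * D2 * 8 + B1 * D3 * 16) := by positivity
    nlinarith
  · have dθ := (((hasDerivAt_sin θ).mul (hasDerivAt_FF (ν := ν) hr1 hr1c hθ hφ h)).const_mul (sin φ)).const_mul c
    have dθ' : HasDerivAt (fun θ' => rieszKer α β (2 * (k + 1)) θ' φ) _ θ := dθ.congr_of_eventuallyEq (by
      filter_upwards [mem_open hθ h] with x hx using hrep x hx.1 φ hφ hx.2)
    have dφ := ((hasDerivAt_sin φ).mul ((hasDerivAt_FF' (ν := ν) hr1 hr1c hθ hφ h).const_mul (sin θ))).const_mul c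
    have dφ' : HasDerivAt (fun φ' => rieszKer α β (2 * (k + 1)) θ φ') _ φ := dφ.congr_of_eventuallyEq (by
      filter_upwards [mem_open hφ h.symm] with x hx using hrep θ hθ x hx.1 hx.2.symm)
    rw [dθ'.deriv, dφ'.deriv]
    have n1 : |c * (sin φ * (cos θ * FF ν (rho (2 * k + 1) g) θ φ + sin θ * FFt ν (rho (2 * k + 1) g1) θ φ))|
        ≤ |c| * ((B0 * D2 * 8 + B1 * D3 * 16) * GR α β θ φ) := by
      rw [abs_mul c]
      refine mul_le_mul_of_nonneg_left ?_ cc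
      rw [mul_add]
      refine (abs_add_le _ _).trans ?_
      rw [add_mul]
      refine add_le_add ?_ ?_
      · rw [abs_mul, abs_mul, abs_of_pos sφ]
        refine le_trans ?_ m1
        exact mul_le_mul_of_nonneg_left (mul_le_of_le_one_left (abs_nonneg _) cθ) sφ.le
      · rw [abs_mul, abs_mul, abs_of_pos sφ, abs_of_pos sθ, ← mul_assoc]; exact m2
    have n2 : |c * (cos φ * (sin θ * FF ν (rho (2 * k + 1) g) θ φ) +
        sin φ * (sin θ * FFt ν (rho (2 * k + 1) g1) φ θ))|
        ≤ |c| * ((B0 * D2 * 8 + B1 * D3 * 16) * GR α β θ φ) := by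
      rw [abs_mul c]
      refine mul_le_mul_of_nonneg_left ?_ cc
      refine (abs_add_le _ _).trans ?_
      rw [add_mul]
      refine add_le_add ?_ ?_
      · rw [abs_mul, abs_mul, abs_of_pos sθ]
        refine le_trans ?_ m1'
        exact mul_le_of_le_one_left (by positivity) cφ
      · rw [abs_mul, abs_mul, abs_of_pos sφ, abs_of_pos sθ, ← mul_assoc]; exact m2'
    refine (add_le_add n1 n2).trans ?_
    have : 0 ≤ |c| * (B0 * D2 * 16) * GR α β θ φ := by positivity
    nlinarith

set_option maxHeartbeats 1600000 in
lemma odd_est {α β : ℝ} (hα : -1 < α) (hβ : -1 < β) (k : ℕ) : ∃ C, 0 < C ∧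
    ∀ θ ∈ Ioo 0 π, ∀ φ ∈ Ioo 0 π, θ ≠ φ →
      |rieszKer α β (2 * k + 1) θ φ| ≤ C * SZ α β θ φ ∧
      |deriv (fun θ' => rieszKer α β (2 * k + 1) θ' φ) θ| +
        |deriv (fun φ' => rieszKer α β (2 * k + 1) θ φ') φ| ≤ C * GR α β θ φ := by
  have ha : 0 < α + 1 := by linarith
  have hb : 0 < β + 1 := by linarith
  have hl : 1 < α + β + 3 := by linarith
  have := isFinite_nu ha hb
  obtain ⟨g, hg, hrep⟩ := rieszKer_odd hα hβ k
  obtain ⟨g1, hg1, hd1⟩ := hg.deriv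
  obtain ⟨g2, hg2, hd2⟩ := hg1.deriv
  have hrep := hrep g1 hg1 hd1
  set ν := nu (α + 1) (β + 1) with hν
  set c := -(1 / Real.Gamma ((2 * k + 1 : ℕ) : ℝ) * C0 α β) with hc
  set L : ℝ := α + 1 + (β + 1) + 1 with hL
  obtain ⟨B0, hB0, b0⟩ := rho_bound hl hg (2 * k) (e := k) (s := L) (by positivity)
    (by push_cast; linarith) (by push_cast; linarith) (by push_cast; linarith) (by push_cast; linarith)
  obtain ⟨B1, hB1, b1⟩ := rho_bound hl hg1 (2 * k) (e := k) (s := L + 1) (by positivity)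
    (by push_cast; linarith) (by push_cast; linarith) (by push_cast; linarith) (by push_cast; linarith)
  obtain ⟨B2, hB2, b2⟩ := rho_bound hl hg2 (2 * k) (e := k) (s := L + 1 + 1) (by positivity)
    (by push_cast; linarith) (by push_cast; linarith) (by push_cast; linarith) (by push_cast; linarith)
  obtain ⟨D1, hD1, d1⟩ := E1 ha hb
  obtain ⟨D2, hD2, d2⟩ := E2 ha hb
  obtain ⟨D3, hD3, d3⟩ := E3 ha hb
  have hr1 : ∀ z < 1, HasDerivAt (rho (2 * k) g) (rho (2 * k) g1 z) z :=
    fun z hz => rho_deriv hl hg _ hg1 hd1 hz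
  have hr2 : ∀ z < 1, HasDerivAt (rho (2 * k) g1) (rho (2 * k) g2 z) z :=
    fun z hz => rho_deriv hl hg1 _ hg2 hd2 hz
  have hr1c := rho_cont hl hg1 (2 * k)
  have hr2c := rho_cont hl hg2 (2 * k)
  set M := 1 + 2 * |α + 1 / 2| + 2 * |β + 1 / 2| with hM
  have hM0 : 0 < M := by positivity
  set M' := |α + β + 2| with hM'
  have hM'0 : 0 ≤ M' := abs_nonneg _
  have b1' : ∀ z < 1, -1 ≤ z → |rho (2 * k) g1 z| ≤ B1 * (1 - z) ^ (-(L + 1 / 2 + 1 / 2)) := by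
    intro z hz hz'; rw [show L + 1 / 2 + 1 / 2 = L + 1 by ring]; exact b1 z hz hz'
  set X0 := B0 * D1 with hX0
  set X1 := B1 * D2 with hX1
  set X2 := (B2 + B1) * D3 with hX2
  have x0 : 0 < X0 := by positivity
  have x1 : 0 < X1 := by positivity
  have x2 : 0 < X2 := by positivity
  set T0 := X1 * 16 + M * (X0 * 4) with hT0
  set T1 := X1 * 8 + X2 * 16 + (M' * (X0 * 2) + M * (X1 * 8)) with hT1
  set T2 := X1 * 8 + M * (X0 * 2) + (X2 * 16 + M * (X1 * 8)) with hT2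
  have t0 : 0 < T0 := by positivity
  have t1 : 0 < T1 := by positivity
  have t2 : 0 < T2 := by positivity
  clear_value T0 T1 T2 X0 X1 X2 M M' c
  refine ⟨|c| * (T0 + T1 + T2) + 1, by positivity, fun θ hθ φ hφ h => ?_⟩
  have hP := PP_pos hθ hφ (α + 1) (β + 1)
  have hw := ww_pos hθ hφ
  have hq := qq_pos hθ hφ h
  have sθ : 0 < sin θ := sin_pos_of_mem_Ioo hθ
  have sφ : 0 < sin φ := sin_pos_of_mem_Ioo hφ
  obtain ⟨w1, w2⟩ := sin_le_ww hθ hφ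
  obtain ⟨l1, l2, l3, l4, l5⟩ := alg hP hw hq (qq_le_one hθ hφ) (qq_le hθ hφ h) sφ.le w2 sθ.le w1
  obtain ⟨l1', l2', -⟩ := alg hP hw hq (qq_le_one hθ hφ) (qq_le hθ hφ h) sθ.le w1 sφ.le w2
  have hS : 0 < SZ α β θ φ := by unfold SZ; positivity
  have hG : 0 < GR α β θ φ := by unfold GR; positivity
  have F0 : |FF ν (rho (2 * k) g) θ φ| ≤ X0 * (PP (α + 1) (β + 1) θ φ / qq θ φ) :=
    ((FF_le hθ hφ h b0).trans (mul_le_mul_of_nonneg_left (d1 θ hθ φ hφ h) hB0.le)).trans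
      (le_of_eq (by rw [hX0, mul_assoc]))
  have F1 : |FFt ν (rho (2 * k) g1) θ φ| ≤ X1 * (PP (α + 1) (β + 1) θ φ / (ww θ φ * qq θ φ)) :=
    ((FFt_le hθ hφ h b1').trans (mul_le_mul_of_nonneg_left (d2 θ hθ φ hφ h) hB1.le)).trans
      (le_of_eq (by rw [hX1, mul_assoc]))
  have F1' : |FFt ν (rho (2 * k) g1) φ θ| ≤ X1 * (PP (α + 1) (β + 1) θ φ / (ww θ φ * qq θ φ)) :=
    ((FFt_le hφ hθ h.symm b1').trans (mul_le_mul_of_nonneg_left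
      ((le_of_eq (FF_symm _ _ _ _)).trans (d2 θ hθ φ hφ h)) hB1.le)).trans (le_of_eq (by rw [hX1, mul_assoc]))
  have F2 : |FFtt ν (rho (2 * k) g1) (rho (2 * k) g2) θ φ| ≤ X2 * (PP (α + 1) (β + 1) θ φ / (ww θ φ * qq θ φ ^ 2)) :=
    ((FFtt_le hθ hφ h b1 b2).trans (mul_le_mul_of_nonneg_left (d3 θ hθ φ hφ h) (by positivity))).trans
      (le_of_eq (by rw [hX2, mul_assoc]))
  have F2' : |FFtx ν (rho (2 * k) g1) (rho (2 * k) g2) θ φ| ≤ X2 * (PP (α + 1) (β + 1) θ φ / (ww θ φ * qq θ φ ^ 2)) :=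
    ((FFtx_le hθ hφ h b1 b2).trans (mul_le_mul_of_nonneg_left (d3 θ hθ φ hφ h) (by positivity))).trans
      (le_of_eq (by rw [hX2, mul_assoc]))
  have z1 := mul_abs_le (by positivity) x1.le F1 l1
  have z2 := mul_abs_le sφ.le x0.le F0 l5
  have m1 := mul_abs_le sφ.le x1.le F1 l2
  have m1' := mul_abs_le sθ.le x1.le F1 l2'
  have m1'' := mul_abs_le sφ.le x1.le F1' l2
  have m2 := mul_abs_le (by positivity) x2.le F2 l4
  have m2' := mul_abs_le (by positivity) x2.le F2' l4
  have m0 := mul_abs_le zero_le_one x0.le F0 (c := 2) (Y := GR α β θ φ) (by rw [one_mul]; exact l3)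
  change _ ≤ _ * SZ α β θ φ at z1 z2
  change _ ≤ _ * GR α β θ φ at m1 m1' m1'' m2 m2'
  rw [one_mul] at m0
  have cc := abs_nonneg c
  have cθ := abs_cos_le_one θ
  have cφ := abs_cos_le_one φ
  have hmm := abs_mm_le α β θ
  rw [← hM] at hmm
  constructor
  · rw [hrep θ hθ φ hφ h, abs_mul c]
    have : |sin φ * (sin θ * FFt ν (rho (2 * k) g1) θ φ + mm α β θ * FF ν (rho (2 * k) g) θ φ)| ≤
        T0 * SZ α β θ φ := by
      rw [mul_add, hT0, add_mul]
      refine (abs_add_le _ _).trans (add_le_add ?_ ?_)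
      · rw [abs_mul, abs_mul, abs_of_pos sφ, abs_of_pos sθ, ← mul_assoc]; exact z1
      · rw [abs_mul, abs_mul, abs_of_pos sφ, mul_left_comm, mul_assoc M]
        exact mul_le_mul hmm z2 (by positivity) hM0.le
    refine (mul_le_mul_of_nonneg_left this cc).trans ?_
    rw [← mul_assoc]
    apply mul_le_mul_of_nonneg_right _ hS.le
    have e1 : 0 ≤ |c| * (T1 + T2) := by positivity
    have e2 : |c| * (T0 + T1 + T2) + 1 = |c| * T0 + |c| * (T1 + T2) + 1 := by ring
    rw [e2]; linarith
  · have dθ := ((((hasDerivAt_sin θ).mul (hasDerivAt_FFt (ν := ν) hr2 hr2c hθ hφ h)).add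
      ((hasDerivAt_mm α β θ).mul (hasDerivAt_FF (ν := ν) hr1 hr1c hθ hφ h))).const_mul (sin φ)).const_mul c
    have dθ' : HasDerivAt (fun θ' => rieszKer α β (2 * k + 1) θ' φ) _ θ := dθ.congr_of_eventuallyEq (by
      filter_upwards [mem_open hθ h] with x hx using hrep x hx.1 φ hφ hx.2)
    have dφ := ((hasDerivAt_sin φ).mul (((hasDerivAt_FFt' (ν := ν) hr2 hr2c hθ hφ h).const_mul (sin θ)).add
      ((hasDerivAt_FF' (ν := ν) hr1 hr1c hθ hφ h).const_mul (mm α β θ)))).const_mul c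
    have dφ' : HasDerivAt (fun φ' => rieszKer α β (2 * k + 1) θ φ') _ φ := dφ.congr_of_eventuallyEq (by
      filter_upwards [mem_open hφ h.symm] with x hx using hrep θ hθ x hx.1 hx.2.symm)
    rw [dθ'.deriv, dφ'.deriv]
    have n1 : |c * (sin φ * (cos θ * FFt ν (rho (2 * k) g1) θ φ +
        sin θ * FFtt ν (rho (2 * k) g1) (rho (2 * k) g2) θ φ +
        (-(α + β + 2) * sin θ * FF ν (rho (2 * k) g) θ φ + mm α β θ * FFt ν (rho (2 * k) g1) θ φ)))|
        ≤ |c| * (T1 * GR α β θ φ) := by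
      rw [abs_mul c]
      refine mul_le_mul_of_nonneg_left ?_ cc
      rw [mul_add, mul_add, mul_add, hT1, add_mul, add_mul, add_mul]
      refine (abs_add_le _ _).trans (add_le_add ((abs_add_le _ _).trans (add_le_add ?_ ?_))
        ((abs_add_le _ _).trans (add_le_add ?_ ?_)))
      · rw [abs_mul, abs_mul, abs_of_pos sφ]
        refine le_trans ?_ m1
        exact mul_le_mul_of_nonneg_left (mul_le_of_le_one_left (abs_nonneg _) cθ) sφ.le
      · rw [abs_mul, abs_mul, abs_of_pos sφ, abs_of_pos sθ, ← mul_assoc]; exact m2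
      · rw [abs_mul, abs_mul, abs_mul, abs_neg, abs_of_pos sφ, abs_of_pos sθ, ← hM']
        have q1 : sin φ * sin θ ≤ 1 := mul_le_one₀ (sin_le_one _) sθ.le (sin_le_one _)
        calc sin φ * (M' * sin θ * |FF ν (rho (2 * k) g) θ φ|)
            = M' * ((sin φ * sin θ) * |FF ν (rho (2 * k) g) θ φ|) := by ring
          _ ≤ M' * |FF ν (rho (2 * k) g) θ φ| :=
            mul_le_mul_of_nonneg_left (mul_le_of_le_one_left (abs_nonneg _) q1) hM'0
          _ ≤ M' * (X0 * 2 * GR α β θ φ) := mul_le_mul_of_nonneg_left m0 hM'0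
          _ = _ := by ring
      · rw [abs_mul, abs_mul, abs_of_pos sφ, mul_left_comm, mul_assoc M]
        exact mul_le_mul hmm m1 (by positivity) hM0.le
    have n2 : |c * (cos φ * (sin θ * FFt ν (rho (2 * k) g1) θ φ + mm α β θ * FF ν (rho (2 * k) g) θ φ) +
        sin φ * (sin θ * FFtx ν (rho (2 * k) g1) (rho (2 * k) g2) θ φ +
          mm α β θ * FFt ν (rho (2 * k) g1) φ θ))|
        ≤ |c| * (T2 * GR α β θ φ) := by
      rw [abs_mul c]
      refine mul_le_mul_of_nonneg_left ?_ cc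
      rw [mul_add (sin φ), hT2, add_mul, add_mul, add_mul]
      refine (abs_add_le _ _).trans (add_le_add ?_
        ((abs_add_le _ _).trans (add_le_add ?_ ?_)))
      · rw [abs_mul]
        refine (mul_le_of_le_one_left (abs_nonneg _) cφ).trans ?_
        refine (abs_add_le _ _).trans (add_le_add ?_ ?_)
        · rw [abs_mul, abs_of_pos sθ]; exact m1'
        · rw [abs_mul, mul_assoc M]
          exact mul_le_mul hmm m0 (abs_nonneg _) hM0.le
      · rw [abs_mul, abs_mul, abs_of_pos sφ, abs_of_pos sθ, ← mul_assoc]; exact m2'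
      · rw [abs_mul, abs_mul, abs_of_pos sφ, mul_left_comm, mul_assoc M]
        exact mul_le_mul hmm m1'' (by positivity) hM0.le
    refine (add_le_add n1 n2).trans ?_
    have e1 : 0 ≤ |c| * T0 * GR α β θ φ := by positivity
    have e2 : (|c| * (T0 + T1 + T2) + 1) * GR α β θ φ = |c| * (T1 * GR α β θ φ) + |c| * (T2 * GR α β θ φ) +
      |c| * T0 * GR α β θ φ + GR α β θ φ := by ring
    rw [e2]; linarith

lemma final_est {α β : ℝ} (hα : -1 < α) (hβ : -1 < β) (N : ℕ) (hN : 1 ≤ N) : ∃ C, 0 < C ∧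
    ∀ θ ∈ Ioo 0 π, ∀ φ ∈ Ioo 0 π, θ ≠ φ →
      |rieszKer α β N θ φ| ≤ C / (ballMeasure α β θ |θ - φ|).toReal ∧
      |deriv (fun θ' => rieszKer α β N θ' φ) θ| +
        |deriv (fun φ' => rieszKer α β N θ φ') φ| ≤
          C / (|θ - φ| * (ballMeasure α β θ |θ - φ|).toReal) := by
  obtain ⟨K, hK, kb⟩ := ball_final hα hβ
  have main : ∃ C, 0 < C ∧ ∀ θ ∈ Ioo 0 π, ∀ φ ∈ Ioo 0 π, θ ≠ φ →
      |rieszKer α β N θ φ| ≤ C * SZ α β θ φ ∧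
      |deriv (fun θ' => rieszKer α β N θ' φ) θ| +
        |deriv (fun φ' => rieszKer α β N θ φ') φ| ≤ C * GR α β θ φ := by
    rcases Nat.even_or_odd' N with ⟨k, rfl | rfl⟩
    · obtain ⟨j, rfl⟩ : ∃ j, k = j + 1 := ⟨k - 1, by omega⟩
      exact even_est hα hβ j
    · exact odd_est hα hβ k
  obtain ⟨C, hC, m⟩ := main
  refine ⟨C * K, by positivity, fun θ hθ φ hφ h => ?_⟩
  obtain ⟨m1, m2⟩ := m θ hθ φ hφ h
  obtain ⟨k1, k2⟩ := kb θ hθ φ hφ h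
  rw [mul_div_assoc, mul_div_assoc]
  exact ⟨m1.trans (mul_le_mul_of_nonneg_left k1 hC.le), m2.trans (mul_le_mul_of_nonneg_left k2 hC.le)⟩

end JR

/-- Theorem (standard Calderón–Zygmund estimates for the Riesz kernel `R̃_N^{α,β}`). -/
theorem rieszKer_standard_estimates (α β : ℝ) (hα : -1 < α) (hβ : -1 < β)
    (N : ℕ) (hN : 1 ≤ N) :
    ∃ C : ℝ, 0 < C ∧ ∀ θ ∈ Ioo (0 : ℝ) π, ∀ φ ∈ Ioo (0 : ℝ) π, θ ≠ φ →
      |rieszKer α β N θ φ| ≤ C / (ballMeasure α β θ |θ - φ|).toReal ∧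
      |deriv (fun θ' => rieszKer α β N θ' φ) θ| +
          |deriv (fun φ' => rieszKer α β N θ φ') φ| ≤
        C / (|θ - φ| * (ballMeasure α β θ |θ - φ|).toReal) := by
  exact JR.final_est hα hβ N hN
end
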